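/- There exists a connected, bounded-degree, countably infinite simple graph G with a root vertex g₀ such that the simple random walk on G started at g₀ is transient (almost surely every vertex is visited only finitely often), and yet, almost surely, the path of the walk has only finitely many cutpoints. -/

import Mathlib

open MeasureTheory
open scoped Classical

/-- `μ` is the law on trajectory space `ℕ → S` of the Markov chain with (countable-state)
transition probabilities `p` started at `x₀`: it is a probability measure, it starts at
`x₀`, and it satisfies the Markov property on cylinder events. -/
def IsMarkovChain {S : Type*} [MeasurableSpace S] (p : S → S → ENNReal) (x₀ : S)
    (μ : Measure (ℕ → S)) : Prop :=
  IsProbabilityMeasure μ ∧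
  μ {ω | ω 0 = x₀} = 1 ∧
  ∀ (n : ℕ) (v : ℕ → S),
    μ {ω | ∀ i ≤ n + 1, ω i = v i} = μ {ω | ∀ i ≤ n, ω i = v i} * p (v n) (v (n + 1))

/-- A vertex `v ≠ g₀` of a graph `H` rooted at `g₀` is a *cutpoint* if after deleting `v`
from `H` the connected component of `g₀` in the remaining graph is finite. -/
def IsCutpoint {V : Type*} (H : SimpleGraph V) (g₀ v : V) : Prop :=
  ∃ hv : v ≠ g₀,
    {u : {u : V // u ≠ v} |
      (H.induce {u : V | u ≠ v}).Reachable ⟨g₀, Ne.symm hv⟩ u}.Finite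

namespace CutWalk
open scoped ENNReal

/-- Prepend a value to a sequence. -/
def consN {α : Type*} (a : α) (ω : ℕ → α) : ℕ → α
  | 0 => a
  | n + 1 => ω n

@[simp] theorem consN_zero {α : Type*} (a : α) (ω : ℕ → α) : consN a ω 0 = a := rfl
@[simp] theorem consN_succ {α : Type*} (a : α) (ω : ℕ → α) (n : ℕ) : consN a ω (n+1) = ω n := rfl

theorem measurable_consN {α : Type*} [MeasurableSpace α] :
    Measurable (fun p : α × (ℕ → α) => consN p.1 p.2) := by
  refine measurable_pi_lambda _ fun n => ?_
  cases n with
  | zero => exact measurable_fst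
  | succ n => simp only [consN_succ]; fun_prop

theorem measurable_consN_right {α : Type*} [MeasurableSpace α] (a : α) :
    Measurable (fun ω : ℕ → α => consN a ω) := by
  refine measurable_pi_lambda _ fun n => ?_
  cases n with
  | zero => exact measurable_const
  | succ n => simp only [consN_succ]; fun_prop

theorem map_consN {α : Type*} [MeasurableSpace α] (ν : Measure α) [IsProbabilityMeasure ν] :
    (ν.prod (Measure.infinitePi fun _ : ℕ => ν)).map (fun p => consN p.1 p.2)
      = Measure.infinitePi (fun _ : ℕ => ν) := by
  refine Measure.eq_infinitePi _ fun s t ht => ?_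
  obtain ⟨N, hN⟩ : ∃ N, s ⊆ Finset.range (N+1) := by
    refine ⟨s.sup id, fun i hi => ?_⟩
    have := Finset.le_sup (f := id) hi
    simp only [id] at this
    simp; omega
  set t' : ℕ → Set α := fun i => if i ∈ s then t i else Set.univ with ht'
  have hm : ∀ i, MeasurableSet (t' i) := by
    intro i; simp only [ht']; split_ifs
    · exact ht i
    · exact MeasurableSet.univ
  have e1 : (s : Set ℕ).pi t = Set.pi (Finset.range (N+1) : Set ℕ) t' := by
    ext x
    simp only [Set.mem_pi, ht']
    constructor
    · intro h i _
      split_ifs with hi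
      · exact h i hi
      · trivial
    · intro h i hi
      have := h i (hN hi)
      rwa [if_pos (by exact hi)] at this
  have e2 : ∏ i ∈ s, ν (t i) = ∏ i ∈ Finset.range (N+1), ν (t' i) := by
    rw [← Finset.prod_subset hN]
    · refine Finset.prod_congr rfl fun i hi => ?_
      simp [ht', hi]
    · intro i _ hi
      simp [ht', hi]
  rw [e1, e2, Measure.map_apply measurable_consN
    (MeasurableSet.pi (Finset.countable_toSet _) fun i _ => hm i)]
  have e3 : (fun p : α × (ℕ → α) => consN p.1 p.2) ⁻¹' (Set.pi (Finset.range (N+1) : Set ℕ) t')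
      = t' 0 ×ˢ Set.pi (Finset.range N : Set ℕ) (fun i => t' (i+1)) := by
    ext ⟨a, ω⟩
    simp only [Set.mem_preimage, Set.mem_pi, Set.mem_prod, Finset.mem_coe, Finset.mem_range]
    constructor
    · intro h
      exact ⟨h 0 (by omega), fun i hi => h (i+1) (by omega)⟩
    · rintro ⟨h0, h⟩ i hi
      cases i with
      | zero => exact h0
      | succ i => exact h i (by omega)
  rw [e3, Measure.prod_prod, Measure.infinitePi_pi _ (fun i _ => hm (i+1)),
    Finset.prod_range_succ', mul_comm]

/-- uniform measure on six points -/
noncomputable def nu6 : Measure (Fin 6) := (6 : ℝ≥0∞)⁻¹ • Measure.count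

instance : IsProbabilityMeasure nu6 := ⟨by
  simp [nu6, Measure.count_univ]
  exact ENNReal.inv_mul_cancel (by norm_num) (by norm_num)⟩

theorem lintegral_nu6 (f : Fin 6 → ℝ≥0∞) : ∫⁻ a, f a ∂nu6 = (6 : ℝ≥0∞)⁻¹ * ∑ a, f a := by
  rw [nu6, lintegral_smul_measure, lintegral_count, tsum_fintype, smul_eq_mul]

/-- driving noise -/
noncomputable def P6 : Measure (ℕ → Fin 6) := Measure.infinitePi fun _ => nu6

instance : IsProbabilityMeasure P6 := by unfold P6; infer_instance

/-- Width profile. -/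
structure Prof where
  w : ℕ → ℕ
  w0 : w 0 = 0
  w1 : w 1 = 1
  step : ∀ n, w (n+1) = w n ∨ w (n+1) = w n + 1

variable (π : Prof)

/-- up-probability -/
noncomputable def up (n : ℕ) : ℝ≥0∞ :=
  if n = 0 then 1 else if π.w n = π.w (n-1) + 1 then 2/3 else 1/2
/-- down-probability -/
noncomputable def dn (n : ℕ) : ℝ≥0∞ :=
  if n = 0 then 0 else if π.w n = π.w (n-1) + 1 then 1/3 else 1/2

/-- threshold -/
noncomputable def thr (n : ℕ) : ℕ :=
  if n = 0 then 6 else if π.w n = π.w (n-1) + 1 then 4 else 3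

noncomputable def stp (n : ℕ) (a : Fin 6) : ℕ := if a.val < thr π n then n+1 else n-1

/-- radial walk driven by noise -/
noncomputable def wlk (x : ℕ) (ω : ℕ → Fin 6) : ℕ → ℕ
  | 0 => x
  | t+1 => stp π (wlk x ω t) (ω t)

theorem wlk_consN (x : ℕ) (a : Fin 6) (ω : ℕ → Fin 6) :
    wlk π x (consN a ω) = consN x (wlk π (stp π x a) ω) := by
  funext t
  induction t with
  | zero => rfl
  | succ t ih =>
    simp only [wlk, consN_succ]
    rw [ih]
    cases t with
    | zero => simp [wlk]
    | succ t => simp [wlk]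

theorem measurable_wlk (x : ℕ) : Measurable (wlk π x) := by
  refine measurable_pi_lambda _ fun t => ?_
  induction t with
  | zero => exact measurable_const
  | succ t ih =>
    have : Measurable (fun p : ℕ × Fin 6 => stp π p.1 p.2) := measurable_of_countable _
    exact this.comp (ih.prodMk (measurable_pi_apply t))

/-- law of the radial walk -/
noncomputable def R (x : ℕ) : Measure (ℕ → ℕ) := P6.map (wlk π x)

instance (x : ℕ) : IsProbabilityMeasure (R π x) := by
  unfold R
  exact Measure.isProbabilityMeasure_map (measurable_wlk π x).aemeasurable

theorem lint_step (x : ℕ) (f : (ℕ → ℕ) → ℝ≥0∞) (hf : Measurable f) :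
    ∫⁻ ω, f ω ∂(R π x) = up π x * ∫⁻ ω, f (consN x ω) ∂(R π (x+1))
      + dn π x * ∫⁻ ω, f (consN x ω) ∂(R π (x-1)) := by
  have hfc : Measurable fun ω => f (consN x ω) := hf.comp (measurable_consN_right x)
  have hfw : Measurable fun ω => f (wlk π x ω) := hf.comp (measurable_wlk π x)
  have h1 : ∫⁻ ω, f ω ∂(R π x) = (6 : ℝ≥0∞)⁻¹ * ∑ a, ∫⁻ ω, f (consN x ω) ∂(R π (stp π x a)) := by
    rw [R, lintegral_map hf (measurable_wlk π x)]
    have : P6 = (nu6.prod P6).map (fun p => consN p.1 p.2) := (map_consN nu6).symm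
    rw [this, lintegral_map hfw measurable_consN,
      lintegral_prod (fun p : Fin 6 × (ℕ → Fin 6) => f (wlk π x (consN p.1 p.2)))
        (hfw.comp measurable_consN).aemeasurable, lintegral_nu6]
    congr 1
    refine Finset.sum_congr rfl fun a _ => ?_
    rw [R, lintegral_map hfc (measurable_wlk π _)]
    simp only [wlk_consN]
  rw [h1]
  set g : ℕ → ℝ≥0∞ := fun y => ∫⁻ ω, f (consN x ω) ∂(R π y) with hg
  have h6 : (6:ℝ≥0∞)⁻¹ * 6 = 1 := ENNReal.inv_mul_cancel (by norm_num) (by norm_num)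
  have q2 : (6:ℝ≥0∞)⁻¹ * 3 = 1/2 := by
    rw [ENNReal.eq_div_iff (by norm_num) (by norm_num), mul_comm, mul_assoc]
    norm_num [h6]
  have q4 : (6:ℝ≥0∞)⁻¹ * 4 = 2/3 := by
    rw [ENNReal.eq_div_iff (by norm_num) (by norm_num), mul_comm, mul_assoc]
    norm_num
    rw [show (12:ℝ≥0∞) = 6 * 2 by norm_num, ← mul_assoc, h6, one_mul]
  have q3 : (6:ℝ≥0∞)⁻¹ * 2 = 1/3 := by
    rw [ENNReal.eq_div_iff (by norm_num) (by norm_num), mul_comm, mul_assoc]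
    norm_num [h6]
  change (6:ℝ≥0∞)⁻¹ * ∑ a, g (stp π x a) = up π x * g (x+1) + dn π x * g (x-1)
  simp only [Fin.sum_univ_six, stp]
  by_cases h0 : x = 0
  · simp [h0, thr, up, dn]
    calc (6:ℝ≥0∞)⁻¹ * (g 1 + g 1 + g 1 + g 1 + g 1 + g 1) = ((6:ℝ≥0∞)⁻¹ * 6) * g 1 := by ring
      _ = g 1 := by rw [h6, one_mul]
  · by_cases h : π.w x = π.w (x-1) + 1
    · have ht : thr π x = 4 := by simp [thr, h0, h]
      have hu : up π x = 2/3 := by simp only [up, h0, h, if_true, if_false]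
      have hd : dn π x = 1/3 := by simp only [dn, h0, h, if_true, if_false]
      rw [hu, hd, ht, ← q4, ← q3]
      simp
      ring
    · have ht : thr π x = 3 := by simp [thr, h0, h]
      have hu : up π x = 1/2 := by simp only [up, h0, h, if_false]
      have hd : dn π x = 1/2 := by simp only [dn, h0, h, if_false]
      rw [hu, hd, ht, ← q2]
      simp
      ring

theorem R_zero (x : ℕ) : ∀ᵐ ω ∂(R π x), ω 0 = x := by
  rw [R, ae_map_iff (measurable_wlk π x).aemeasurable (by measurability)]
  exact Filter.Eventually.of_forall fun ω => rfl

theorem R_path (x : ℕ) : ∀ᵐ ω ∂(R π x), ω 0 = x ∧ ∀ t, (ω (t+1) = ω t + 1 ∨ ω (t+1) + 1 = ω t) := by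
  rw [R, ae_map_iff (measurable_wlk π x).aemeasurable (by measurability)]
  refine Filter.Eventually.of_forall fun ω => ⟨rfl, fun t => ?_⟩
  simp only [wlk, stp]
  have := (ω t).isLt
  split_ifs with h
  · left; trivial
  · right
    have : wlk π x ω t ≠ 0 := by
      intro h0
      rw [h0] at h
      simp [thr] at h
    omega

/-- one-step for sets -/
theorem meas_step (x : ℕ) (E : Set (ℕ → ℕ)) (hE : MeasurableSet E) :
    R π x E = up π x * R π (x+1) ((fun ω => consN x ω) ⁻¹' E)
      + dn π x * R π (x-1) ((fun ω => consN x ω) ⁻¹' E) := by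
  have hc := measurable_consN_right (α := ℕ) x
  have := lint_step π x (E.indicator 1) (measurable_one.indicator hE)
  rw [lintegral_indicator_one hE] at this
  rw [this, ← lintegral_indicator_one (hc hE), ← lintegral_indicator_one (hc hE)]
  rfl

theorem up_add_dn (x : ℕ) : up π x + dn π x = 1 := by
  unfold up dn
  split_ifs
  · simp
  · rw [← ENNReal.add_div]; norm_num; exact ENNReal.div_self (by norm_num) (by norm_num)
  · exact ENNReal.add_halves 1

/-- shift -/
def sh {α : Type*} (t : ℕ) (ω : ℕ → α) : ℕ → α := fun n => ω (t + n)

@[simp] theorem sh_apply {α : Type*} (t : ℕ) (ω : ℕ → α) (n : ℕ) : sh t ω n = ω (t+n) := rfl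

theorem measurable_sh {α : Type*} [MeasurableSpace α] (t : ℕ) :
    Measurable (sh t : (ℕ → α) → (ℕ → α)) :=
  measurable_pi_lambda _ fun n => measurable_pi_apply _

/-- depends on coordinates `≤ t` -/
def Pre {β : Type*} (t : ℕ) (f : (ℕ → ℕ) → β) : Prop :=
  ∀ ω ω', (∀ i ≤ t, ω i = ω' i) → f ω = f ω'

theorem markov (t : ℕ) : ∀ (x : ℕ) (f g : (ℕ → ℕ) → ℝ≥0∞), Measurable f → Measurable g → Pre t f →
    ∫⁻ ω, f ω * g (sh t ω) ∂(R π x) = ∫⁻ ω, f ω * (∫⁻ η, g η ∂(R π (ω t))) ∂(R π x) := by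
  induction t with
  | zero =>
    intro x f g hf hg hp
    have hs : ∀ ω : ℕ → ℕ, sh 0 ω = ω := fun ω => by funext n; simp [sh]
    have hc : ∀ᵐ ω ∂(R π x), f ω = f (fun _ => x) := by
      filter_upwards [R_zero π x] with ω hω
      exact hp _ _ fun i hi => by
        have : i = 0 := by omega
        rw [this]; exact hω
    have e1 : ∫⁻ ω, f ω * g (sh 0 ω) ∂(R π x) = ∫⁻ ω, f (fun _ => x) * g ω ∂(R π x) := by
      refine lintegral_congr_ae ?_
      filter_upwards [hc] with ω h
      rw [h, hs]
    have e2 : ∫⁻ ω, f ω * (∫⁻ η, g η ∂(R π (ω 0))) ∂(R π x)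
        = ∫⁻ ω, f (fun _ => x) * (∫⁻ η, g η ∂(R π x)) ∂(R π x) := by
      refine lintegral_congr_ae ?_
      filter_upwards [hc, R_zero π x] with ω h h0
      simp only [h, h0]
    rw [e1, e2, lintegral_const_mul _ hg, lintegral_const, measure_univ, mul_one]
  | succ t ih =>
    intro x f g hf hg hp
    have hG : Measurable fun n : ℕ => ∫⁻ η, g η ∂(R π n) := measurable_of_countable _
    have hc := measurable_consN_right (α := ℕ) x
    rw [lint_step π x (fun ω => f ω * g (sh (t+1) ω)) (hf.mul (hg.comp (measurable_sh _))),
      lint_step π x (fun ω => f ω * ∫⁻ η, g η ∂(R π (ω (t+1))))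
        (hf.mul (hG.comp (measurable_pi_apply _)))]
    have key : ∀ ω, sh (t+1) (consN x ω) = sh t ω := by
      intro ω; funext n
      simp only [sh]
      rw [show t + 1 + n = (t + n) + 1 by omega, consN_succ]
    have hp' : Pre t fun ω => f (consN x ω) := by
      intro ω ω' h
      refine hp _ _ fun i hi => ?_
      cases i with
      | zero => rfl
      | succ i => exact h i (by omega)
    simp only [key, consN_succ]
    rw [ih (x+1) (fun ω => f (consN x ω)) g (hf.comp hc) hg hp',
      ih (x-1) (fun ω => f (consN x ω)) g (hf.comp hc) hg hp']

theorem Pre.indicator {t : ℕ} {A : Set (ℕ → ℕ)} (h : Pre t (fun ω => ω ∈ A)) :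
    Pre t (A.indicator (1 : (ℕ → ℕ) → ℝ≥0∞)) := by
  intro ω ω' hh
  have := h ω ω' hh
  simp only [eq_iff_iff] at this
  by_cases h1 : ω ∈ A
  · rw [Set.indicator_of_mem h1, Set.indicator_of_mem (this.1 h1)]; rfl
  · rw [Set.indicator_of_notMem h1, Set.indicator_of_notMem (fun h2 => h1 (this.2 h2))]

/-- Markov property with function weight and a fixed position at time `t`. -/
theorem markov_fun (t x y : ℕ) (f : (ℕ → ℕ) → ℝ≥0∞) (hf : Measurable f) (hp : Pre t f)
    (hy : ∀ ω, f ω ≠ 0 → ω t = y) (E : Set (ℕ → ℕ)) (hE : MeasurableSet E) :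
    ∫⁻ ω, f ω * (E.indicator 1 (sh t ω)) ∂(R π x) = (∫⁻ ω, f ω ∂(R π x)) * R π y E := by
  rw [markov π t x f _ hf (measurable_one.indicator hE) hp, ← lintegral_mul_const _ hf]
  refine lintegral_congr fun ω => ?_
  by_cases h : f ω = 0
  · simp [h]
  · rw [hy ω h, lintegral_indicator_one hE]

theorem markov_set (t x y : ℕ) (A E : Set (ℕ → ℕ)) (hA : MeasurableSet A)
    (hp : Pre t (fun ω => ω ∈ A)) (hy : ∀ ω ∈ A, ω t = y) (hE : MeasurableSet E) :
    R π x (A ∩ sh t ⁻¹' E) = R π x A * R π y E := by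
  have := markov_fun π t x y (A.indicator 1) (measurable_one.indicator hA) hp.indicator
    (fun ω h => hy ω (by by_contra h1; exact h (Set.indicator_of_notMem h1 _))) E hE
  rw [lintegral_indicator_one hA] at this
  rw [← this, ← lintegral_indicator_one (hA.inter (measurable_sh t hE))]
  refine lintegral_congr fun ω => ?_
  by_cases h1 : ω ∈ A <;> by_cases h2 : sh t ω ∈ E <;> simp [h1, h2, Set.indicator]

/-- last-visit lemma -/
theorem last_visit (x y : ℕ) (A : ℕ → Set (ℕ → ℕ)) (E : Set (ℕ → ℕ)) (hA : ∀ t, MeasurableSet (A t))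
    (hp : ∀ t, Pre t (fun ω => ω ∈ A t)) (hy : ∀ t, ∀ ω ∈ A t, ω t = y) (hE : MeasurableSet E)
    (hd : ∀ s t ω, s < t → ω ∈ A s → ω ∈ A t → sh s ω ∉ E) :
    (∑' t, R π x (A t)) * R π y E ≤ 1 := by
  rw [← ENNReal.tsum_mul_right]
  calc ∑' t, R π x (A t) * R π y E = ∑' t, R π x (A t ∩ sh t ⁻¹' E) := by
        refine tsum_congr fun t => ?_
        rw [markov_set π t x y _ _ (hA t) (hp t) (hy t) hE]
    _ = R π x (⋃ t, A t ∩ sh t ⁻¹' E) := by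
        rw [measure_iUnion]
        · intro s t hst
          rw [Function.onFun, Set.disjoint_left]
          rintro ω ⟨h1, h2⟩ ⟨h3, h4⟩
          rcases lt_or_gt_of_ne hst with h | h
          · exact hd s t ω h h1 h3 h2
          · exact hd t s ω h h3 h1 h4
        · exact fun t => (hA t).inter (measurable_sh t hE)
    _ ≤ 1 := prob_le_one

/-- union bound with the Markov property -/
theorem union_markov (x y : ℕ) (A : ℕ → Set (ℕ → ℕ)) (E : Set (ℕ → ℕ)) (hA : ∀ t, MeasurableSet (A t))
    (hp : ∀ t, Pre t (fun ω => ω ∈ A t)) (hy : ∀ t, ∀ ω ∈ A t, ω t = y) (hE : MeasurableSet E) :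
    R π x {ω | ∃ t, ω ∈ A t ∧ sh t ω ∈ E} ≤ (∑' t, R π x (A t)) * R π y E := by
  rw [← ENNReal.tsum_mul_right]
  have : {ω | ∃ t, ω ∈ A t ∧ sh t ω ∈ E} = ⋃ t, A t ∩ sh t ⁻¹' E := by
    ext ω; simp
  rw [this]
  refine (measure_iUnion_le _).trans (le_of_eq (tsum_congr fun t => ?_))
  rw [markov_set π t x y _ _ (hA t) (hp t) (hy t) hE]

/-- strong Markov property at a disjointly described time -/
theorem strong_markov (x y : ℕ) (A : ℕ → Set (ℕ → ℕ)) (E : Set (ℕ → ℕ))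
    (hA : ∀ t, MeasurableSet (A t))
    (hp : ∀ t, Pre t (fun ω => ω ∈ A t)) (hy : ∀ t, ∀ ω ∈ A t, ω t = y) (hE : MeasurableSet E)
    (hd : ∀ s t ω, s < t → ω ∈ A s → ω ∉ A t) :
    R π x {ω | ∃ t, ω ∈ A t ∧ sh t ω ∈ E} = R π x {ω | ∃ t, ω ∈ A t} * R π y E := by
  have e1 : {ω | ∃ t, ω ∈ A t ∧ sh t ω ∈ E} = ⋃ t, A t ∩ sh t ⁻¹' E := by
    ext ω; simp
  have e2 : {ω | ∃ t, ω ∈ A t} = ⋃ t, A t := by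
    ext ω; simp
  have hdis : Pairwise (Function.onFun Disjoint A) := by
    intro s t hst
    rw [Function.onFun, Set.disjoint_left]
    intro ω h1 h3
    rcases lt_or_gt_of_ne hst with h | h
    · exact hd s t ω h h1 h3
    · exact hd t s ω h h3 h1
  rw [e1, e2, measure_iUnion hdis hA, measure_iUnion (fun s t hst => (hdis hst).mono
    Set.inter_subset_left Set.inter_subset_left) (fun t => (hA t).inter (measurable_sh t hE)),
    ← ENNReal.tsum_mul_right]
  exact tsum_congr fun t => markov_set π t x y _ _ (hA t) (hp t) (hy t) hE

end CutWalk

namespace CutWalk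
open scoped ENNReal

/-! ### deterministic nearest neighbour paths -/

theorem first_after {P : ℕ → Prop} {s : ℕ} (h : ∃ t, s ≤ t ∧ P t) :
    ∃ t, s ≤ t ∧ P t ∧ ∀ r, s ≤ r → r < t → ¬ P r := by
  refine ⟨Nat.find h, (Nat.find_spec h).1, (Nat.find_spec h).2, fun r hr hrt hP => ?_⟩
  exact Nat.find_min h hrt ⟨hr, hP⟩

theorem last_before {P : ℕ → Prop} {s t : ℕ} (hst : s ≤ t) (hs : P s) :
    ∃ r, s ≤ r ∧ r ≤ t ∧ P r ∧ ∀ k, r < k → k ≤ t → ¬ P k := by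
  induction t, hst using Nat.le_induction with
  | base => exact ⟨s, le_rfl, le_rfl, hs, fun k h1 h2 => by omega⟩
  | succ t hst ih =>
    by_cases h : P (t+1)
    · exact ⟨t+1, by omega, le_rfl, h, fun k h1 h2 => by omega⟩
    · obtain ⟨r, h1, h2, h3, h4⟩ := ih
      refine ⟨r, h1, by omega, h3, fun k hk hk' => ?_⟩
      rcases Nat.lt_or_ge t k with h5 | h5
      · rw [show k = t+1 by omega]; exact h
      · exact h4 k hk h5

/-- nearest neighbour path visiting every level finitely often -/
structure NP (ω : ℕ → ℕ) : Prop where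
  step : ∀ t, ω (t+1) = ω t + 1 ∨ ω (t+1) + 1 = ω t
  fin : ∀ p, {t | ω t = p}.Finite

theorem ivt_up {ω : ℕ → ℕ} (h : ∀ t, ω (t+1) = ω t + 1 ∨ ω (t+1) + 1 = ω t) {s t y : ℕ}
    (hst : s ≤ t) (h1 : ω s ≤ y) (h2 : y ≤ ω t) : ∃ r, s ≤ r ∧ r ≤ t ∧ ω r = y := by
  induction t, hst using Nat.le_induction with
  | base => exact ⟨s, le_rfl, le_rfl, by omega⟩
  | succ t hst ih =>
    by_cases hy : y ≤ ω t
    · obtain ⟨r, a, b, c⟩ := ih hy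
      exact ⟨r, a, by omega, c⟩
    · have := h t
      exact ⟨t+1, by omega, le_rfl, by omega⟩

theorem ivt_dn {ω : ℕ → ℕ} (h : ∀ t, ω (t+1) = ω t + 1 ∨ ω (t+1) + 1 = ω t) {s t y : ℕ}
    (hst : s ≤ t) (h1 : y ≤ ω s) (h2 : ω t ≤ y) : ∃ r, s ≤ r ∧ r ≤ t ∧ ω r = y := by
  induction t, hst using Nat.le_induction with
  | base => exact ⟨s, le_rfl, le_rfl, by omega⟩
  | succ t hst ih =>
    by_cases hy : ω t ≤ y
    · obtain ⟨r, a, b, c⟩ := ih hy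
      exact ⟨r, a, by omega, c⟩
    · have := h t
      exact ⟨t+1, by omega, le_rfl, by omega⟩

theorem NP.sh {ω : ℕ → ℕ} (h : NP ω) (s : ℕ) : NP (sh s ω) where
  step t := h.step (s + t)
  fin p := by
    refine Set.Finite.subset ((h.fin p).preimage (f := fun t => s + t)
      (fun a _ b _ hab => by simpa using hab)) ?_
    intro t ht
    exact ht

theorem NP.large {ω : ℕ → ℕ} (h : NP ω) (N : ℕ) : ∃ T, ∀ t, T ≤ t → N < ω t := by
  have hf : {t | ω t ≤ N}.Finite := by
    have : {t | ω t ≤ N} = ⋃ p ∈ Finset.range (N+1), {t | ω t = p} := by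
      ext t; simp
    rw [this]
    exact Set.Finite.biUnion (Finset.finite_toSet _) fun p _ => h.fin p
  obtain ⟨T, hT⟩ := hf.bddAbove
  refine ⟨T+1, fun t ht => ?_⟩
  by_contra hc
  have := hT (show t ∈ {t | ω t ≤ N} from by simpa using hc)
  omega

theorem NP.hits {ω : ℕ → ℕ} (h : NP ω) {s y : ℕ} (hy : ω s ≤ y) : ∃ t, s ≤ t ∧ ω t = y := by
  obtain ⟨T, hT⟩ := h.large y
  obtain ⟨r, h1, h2, h3⟩ := ivt_up h.step (le_max_left s T) hy (hT (max s T) (le_max_right _ _)).le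
  exact ⟨r, h1, h3⟩

/-! ### Potentials -/
variable (π : Prof)

noncomputable def aa (n : ℕ) : ℝ≥0∞ := ((2:ℝ≥0∞) ^ (π.w n))⁻¹

theorem aa_ne_zero (n : ℕ) : aa π n ≠ 0 := by
  unfold aa; exact ENNReal.inv_ne_zero.2 (ENNReal.pow_ne_top (by norm_num))

theorem aa_ne_top (n : ℕ) : aa π n ≠ ⊤ := by
  unfold aa; exact ENNReal.inv_ne_top.2 (pow_ne_zero _ (by norm_num))

noncomputable def rr (p q : ℕ) : ℝ≥0∞ := ∑ i ∈ Finset.Ico p q, aa π i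

noncomputable def HH (p : ℕ) : ℝ≥0∞ := ∑' i, aa π (p + i)

theorem balance {n : ℕ} (hn : n ≠ 0) : up π n * aa π n = dn π n * aa π (n-1) := by
  obtain ⟨m, rfl⟩ : ∃ m, n = m+1 := ⟨n-1, by omega⟩
  simp only [up, dn, aa, Nat.add_sub_cancel, if_neg hn]
  have h2 : (2:ℝ≥0∞) ^ π.w m ≠ 0 := pow_ne_zero _ (by norm_num)
  have h2' : (2:ℝ≥0∞) ^ π.w m ≠ ⊤ := ENNReal.pow_ne_top (by norm_num)
  rcases π.step m with h | h
  · rw [h]; simp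
  · rw [h]
    simp only [if_true]
    rw [pow_succ, ENNReal.mul_inv (Or.inl h2) (Or.inl h2'), mul_comm _ (2:ℝ≥0∞)⁻¹, ← mul_assoc]
    congr 1
    rw [ENNReal.div_eq_inv_mul, mul_assoc, ENNReal.mul_inv_cancel (by norm_num) (by norm_num),
      ENNReal.div_eq_inv_mul]

theorem rr_self (p : ℕ) : rr π p p = 0 := by simp [rr]
theorem rr_zero {p q : ℕ} (h : q ≤ p) : rr π p q = 0 := by
  simp [rr, Finset.Ico_eq_empty_of_le h]
theorem rr_succ {p q : ℕ} (h : p ≤ q) : rr π p (q+1) = rr π p q + aa π q := by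
  simp [rr, Finset.sum_Ico_succ_top h]
theorem rr_head {p q : ℕ} (h : p < q) : rr π p q = aa π p + rr π (p+1) q := by
  simp [rr, Finset.sum_eq_sum_Ico_succ_bot h]
theorem rr_add {p q s : ℕ} (h : p ≤ q) (h' : q ≤ s) : rr π p s = rr π p q + rr π q s := by
  simp [rr, Finset.sum_Ico_consecutive _ h h']
theorem rr_ne_top (p q : ℕ) : rr π p q ≠ ⊤ := by
  simp [rr, ENNReal.sum_eq_top, aa_ne_top]
theorem rr_ne_zero {p q : ℕ} (h : p < q) : rr π p q ≠ 0 := by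
  rw [rr_head π h]; simp [aa_ne_zero]
theorem HH_head (p : ℕ) : HH π p = aa π p + HH π (p+1) := by
  rw [HH, tsum_eq_zero_add' ENNReal.summable]
  simp [HH, add_assoc, add_comm 1]
theorem HH_split {p q : ℕ} (h : p ≤ q) : HH π p = rr π p q + HH π q := by
  induction q, h using Nat.le_induction with
  | base => simp [rr_self]
  | succ q hq ih => rw [ih, rr_succ π hq, HH_head π q]; ring
theorem HH_anti {p q : ℕ} (h : p ≤ q) : HH π q ≤ HH π p := by
  rw [HH_split π h]; exact le_add_self
theorem HH_ne_zero (p : ℕ) : HH π p ≠ 0 := by rw [HH_head]; simp [aa_ne_zero]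
theorem rr_le_HH (p q : ℕ) : rr π p q ≤ HH π p := by
  rcases le_total p q with h | h
  · rw [HH_split π h]; exact le_self_add
  · simp [rr_zero π h]

/-- Superharmonic comparison. -/
theorem superharm (T F : ℕ → Prop) (h : ℕ → ℝ≥0∞) (hT : ∀ x, T x → 1 ≤ h x)
    (hh : ∀ x, ¬ T x → ¬ F x → up π x * h (x+1) + dn π x * h (x-1) ≤ h x) (x : ℕ) :
    R π x {ω | ∃ t, T (ω t) ∧ ∀ s < t, ¬ F (ω s)} ≤ h x := by
  have hTm : ∀ t, Measurable fun ω : ℕ → ℕ => T (ω t) := fun t =>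
    (measurable_of_countable T).comp (measurable_pi_apply t)
  have hFm : ∀ t, Measurable fun ω : ℕ → ℕ => F (ω t) := fun t =>
    (measurable_of_countable F).comp (measurable_pi_apply t)
  have main : ∀ n x, R π x {ω | ∃ t ≤ n, T (ω t) ∧ ∀ s < t, ¬ F (ω s)} ≤ h x := by
    intro n
    induction n with
    | zero =>
      intro x
      by_cases hx : T x
      · exact prob_le_one.trans (hT x hx)
      · refine le_trans (le_of_eq ?_) zero_le
        refine measure_mono_null (t := {ω | ¬ ω 0 = x}) ?_ (R_zero π x)
        rintro ω ⟨t, ht, h1, _⟩ h0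
        rw [show t = 0 by omega, h0] at h1
        exact hx h1
    | succ n ih =>
      intro x
      by_cases hx : T x
      · exact prob_le_one.trans (hT x hx)
      by_cases hF : F x
      · refine le_trans (le_of_eq ?_) zero_le
        refine measure_mono_null (t := {ω | ¬ ω 0 = x}) ?_ (R_zero π x)
        rintro ω ⟨t, ht, h1, h2⟩ h0
        cases t with
        | zero => rw [h0] at h1; exact hx h1
        | succ t => exact h2 0 (by omega) (h0 ▸ hF)
      · refine le_trans ?_ (hh x hx hF)
        rw [meas_step]
        · have hs : (fun ω => consN x ω) ⁻¹' {ω | ∃ t ≤ n+1, T (ω t) ∧ ∀ s < t, ¬ F (ω s)} ⊆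
              {ω | ∃ t ≤ n, T (ω t) ∧ ∀ s < t, ¬ F (ω s)} := by
            rintro ω ⟨t, ht, h1, h2⟩
            cases t with
            | zero => exact absurd h1 hx
            | succ t => exact ⟨t, by omega, h1, fun s hs => h2 (s+1) (by omega)⟩
          gcongr
          · exact (measure_mono hs).trans (ih (x+1))
          · exact (measure_mono hs).trans (ih (x-1))
        · measurability
  have hU : {ω : ℕ → ℕ | ∃ t, T (ω t) ∧ ∀ s < t, ¬ F (ω s)} =
      ⋃ n, {ω | ∃ t ≤ n, T (ω t) ∧ ∀ s < t, ¬ F (ω s)} := by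
    ext ω; simp only [Set.mem_iUnion]
    constructor
    · rintro ⟨t, h⟩; exact ⟨t, t, le_rfl, h⟩
    · rintro ⟨n, t, _, h⟩; exact ⟨t, h⟩
  rw [hU, Monotone.measure_iUnion]
  · exact iSup_le fun n => main n x
  · intro m n hmn ω
    rintro ⟨t, ht, h⟩
    exact ⟨t, ht.trans hmn, h⟩

/-- hit `q` before `p` -/
def HB (q p : ℕ) : Set (ℕ → ℕ) := {ω | ∃ t, ω t = q ∧ ∀ s < t, ω s ≠ p}

theorem measurableSet_HB (q p : ℕ) : MeasurableSet (HB q p) := by unfold HB; measurability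

theorem HB_up_le {p q : ℕ} (hpq : p < q) (x : ℕ) : R π x (HB q p) ≤ rr π p x / rr π p q := by
  refine superharm π (fun y => y = q) (fun y => y = p) (fun y => rr π p y / rr π p q) ?_ ?_ x
  · rintro y rfl
    exact (ENNReal.div_self (rr_ne_zero π hpq) (rr_ne_top π _ _)).ge
  · intro y _ hy
    simp only [ENNReal.div_eq_inv_mul]
    rw [mul_left_comm, mul_left_comm (dn π y), ← mul_add]
    gcongr
    rcases lt_or_gt_of_ne hy with h | h
    · rw [rr_zero π (show y+1 ≤ p by omega), rr_zero π (show y-1 ≤ p by omega)]; simp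
    · obtain ⟨m, rfl⟩ : ∃ m, y = m+1 := ⟨y-1, by omega⟩
      have hb := balance π (show m+1 ≠ 0 by omega)
      simp only [Nat.add_sub_cancel] at hb ⊢
      rw [rr_succ π (show p ≤ m+1 by omega), rr_succ π (show p ≤ m by omega)]
      calc _ = (up π (m+1) + dn π (m+1)) * rr π p m + up π (m+1) * aa π m
            + up π (m+1) * aa π (m+1) := by ring
        _ = (up π (m+1) + dn π (m+1)) * rr π p m + (up π (m+1) + dn π (m+1)) * aa π m := by
            rw [hb]; ring
        _ ≤ _ := by rw [up_add_dn]; simp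

theorem HB_dn_le {p q : ℕ} (hpq : p < q) (x : ℕ) : R π x (HB p q) ≤ rr π x q / rr π p q := by
  refine superharm π (fun y => y = p) (fun y => y = q) (fun y => rr π y q / rr π p q) ?_ ?_ x
  · rintro y rfl
    exact (ENNReal.div_self (rr_ne_zero π hpq) (rr_ne_top π _ _)).ge
  · intro y _ hy
    simp only [ENNReal.div_eq_inv_mul]
    rw [mul_left_comm, mul_left_comm (dn π y), ← mul_add]
    gcongr
    rcases lt_or_gt_of_ne hy with h | h
    · by_cases h0 : y = 0
      · subst h0
        rw [rr_head π h]
        simp [up, dn]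
      obtain ⟨m, rfl⟩ : ∃ m, y = m+1 := ⟨y-1, by omega⟩
      have hb := balance π (show m+1 ≠ 0 by omega)
      simp only [Nat.add_sub_cancel] at hb ⊢
      rw [rr_head π (show m < q by omega), rr_head π h]
      calc _ = (up π (m+1) + dn π (m+1)) * rr π (m+1+1) q + dn π (m+1) * aa π (m+1)
            + dn π (m+1) * aa π m := by ring
        _ = (up π (m+1) + dn π (m+1)) * rr π (m+1+1) q + (up π (m+1) + dn π (m+1)) * aa π (m+1) := by
            rw [← hb]; ring
        _ ≤ _ := by rw [up_add_dn]; simp [add_comm]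
    · rw [rr_zero π (show q ≤ y+1 by omega), rr_zero π (show q ≤ y-1 by omega)]; simp

theorem hit_le (hH : HH π 0 ≠ ⊤) (p x : ℕ) : R π x {ω | ∃ t, ω t = p} ≤ HH π x / HH π p := by
  have hp : HH π p ≠ ⊤ := ne_top_of_le_ne_top hH (HH_anti π (Nat.zero_le p))
  have e : {ω : ℕ → ℕ | ∃ t, ω t = p} = {ω | ∃ t, ω t = p ∧ ∀ s < t, ¬ False} := by
    ext ω; simp
  rw [e]
  refine superharm π (fun y => y = p) (fun _ => False) (fun y => HH π y / HH π p) ?_ ?_ x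
  · rintro y rfl
    exact (ENNReal.div_self (HH_ne_zero π _) hp).ge
  · intro y _ _
    simp only [ENNReal.div_eq_inv_mul]
    rw [mul_left_comm, mul_left_comm (dn π y), ← mul_add]
    gcongr
    by_cases h0 : y = 0
    · subst h0
      rw [HH_head π 0]
      simp [up, dn]
    obtain ⟨m, rfl⟩ : ∃ m, y = m+1 := ⟨y-1, by omega⟩
    have hb := balance π (show m+1 ≠ 0 by omega)
    simp only [Nat.add_sub_cancel] at hb ⊢
    rw [HH_head π m, HH_head π (m+1)]
    calc _ = (up π (m+1) + dn π (m+1)) * HH π (m+1+1) + dn π (m+1) * aa π (m+1)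
          + dn π (m+1) * aa π m := by ring
      _ = (up π (m+1) + dn π (m+1)) * HH π (m+1+1) + (up π (m+1) + dn π (m+1)) * aa π (m+1) := by
          rw [← hb]; ring
      _ ≤ _ := by rw [up_add_dn]; simp [add_comm]

/-- never hit `p` -/
def NV (p : ℕ) : Set (ℕ → ℕ) := {ω | ∀ t, ω t ≠ p}

theorem measurableSet_NV (p : ℕ) : MeasurableSet (NV p) := by unfold NV; measurability

theorem NV_ge (hH : HH π 0 ≠ ⊤) {p x : ℕ} (hpx : p ≤ x) : rr π p x ≤ HH π p * R π x (NV p) := by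
  have hp : HH π p ≠ ⊤ := ne_top_of_le_ne_top hH (HH_anti π (Nat.zero_le p))
  have hx : HH π x ≠ ⊤ := ne_top_of_le_ne_top hH (HH_anti π (Nat.zero_le x))
  have h1 := hit_le π hH p x
  have h2 : R π x {ω | ∃ t, ω t = p} + R π x (NV p) = 1 := by
    have : NV p = {ω : ℕ → ℕ | ∃ t, ω t = p}ᶜ := by ext ω; simp [NV]
    rw [this]
    exact prob_add_prob_compl (by measurability)
  have h3 : HH π p ≤ HH π x + HH π p * R π x (NV p) := by
    calc HH π p = HH π p * (R π x {ω | ∃ t, ω t = p} + R π x (NV p)) := by rw [h2, mul_one]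
      _ = HH π p * R π x {ω | ∃ t, ω t = p} + HH π p * R π x (NV p) := mul_add _ _ _
      _ ≤ HH π p * (HH π x / HH π p) + HH π p * R π x (NV p) := by gcongr
      _ = _ := by rw [ENNReal.mul_div_cancel (HH_ne_zero π p) hp]
  have h4 : HH π x + rr π p x ≤ HH π x + HH π p * R π x (NV p) := by
    rw [add_comm, ← HH_split π hpx]; exact h3
  exact (ENNReal.add_le_add_iff_left hx).1 h4

theorem up_ge (n : ℕ) : 2⁻¹ ≤ up π n := by
  unfold up
  split_ifs
  · simp
  · rw [ENNReal.inv_le_iff_inv_le]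
    rw [ENNReal.inv_div (by norm_num) (by norm_num)]
    exact ENNReal.div_le_of_le_mul (by norm_num)
  · simp

/-- no return to `p` -/
def NR (p : ℕ) : Set (ℕ → ℕ) := {ω | ∀ t, 0 < t → ω t ≠ p}

theorem measurableSet_NR (p : ℕ) : MeasurableSet (NR p) := by unfold NR; measurability

theorem NR_pos (hH : HH π 0 ≠ ⊤) (p : ℕ) : R π p (NR p) ≠ 0 := by
  intro h
  have h1 := NV_ge π hH (show p ≤ p+1 by omega)
  rw [meas_step π p _ (measurableSet_NR p)] at h
  have h2 : up π p * R π (p+1) (NV p) = 0 := by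
    refine le_antisymm ?_ zero_le
    refine le_trans ?_ (le_self_add.trans h.le)
    gcongr
    intro ω hω t ht
    obtain ⟨m, rfl⟩ : ∃ m, t = m+1 := ⟨t-1, by omega⟩
    exact hω m
  rcases mul_eq_zero.1 h2 with h3 | h3
  · have := up_ge π p
    rw [h3] at this
    simp at this
  · rw [h3, mul_zero] at h1
    exact rr_ne_zero π (show p < p+1 by omega) (le_antisymm h1 zero_le)

theorem ae_NP (hH : HH π 0 ≠ ⊤) (x : ℕ) : ∀ᵐ ω ∂(R π x), ω 0 = x ∧ NP ω := by
  have hfin : ∀ p, ∀ᵐ ω ∂(R π x), {t | ω t = p}.Finite := by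
    intro p
    have := last_visit π x p (fun t => {ω | ω t = p}) (NR p) (fun t => by measurability)
      (fun t ω ω' h => by simp only [Set.mem_ofPred_eq, h t le_rfl]) (fun t ω h => h)
      (measurableSet_NR p) (fun s t ω hst h1 h2 h3 => by
        refine h3 (t - s) (by omega) ?_
        simp only [sh_apply]
        rw [show s + (t-s) = t by omega]; exact h2)
    have hne : ∑' t, R π x {ω | ω t = p} ≠ ⊤ := by
      intro h
      rw [h, ENNReal.top_mul (NR_pos π hH p)] at this
      simp at this
    have := ae_finite_setOfPred_mem hne
    filter_upwards [this] with ω h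
    exact h
  filter_upwards [R_path π x, ae_all_iff.2 hfin] with ω h1 h2
  exact ⟨h1.1, h1.2, h2⟩

theorem HB_up_ge (hH : HH π 0 ≠ ⊤) {p x q : ℕ} (hpq : p < q) (hp : p ≤ x) (hq : x ≤ q) :
    rr π p x ≤ rr π p q * R π x (HB q p) := by
  have h1 := HB_dn_le π hpq x
  have h2 : 1 ≤ R π x (HB p q) + R π x (HB q p) := by
    rw [← measure_univ (μ := R π x)]
    refine le_trans (measure_mono_ae ?_) (measure_union_le _ _)
    filter_upwards [ae_NP π hH x] with ω hω _
    obtain ⟨t, -, h3, h4⟩ := first_after (hω.2.hits (s := 0) (y := q) (by rw [hω.1]; exact hq))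
    by_cases h : ∀ s < t, ω s ≠ p
    · exact Or.inr ⟨t, h3, h⟩
    · push Not at h
      obtain ⟨s, hs, h5⟩ := h
      exact Or.inl ⟨s, h5, fun r hr => h4 r (by omega) (by omega)⟩
  have h3 : rr π p q ≤ rr π x q + rr π p q * R π x (HB q p) := by
    calc rr π p q ≤ rr π p q * (R π x (HB p q) + R π x (HB q p)) := le_mul_of_one_le_right' h2
      _ = rr π p q * R π x (HB p q) + rr π p q * R π x (HB q p) := mul_add _ _ _
      _ ≤ rr π p q * (rr π x q / rr π p q) + rr π p q * R π x (HB q p) := by gcongr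
      _ = _ := by rw [ENNReal.mul_div_cancel (rr_ne_zero π hpq) (rr_ne_top π _ _)]
  have h4 := rr_add π hp hq
  have h5 : rr π x q + rr π p x ≤ rr π x q + rr π p q * R π x (HB q p) := by
    rw [add_comm, ← h4]; exact h3
  exact (ENNReal.add_le_add_iff_left (rr_ne_top π _ _)).1 h5

end CutWalk

namespace CutWalk
open scoped ENNReal

noncomputable def nu2 : Measure Bool := (2 : ℝ≥0∞)⁻¹ • Measure.count

instance : IsProbabilityMeasure nu2 := ⟨by
  simp only [nu2, Measure.smul_apply, Measure.count_univ, smul_eq_mul]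
  simp [ENNReal.inv_mul_cancel (show (2:ℝ≥0∞) ≠ 0 by norm_num) (by norm_num)]⟩

theorem nu2_singleton (b : Bool) : nu2 {b} = (2:ℝ≥0∞)⁻¹ := by simp [nu2]

noncomputable def Q2 : Measure (ℕ → Bool) := Measure.infinitePi fun _ => nu2

instance : IsProbabilityMeasure Q2 := by unfold Q2; infer_instance

/-- event depending on coordinates `< s` -/
def PreB (s : ℕ) (E : Set (ℕ → Bool)) : Prop :=
  ∀ B B' : ℕ → Bool, (∀ i < s, B i = B' i) → B ∈ E → B' ∈ E

theorem PreB.mono {s t : ℕ} (h : s ≤ t) {E : Set (ℕ → Bool)} (hE : PreB s E) : PreB t E :=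
  fun B B' hh => hE B B' fun i hi => hh i (by omega)

theorem PreB.inter {s : ℕ} {E F : Set (ℕ → Bool)} (hE : PreB s E) (hF : PreB s F) :
    PreB s (E ∩ F) := fun B B' hh h => ⟨hE B B' hh h.1, hF B B' hh h.2⟩

theorem PreB.eq_preimage {s : ℕ} {E : Set (ℕ → Bool)} (hE : PreB s E) :
    E = (fun (B : ℕ → Bool) (i : Finset.range s) => B i) ⁻¹'
      {b | (fun i => if h : i ∈ Finset.range s then b ⟨i, h⟩ else false) ∈ E} := by
  ext B
  constructor
  · intro h
    refine hE B _ (fun i hi => ?_) h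
    simp [hi]
  · intro h
    refine hE _ B (fun i hi => ?_) h
    simp [hi]

theorem PreB.measurableSet {s : ℕ} {E : Set (ℕ → Bool)} (hE : PreB s E) : MeasurableSet E := by
  rw [hE.eq_preimage]
  exact (measurable_pi_lambda _ fun i => measurable_pi_apply _) (Set.toFinite _).measurableSet

theorem Q2_indep {s : ℕ} {E : Set (ℕ → Bool)} (hE : PreB s E) (I : Finset ℕ) (hI : ∀ i ∈ I, s ≤ i)
    (b : ℕ → Bool) : Q2 (E ∩ {B | ∀ i ∈ I, B i = b i}) = Q2 E * ((2:ℝ≥0∞) ^ I.card)⁻¹ := by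
  have hind : ProbabilityTheory.iIndepFun (fun i (B : ℕ → Bool) => B i) Q2 :=
    ProbabilityTheory.iIndepFun_infinitePi (P := fun _ => nu2) (X := fun _ (b : Bool) => b) (fun i => measurable_id)
  have h2 := hind.indepFun_finset (Finset.range s) I (by
    rw [Finset.disjoint_left]; intro i hi hi'
    have := hI i hi'
    simp at hi; omega) (fun i => measurable_pi_apply i)
  have e2 : {B : ℕ → Bool | ∀ i ∈ I, B i = b i} =
      (fun (B : ℕ → Bool) (i : I) => B i) ⁻¹' {c | ∀ i, c i = b i} := by
    ext B; simp
  have e3 : Q2 {B : ℕ → Bool | ∀ i ∈ I, B i = b i} = ((2:ℝ≥0∞) ^ I.card)⁻¹ := by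
    have : {B : ℕ → Bool | ∀ i ∈ I, B i = b i} = Set.pi (I : Set ℕ) (fun i => {b i}) := by
      ext B; simp [Set.mem_pi]
    rw [this, Q2, Measure.infinitePi_pi _ (fun i _ => measurableSet_singleton _)]
    simp [nu2_singleton, ENNReal.inv_pow]
  rw [← e3, e2]
  conv_lhs => rw [hE.eq_preimage]
  rw [h2.measure_inter_preimage_eq_mul _ _ (Set.toFinite _).measurableSet (Set.toFinite _).measurableSet,
    ← hE.eq_preimage]

variable (π : Prof)

/-- coordinate of an edge -/
noncomputable def cc (e : ℕ) : ℕ := if π.w (e+1) = π.w e + 1 then π.w e else e % π.w e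

def ed (S : ℕ → ℕ) (t : ℕ) : ℕ := min (S t) (S (t+1))

noncomputable def bb (S : ℕ → ℕ) (B : ℕ → Bool) : ℕ → ℕ → Bool
  | 0, _ => false
  | t+1, k => if cc π (ed S t) = k then B t else bb S B t k

noncomputable def bt (S : ℕ → ℕ) (B : ℕ → Bool) (t : ℕ) : Finset ℕ :=
  (Finset.range (π.w (S t))).filter fun k => bb π S B t k = true

noncomputable def XX (S : ℕ → ℕ) (B : ℕ → Bool) (t : ℕ) : ℕ × Finset ℕ := (S t, bt π S B t)

def Rf (S : ℕ → ℕ) (s t n : ℕ) : Prop := ∀ k < n, ∃ i, s ≤ i ∧ i < t ∧ cc π (ed S i) = k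

theorem Rf.mono {S : ℕ → ℕ} {s t n s' t' n' : ℕ} (h : Rf π S s t n) (hs : s' ≤ s) (ht : t ≤ t')
    (hn : n' ≤ n) : Rf π S s' t' n' := by
  intro k hk
  obtain ⟨i, h1, h2, h3⟩ := h k (by omega)
  exact ⟨i, by omega, by omega, h3⟩

theorem bb_pre (S : ℕ → ℕ) (B B' : ℕ → Bool) (t : ℕ) (h : ∀ i < t, B i = B' i) (k : ℕ) :
    bb π S B t k = bb π S B' t k := by
  induction t with
  | zero => rfl
  | succ t ih => simp only [bb, h t (by omega), ih (fun i hi => h i (by omega))]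

theorem bt_pre (S : ℕ → ℕ) (B B' : ℕ → Bool) (t : ℕ) (h : ∀ i < t, B i = B' i) :
    bt π S B t = bt π S B' t := by
  simp only [bt, bb_pre π S B B' t h]

theorem bb_last (S : ℕ → ℕ) (B : ℕ → Bool) (k i : ℕ) (hi : cc π (ed S i) = k) :
    ∀ t, i < t → (∀ j, i < j → j < t → cc π (ed S j) ≠ k) → bb π S B t k = B i := by
  intro t
  induction t with
  | zero => intro h; omega
  | succ t ih =>
    intro h1 h2
    by_cases h : t = i
    · subst h; simp [bb, hi]
    · simp only [bb]
      rw [if_neg (h2 t (by omega) (by omega)), ih (by omega) fun j hj hj' => h2 j hj (by omega)]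

theorem bt_subset (S : ℕ → ℕ) (B : ℕ → Bool) (t : ℕ) : bt π S B t ⊆ Finset.range (π.w (S t)) :=
  Finset.filter_subset _ _

theorem bits_eq (S : ℕ → ℕ) {s t : ℕ} (hR : Rf π S s t (π.w (S t))) {E : Set (ℕ → Bool)}
    (hE : PreB s E) {y : Finset ℕ} (hy : y ⊆ Finset.range (π.w (S t))) :
    Q2 (E ∩ {B | bt π S B t = y}) = Q2 E * aa π (S t) := by
  have hl : ∀ k, ∃ i, k < π.w (S t) → s ≤ i ∧ i < t ∧ cc π (ed S i) = k ∧
      ∀ j, i < j → j < t → cc π (ed S j) ≠ k := by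
    intro k
    by_cases hk : k < π.w (S t)
    · obtain ⟨i, h1, h2, h3⟩ := hR k hk
      obtain ⟨r, h4, h5, h6, h7⟩ := last_before (P := fun i => cc π (ed S i) = k)
        (show i ≤ t - 1 by omega) h3
      exact ⟨r, fun _ => ⟨by omega, by omega, h6, fun j hj hj' => h7 j hj (by omega)⟩⟩
    · exact ⟨0, fun h => absurd h hk⟩
  choose l hl using hl
  have hinj : Set.InjOn l (Finset.range (π.w (S t)) : Set ℕ) := by
    intro a ha b hb hab
    have h1 := (hl a (by simpa using ha)).2.2.1
    have h2 := (hl b (by simpa using hb)).2.2.1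
    rw [← h1, ← h2, hab]
  have e : {B : ℕ → Bool | bt π S B t = y} = {B | ∀ i ∈ (Finset.range (π.w (S t))).image l,
      B i = decide (cc π (ed S i) ∈ y)} := by
    ext B
    simp only [Finset.mem_image, Finset.mem_range]
    constructor
    · rintro (h : bt π S B t = y) i ⟨k, hk, rfl⟩
      obtain ⟨h1, h2, h3, h4⟩ := hl k hk
      rw [← bb_last π S B k (l k) h3 t h2 h4, h3, ← h]
      simp [bt, hk]
    · intro h
      change bt π S B t = y
      ext k
      by_cases hk : k < π.w (S t)
      · obtain ⟨h1, h2, h3, h4⟩ := hl k hk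
        have h5 := h (l k) ⟨k, hk, rfl⟩
        rw [← bb_last π S B k (l k) h3 t h2 h4, h3] at h5
        simp [bt, hk, h5]
      · constructor
        · intro h6; exact absurd (Finset.mem_range.1 (bt_subset π S B t h6)) hk
        · intro h6; exact absurd (Finset.mem_range.1 (hy h6)) hk
  rw [e, Q2_indep hE, Finset.card_image_of_injOn hinj, Finset.card_range, aa]
  intro i hi
  simp only [Finset.mem_image, Finset.mem_range] at hi
  obtain ⟨k, hk, rfl⟩ := hi
  exact (hl k hk).1

theorem bits_le (S : ℕ → ℕ) {s t : ℕ} (hR : Rf π S s t (π.w (S t))) {E : Set (ℕ → Bool)}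
    (hE : PreB s E) (y : Finset ℕ) :
    Q2 (E ∩ {B | bt π S B t = y}) ≤ Q2 E * aa π (S t) := by
  by_cases hy : y ⊆ Finset.range (π.w (S t))
  · exact (bits_eq π S hR hE hy).le
  · have : E ∩ {B | bt π S B t = y} = ∅ := by
      ext B
      simp only [Set.mem_inter_iff, Set.mem_empty_iff_false, iff_false, not_and]
      rintro - (h : bt π S B t = y)
      exact hy (h ▸ bt_subset π S B t)
    rw [this]; simp

theorem preB_bt (S : ℕ → ℕ) (t : ℕ) (A : Set (Finset ℕ)) : PreB t {B | bt π S B t ∈ A} := by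
  intro B B' h hB
  change bt π S B' t ∈ A
  rw [← bt_pre π S B B' t h]; exact hB

theorem bits_avoid (S : ℕ → ℕ) {s t : ℕ} (hR : Rf π S s t (π.w (S t))) {E : Set (ℕ → Bool)}
    (hE : PreB s E) (A : Finset (Finset ℕ)) (hA : A ⊆ (Finset.range (π.w (S t))).powerset) :
    Q2 (E ∩ {B | bt π S B t ∉ A}) ≤ Q2 E * (((2 ^ π.w (S t) - A.card : ℕ) : ℝ≥0∞) * aa π (S t)) := by
  have : E ∩ {B | bt π S B t ∉ A} ⊆ ⋃ y ∈ (Finset.range (π.w (S t))).powerset \ A,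
      E ∩ {B | bt π S B t = y} := by
    rintro B ⟨h1, h2⟩
    simp only [Set.mem_iUnion]
    refine ⟨bt π S B t, ?_, h1, rfl⟩
    rw [Finset.mem_sdiff, Finset.mem_powerset]
    exact ⟨bt_subset π S B t, h2⟩
  refine (measure_mono this).trans ((measure_biUnion_finset_le _ _).trans ?_)
  refine (Finset.sum_le_sum fun y _ => bits_le π S hR hE y).trans ?_
  rw [Finset.sum_const, Finset.card_sdiff_of_subset hA, Finset.card_powerset, Finset.card_range,
    nsmul_eq_mul]
  exact le_of_eq (by ring)

theorem bits_avoid_many (S : ℕ → ℕ) (n : ℕ) (r : ℕ → ℕ) (a : ℕ)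
    (hw : ∀ i, 1 ≤ i → i ≤ a → π.w (S (r i)) = n)
    (hR : ∀ i < a, Rf π S (r i) (r (i+1)) n) (hm : ∀ i < a, r i ≤ r (i+1))
    {E : Set (ℕ → Bool)} (hE : PreB (r 0) E) (A : Finset (Finset ℕ))
    (hA : A ⊆ (Finset.range n).powerset) :
    Q2 (E ∩ {B | ∀ i, 1 ≤ i → i ≤ a → bt π S B (r i) ∉ A}) ≤
      Q2 E * (((2 ^ n - A.card : ℕ) : ℝ≥0∞) * ((2:ℝ≥0∞)^n)⁻¹) ^ a := by
  induction a with
  | zero => simp; exact measure_mono Set.inter_subset_left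
  | succ a ih =>
    have ih' := ih (fun i h1 h2 => hw i h1 (by omega)) (fun i h => hR i (by omega))
      (fun i h => hm i (by omega))
    have e : E ∩ {B | ∀ i, 1 ≤ i → i ≤ a+1 → bt π S B (r i) ∉ A} ⊆
        (E ∩ {B | ∀ i, 1 ≤ i → i ≤ a → bt π S B (r i) ∉ A}) ∩ {B | bt π S B (r (a+1)) ∉ A} := by
      rintro B ⟨h1, h2⟩
      exact ⟨⟨h1, fun i h3 h4 => h2 i h3 (by omega)⟩, h2 (a+1) (by omega) le_rfl⟩
    have hmono : ∀ i ≤ a, ∀ j ≤ i, r j ≤ r i := by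
      intro i
      induction i with
      | zero => intro _ j hj; rw [Nat.le_zero.1 hj]
      | succ i ihi =>
        intro hi j hj
        rcases Nat.lt_or_ge i j with h | h
        · rw [show j = i+1 by omega]
        · exact (ihi (by omega) j h).trans (hm i (by omega))
    have hwa := hw (a+1) (by omega) le_rfl
    have hp : PreB (r a) (E ∩ {B | ∀ i, 1 ≤ i → i ≤ a → bt π S B (r i) ∉ A}) := by
      refine (hE.mono (hmono a le_rfl 0 (by omega))).inter ?_
      intro B B' h hB i h1 h2
      rw [← bt_pre π S B B' (r i) (fun j hj => h j (by have := hmono a le_rfl i h2; omega))]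
      exact hB i h1 h2
    refine (measure_mono e).trans ((bits_avoid π S (s := r a) (by rw [hwa]; exact hR a (by omega)) hp A
      (by rw [hwa]; exact hA)).trans ?_)
    rw [hwa, aa, hwa, pow_succ]
    exact (mul_le_mul' ih' le_rfl).trans (by rw [mul_assoc])

theorem bits_coll (S : ℕ → ℕ) (s t n : ℕ) (hn : π.w (S t) = n)
    (hR : Rf π S s t n) :
    Q2 {B | bt π S B s = bt π S B t} ≤ ((2:ℝ≥0∞)^n)⁻¹ := by
  have : {B : ℕ → Bool | bt π S B s = bt π S B t} ⊆ ⋃ y ∈ (Finset.range (π.w (S s))).powerset,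
      {B | bt π S B s = y} ∩ {B | bt π S B t = y} := by
    intro B hB
    simp only [Set.mem_iUnion]
    exact ⟨bt π S B s, Finset.mem_powerset.2 (bt_subset π S B s), rfl, hB.symm⟩
  refine (measure_mono this).trans ((measure_biUnion_finset_le _ _).trans ?_)
  have hp : ∀ y, PreB s {B | bt π S B s = y} := fun y => preB_bt π S s {y}
  refine (Finset.sum_le_sum fun y _ => bits_le π S (by rw [hn]; exact hR) (hp y) y).trans ?_
  rw [← Finset.sum_mul, ← measure_biUnion_finset]
  · rw [aa, hn]
    exact (mul_le_mul_left prob_le_one _).trans (by rw [one_mul])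
  · intro y _ z _ hyz
    rw [Function.onFun, Set.disjoint_left]
    intro B h1 h2
    exact hyz (h1.symm.trans h2)
  · exact fun y _ => (hp y).measurableSet

theorem pow_bound (W a b : ℕ) (hW : 0 < W) (ha : 0 < a) (hb : 0 < b) (haW : a ≤ W) :
    (((W - a : ℕ) : ℝ≥0∞) * (W:ℝ≥0∞)⁻¹) ^ b ≤ (W : ℝ≥0∞) / ((a:ℝ≥0∞) * b) := by
  have hW' : (0:ℝ) < W := by exact_mod_cast hW
  have ha' : (0:ℝ) < a := by exact_mod_cast ha
  have hb' : (0:ℝ) < b := by exact_mod_cast hb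
  have haW' : (a:ℝ) ≤ W := by exact_mod_cast haW
  have h1 : (((W - a : ℕ) : ℝ≥0∞) * (W:ℝ≥0∞)⁻¹) ^ b = ENNReal.ofReal (((W - a)/W) ^ b) := by
    rw [ENNReal.ofReal_pow (by apply div_nonneg <;> linarith), ENNReal.ofReal_div_of_pos hW',
      ENNReal.ofReal_natCast, ← Nat.cast_sub haW, ENNReal.ofReal_natCast, div_eq_mul_inv]
  have h2 : (W : ℝ≥0∞) / ((a:ℝ≥0∞) * b) = ENNReal.ofReal (W / (a * b)) := by
    rw [ENNReal.ofReal_div_of_pos (by positivity), ENNReal.ofReal_mul ha'.le,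
      ENNReal.ofReal_natCast, ENNReal.ofReal_natCast, ENNReal.ofReal_natCast]
  rw [h1, h2]
  apply ENNReal.ofReal_le_ofReal
  set x : ℝ := a / W with hx
  have hx0 : 0 < x := by positivity
  have hx1 : x ≤ 1 := by rw [hx, div_le_one hW']; exact haW'
  have e1 : ((W:ℝ) - a)/W = 1 - x := by rw [hx]; field_simp
  have e2 : (W:ℝ) / (a*b) = 1 / (b * x) := by rw [hx]; field_simp
  rw [e1, e2, le_div_iff₀ (by positivity)]
  have h3 : 1 + b * x ≤ (1+x)^b := by
    have := one_add_mul_le_pow (show (-2:ℝ) ≤ x by linarith) b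
    linarith
  calc (1-x)^b * (b*x) ≤ (1-x)^b * (1+x)^b := by
        apply mul_le_mul_of_nonneg_left (by linarith)
        exact pow_nonneg (by linarith) _
    _ = ((1-x)*(1+x))^b := by rw [mul_pow]
    _ ≤ 1 := by
        apply pow_le_one₀
        · apply mul_nonneg <;> linarith
        · nlinarith

theorem no_match (S : ℕ → ℕ) (n : ℕ) (r r' : ℕ → ℕ) (a b : ℕ) (ha : 0 < a) (hb : 0 < b)
    (haW : a ≤ 2 ^ n)
    (hw : ∀ i, 1 ≤ i → i ≤ a → π.w (S (r i)) = n)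
    (hR : ∀ i < a, Rf π S (r i) (r (i+1)) n) (hm : ∀ i < a, r i ≤ r (i+1))
    (hw' : ∀ i, 1 ≤ i → i ≤ b → π.w (S (r' i)) = n)
    (hR' : ∀ i < b, Rf π S (r' i) (r' (i+1)) n) (hm' : ∀ i < b, r' i ≤ r' (i+1))
    (hrr : r a ≤ r' 0) :
    Q2 {B | ∀ i k, 1 ≤ i → i ≤ a → 1 ≤ k → k ≤ b → bt π S B (r i) ≠ bt π S B (r' k)} ≤
      (a:ℝ≥0∞) * a / 2 ^ n + 2 ^ n / ((a:ℝ≥0∞) * b) := by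
  set AA : (ℕ → Bool) → Finset (Finset ℕ) := fun B => (Finset.Icc 1 a).image fun i => bt π S B (r i)
    with hAA
  have hmono : ∀ i ≤ a, ∀ j ≤ i, r j ≤ r i := by
    intro i
    induction i with
    | zero => intro _ j hj; rw [Nat.le_zero.1 hj]
    | succ i ihi =>
      intro hi j hj
      rcases Nat.lt_or_ge i j with h | h
      · rw [show j = i+1 by omega]
      · exact (ihi (by omega) j h).trans (hm i (by omega))
  set C1 : Set (ℕ → Bool) := ⋃ i ∈ Finset.Icc 1 a, ⋃ k ∈ (Finset.Icc 1 a).filter (fun k => i < k),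
    {B | bt π S B (r i) = bt π S B (r k)} with hC1
  set FF := (Finset.range n).powerset.powersetCard a with hFF
  set C2 : Set (ℕ → Bool) := ⋃ A ∈ FF, {B | AA B = A} ∩
    {B | ∀ k, 1 ≤ k → k ≤ b → bt π S B (r' k) ∉ A} with hC2
  have hAsub : ∀ B, AA B ⊆ (Finset.range n).powerset := by
    intro B y hy
    simp only [hAA, Finset.mem_image, Finset.mem_Icc] at hy
    obtain ⟨i, hi, rfl⟩ := hy
    rw [Finset.mem_powerset, ← hw i hi.1 hi.2]
    exact bt_subset π S B _
  have hsub : {B | ∀ i k, 1 ≤ i → i ≤ a → 1 ≤ k → k ≤ b → bt π S B (r i) ≠ bt π S B (r' k)} ⊆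
      C1 ∪ C2 := by
    intro B hB
    by_cases hinj : Set.InjOn (fun i => bt π S B (r i)) (Finset.Icc 1 a : Set ℕ)
    · right
      simp only [hC2, Set.mem_iUnion]
      refine ⟨AA B, ?_, rfl, ?_⟩
      · rw [hFF, Finset.mem_powersetCard]
        refine ⟨hAsub B, ?_⟩
        rw [hAA]; simp only
        rw [Finset.card_image_of_injOn hinj]; simp
      · intro k h1 h2 h3
        simp only [hAA, Finset.mem_image, Finset.mem_Icc] at h3
        obtain ⟨i, hi, h4⟩ := h3
        exact hB i k hi.1 hi.2 h1 h2 h4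
    · left
      simp only [Set.InjOn] at hinj
      push Not at hinj
      obtain ⟨i, hi, k, hk, h1, h2⟩ := hinj
      simp only [hC1, Set.mem_iUnion]
      rcases lt_or_gt_of_ne h2 with h | h
      · exact ⟨i, by exact_mod_cast hi, k, Finset.mem_filter.2 ⟨by exact_mod_cast hk, h⟩, h1⟩
      · exact ⟨k, by exact_mod_cast hk, i, Finset.mem_filter.2 ⟨by exact_mod_cast hi, h⟩, h1.symm⟩
  refine (measure_mono hsub).trans ((measure_union_le _ _).trans (add_le_add ?_ ?_))
  · refine (measure_biUnion_finset_le _ _).trans ?_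
    have : ∀ i ∈ Finset.Icc 1 a, Q2 (⋃ k ∈ (Finset.Icc 1 a).filter (fun k => i < k),
        {B | bt π S B (r i) = bt π S B (r k)}) ≤ a * ((2:ℝ≥0∞)^n)⁻¹ := by
      intro i hi
      rw [Finset.mem_Icc] at hi
      refine (measure_biUnion_finset_le _ _).trans ?_
      calc _ ≤ ∑ k ∈ (Finset.Icc 1 a).filter (fun k => i < k), ((2:ℝ≥0∞)^n)⁻¹ := by
            refine Finset.sum_le_sum fun k hk => ?_
            simp only [Finset.mem_filter, Finset.mem_Icc] at hk
            obtain ⟨m, rfl⟩ : ∃ m, k = m+1 := ⟨k-1, by omega⟩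
            exact bits_coll π S _ _ n (hw _ (by omega) hk.1.2)
              ((hR m (by omega)).mono π (hmono m (by omega) i (by omega)) le_rfl le_rfl)
        _ ≤ _ := by
            rw [Finset.sum_const, nsmul_eq_mul]
            gcongr
            refine (Finset.card_filter_le _ _).trans ?_
            simp
    refine (Finset.sum_le_sum this).trans ?_
    rw [Finset.sum_const, nsmul_eq_mul, Nat.card_Icc, Nat.add_sub_cancel, div_eq_mul_inv, mul_assoc]
  · refine (measure_biUnion_finset_le _ _).trans ?_
    have hp : ∀ A, PreB (r' 0) {B | AA B = A} := by
      intro A B B' h hB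
      rw [← show AA B = A from hB]
      simp only [hAA]
      refine Finset.image_congr fun i hi => ?_
      simp only [Finset.coe_Icc, Set.mem_Icc] at hi
      refine (bt_pre π S B B' (r i) fun j hj => h j ?_).symm
      have := hmono a le_rfl i hi.2
      omega
    have : ∀ A ∈ FF, Q2 ({B | AA B = A} ∩ {B | ∀ k, 1 ≤ k → k ≤ b → bt π S B (r' k) ∉ A}) ≤
        Q2 {B | AA B = A} * (2 ^ n / ((a:ℝ≥0∞) * b)) := by
      intro A hA
      rw [hFF, Finset.mem_powersetCard] at hA
      refine (bits_avoid_many π S n r' b hw' hR' hm' (hp A) A hA.1).trans ?_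
      gcongr
      rw [hA.2]
      have := pow_bound (2^n) a b (by positivity) ha hb haW
      push_cast at this ⊢
      exact this
    refine (Finset.sum_le_sum this).trans ?_
    rw [← Finset.sum_mul, ← measure_biUnion_finset]
    · exact (mul_le_mul_left prob_le_one _).trans (by rw [one_mul])
    · intro y _ z _ hyz
      rw [Function.onFun, Set.disjoint_left]
      intro B h1 h2
      exact hyz (h1.symm.trans h2)
    · exact fun y _ => (hp y).measurableSet

end CutWalk

namespace CutWalk
open scoped ENNReal

/-- all visits to level `c` are connected to the first one inside the open cell `(α, β)` -/
def Link {V : Type*} (S : ℕ → ℕ) (z : ℕ → V) (α c β : ℕ) : Prop :=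
  ∀ t0 t, S t0 = c → (∀ s < t0, S s ≠ c) → S t = c → ∃ s r r', t0 ≤ r ∧ s ≤ r' ∧ s ≤ t ∧ z r = z r' ∧
    (∀ i, t0 ≤ i → i ≤ r → α < S i ∧ S i < β) ∧ (∀ i, s ≤ i → i ≤ r' → α < S i ∧ S i < β) ∧
    (∀ i, s ≤ i → i ≤ t → α < S i ∧ S i < β)

section det
variable {V : Type*} (z : ℕ → V)

def pathG : SimpleGraph V := SimpleGraph.fromEdgeSet {e : Sym2 V | ∃ n : ℕ, e = s(z n, z (n + 1))}

def Rch (v a b : V) : Prop := ∃ (ha : a ≠ v) (hb : b ≠ v),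
  ((pathG z).induce {u : V | u ≠ v}).Reachable ⟨a, ha⟩ ⟨b, hb⟩

variable {z}

theorem Rch.trans {v a b c : V} (h : Rch z v a b) (h' : Rch z v b c) : Rch z v a c := by
  obtain ⟨ha, hb, h⟩ := h
  obtain ⟨_, hc, h'⟩ := h'
  exact ⟨ha, hc, SimpleGraph.Reachable.trans h h'⟩

theorem Rch.symm {v a b : V} (h : Rch z v a b) : Rch z v b a := by
  obtain ⟨ha, hb, h⟩ := h
  exact ⟨hb, ha, SimpleGraph.Reachable.symm h⟩

theorem rch_seg {v : V} (hne : ∀ n, z n ≠ z (n+1)) {s t : ℕ} (hst : s ≤ t)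
    (h : ∀ i, s ≤ i → i ≤ t → z i ≠ v) : Rch z v (z s) (z t) := by
  induction t, hst using Nat.le_induction with
  | base => exact ⟨h s le_rfl le_rfl, h s le_rfl le_rfl, SimpleGraph.Reachable.refl _⟩
  | succ t hst ih =>
    refine (ih fun i h1 h2 => h i h1 (by omega)).trans
      ⟨h t hst (by omega), h (t+1) (by omega) le_rfl, SimpleGraph.Adj.reachable ?_⟩
    rw [SimpleGraph.comap_adj]
    simp only [pathG, SimpleGraph.fromEdgeSet_adj, Function.Embedding.subtype_apply]
    exact ⟨⟨t, rfl⟩, hne t⟩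

theorem link_rch {S : ℕ → ℕ} {v : V} {lv : V → ℕ} (hS : ∀ t, S t = lv (z t)) (hne : ∀ n, z n ≠ z (n+1))
    {α c β : ℕ} (hL : Link S z α c β) (hv : lv v ≤ α ∨ β ≤ lv v) {t0 t : ℕ} (h0 : S t0 = c)
    (h1 : ∀ s < t0, S s ≠ c) (ht : S t = c) : Rch z v (z t0) (z t) := by
  obtain ⟨s, r, r', h2, h3, h4, h5, h6, h7, h8⟩ := hL t0 t h0 h1 ht
  have hx : ∀ i, (α < S i ∧ S i < β) → z i ≠ v := by
    intro i hi he
    rw [hS, he] at hi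
    omega
  refine (rch_seg hne h2 fun i a b => hx i (h6 i a b)).trans ?_
  rw [h5]
  exact (rch_seg hne h3 fun i a b => hx i (h7 i a b)).symm.trans
    (rch_seg hne h4 fun i a b => hx i (h8 i a b))

theorem not_cut {S : ℕ → ℕ} {v : V} {lv : V → ℕ} (hS : ∀ t, S t = lv (z t)) (hNP : NP S) (hS0 : S 0 = 0)
    {α c β α' c' β' : ℕ} (hc1 : c < β) (hc1' : α' < c')
    (hv : β ≤ lv v) (hv' : lv v ≤ α') (hL : Link S z α c β) (hL' : Link S z α' c' β')
    {s t : ℕ} (hst : s ≤ t) (hs : S s = c) (ht : S t = c') (hav : ∀ i, s ≤ i → i ≤ t → z i ≠ v) :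
    ¬ IsCutpoint (SimpleGraph.fromEdgeSet {e : Sym2 V | ∃ n : ℕ, e = s(z n, z (n + 1))}) (z 0) v := by
  have hne : ∀ n, z n ≠ z (n+1) := by
    intro n he
    have := hNP.step n
    rw [hS, hS, ← he] at this
    omega
  obtain ⟨t0, -, h0, h0'⟩ := first_after (P := fun t => S t = c) (s := 0) ⟨s, by omega, hs⟩
  obtain ⟨t1, -, h1, h1'⟩ := first_after (P := fun t => S t = c') (s := 0) ⟨t, by omega, ht⟩
  have r1 : Rch z v (z 0) (z t0) := by
    refine rch_seg hne (Nat.zero_le _) fun i _ hi he => ?_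
    have h3 : lv v = S i := by rw [hS, he]
    obtain ⟨r, h4, h5, h6⟩ := ivt_up hNP.step (Nat.zero_le i) (y := c) (by omega) (by omega)
    have h7 : r ≠ i := by rintro rfl; omega
    exact h0' r (by omega) (by omega) h6
  have r2 : Rch z v (z t0) (z s) := link_rch hS hne hL (Or.inr hv) h0 (fun s hs => h0' s (by omega) hs) hs
  have r3 : Rch z v (z s) (z t) := rch_seg hne hst hav
  have l' := fun {x} => link_rch (v := v) (t := x) hS hne hL' (Or.inl hv') h1 (fun s hs => h1' s (by omega) hs)
  obtain ⟨T, hT⟩ := hNP.large c'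
  have htT : t ≤ T := by
    by_contra h
    have := hT t (by omega)
    omega
  obtain ⟨q, q1, q2, q3, q4⟩ := last_before (P := fun t => S t = c') htT ht
  have r5 : Rch z v (z 0) (z q) := r1.trans (r2.trans (r3.trans ((l' ht).symm.trans (l' q3))))
  have r6 : ∀ k, q ≤ k → Rch z v (z 0) (z k) := by
    intro k hk
    refine r5.trans (rch_seg hne hk fun i hi1 _ he => ?_)
    have h3 : lv v = S i := by rw [hS, he]
    obtain ⟨r, h4, h5, h6⟩ := ivt_up hNP.step (le_max_left i T) (y := c') (by omega)
      (hT (max i T) (le_max_right _ _)).le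
    have h7 : r ≠ i := by rintro rfl; omega
    have : T < r := by
      by_contra h
      exact q4 r (by omega) (by omega) h6
    have := hT r (by omega)
    omega
  rintro ⟨hv0, hfin⟩
  have hf2 := (hfin.image (fun u => lv u.1)).bddAbove
  obtain ⟨N, hN⟩ := hf2
  obtain ⟨T', hT'⟩ := hNP.large N
  obtain ⟨ha, hb, h⟩ := r6 (max q T') (le_max_left _ _)
  have h8 := hN ⟨⟨z (max q T'), hb⟩, h, rfl⟩
  have h9 := hT' (max q T') (le_max_right _ _)
  rw [hS] at h9
  simp only at h8
  omega

end det
end CutWalk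

namespace CutWalk
open scoped ENNReal

theorem pre_of_imp {t : ℕ} {A : Set (ℕ → ℕ)}
    (h : ∀ ω ω' : ℕ → ℕ, (∀ i ≤ t, ω i = ω' i) → ω ∈ A → ω' ∈ A) : Pre t (fun ω => ω ∈ A) :=
  fun ω ω' hh => propext ⟨h ω ω' hh, h ω' ω fun i hi => (hh i hi).symm⟩

variable (π : Prof)

/-- strong Markov at the first time a predicate holds -/
theorem strong_first (x y : ℕ) (P : ℕ → (ℕ → ℕ) → Prop) (E : Set (ℕ → ℕ))
    (hP : ∀ t, MeasurableSet {ω | P t ω})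
    (hp : ∀ t, ∀ ω ω' : ℕ → ℕ, (∀ i ≤ t, ω i = ω' i) → P t ω → P t ω')
    (hy : ∀ t ω, P t ω → ω t = y) (hE : MeasurableSet E) :
    R π x {ω | ∃ t, P t ω ∧ (∀ s < t, ¬ P s ω) ∧ sh t ω ∈ E} = R π x {ω | ∃ t, P t ω} * R π y E := by
  have h := strong_markov π x y (fun t => {ω | P t ω ∧ (∀ s < t, ¬ P s ω)}) E
    (fun t => by
      have : {ω | P t ω ∧ (∀ s < t, ¬ P s ω)} = {ω | P t ω} ∩ ⋂ s, ⋂ (_ : s < t), {ω | P s ω}ᶜ := by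
        ext ω; simp
      rw [this]
      exact (hP t).inter (MeasurableSet.iInter fun s => MeasurableSet.iInter fun _ => (hP s).compl))
    (fun t => pre_of_imp (by
      rintro ω ω' hh ⟨h1, h2⟩
      exact ⟨hp t ω ω' hh h1, fun s hs h3 => h2 s hs (hp s ω' ω (fun i hi => (hh i (by omega)).symm) h3)⟩))
    (fun t ω h => hy t ω h.1) hE (fun s t ω hst h1 h2 => h2.2 s hst h1.1)
  have e1 : {ω | ∃ t, P t ω ∧ (∀ s < t, ¬ P s ω) ∧ sh t ω ∈ E} =
      {ω | ∃ t, ω ∈ {ω | P t ω ∧ (∀ s < t, ¬ P s ω)} ∧ sh t ω ∈ E} := by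
    ext ω; simp [and_assoc]
  have e2 : {ω | ∃ t, P t ω} = {ω | ∃ t, ω ∈ {ω | P t ω ∧ (∀ s < t, ¬ P s ω)}} := by
    ext ω
    constructor
    · rintro ⟨t, ht⟩
      obtain ⟨r, h1, h2, h3⟩ := first_after (P := fun t => P t ω) (s := 0) ⟨t, by omega, ht⟩
      exact ⟨r, h2, fun s hs => h3 s (by omega) hs⟩
    · rintro ⟨t, ht⟩; exact ⟨t, ht.1⟩
  rw [e1, e2, h]

theorem cross_up {ω : ℕ → ℕ} (h : ∀ t, ω (t+1) = ω t + 1 ∨ ω (t+1) + 1 = ω t) {s t e : ℕ}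
    (hst : s ≤ t) (h1 : ω s ≤ e) (h2 : e < ω t) : ∃ i, s ≤ i ∧ i < t ∧ ω i = e ∧ ω (i+1) = e+1 := by
  obtain ⟨r, h3, h4, h5, h6⟩ := last_before (P := fun i => ω i ≤ e) hst h1
  have h7 : r ≠ t := by rintro rfl; omega
  have h8 := h6 (r+1) (by omega) (by omega)
  have := h r
  exact ⟨r, h3, by omega, by omega, by omega⟩

theorem cross_dn {ω : ℕ → ℕ} (h : ∀ t, ω (t+1) = ω t + 1 ∨ ω (t+1) + 1 = ω t) {s t e : ℕ}
    (hst : s ≤ t) (h1 : e < ω s) (h2 : ω t ≤ e) : ∃ i, s ≤ i ∧ i < t ∧ ω i = e+1 ∧ ω (i+1) = e := by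
  obtain ⟨r, h3, h4, h5, h6⟩ := last_before (P := fun i => e < ω i) hst h1
  have h7 : r ≠ t := by rintro rfl; omega
  have h8 := h6 (r+1) (by omega) (by omega)
  have := h r
  exact ⟨r, h3, by omega, by omega, by omega⟩

theorem exists_mod (a n k : ℕ) (hk : k < n) : ∃ e, a ≤ e ∧ e < a + n ∧ e % n = k := by
  have hm := Nat.mod_lt a (show 0 < n by omega)
  have hd := Nat.div_add_mod a n
  by_cases h : a % n ≤ k
  · refine ⟨n * (a / n) + k, by omega, by omega, ?_⟩
    rw [Nat.mul_add_mod]; exact Nat.mod_eq_of_lt hk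
  · refine ⟨n * (a / n + 1) + k, ?_, ?_, ?_⟩
    · rw [Nat.mul_add]; omega
    · rw [Nat.mul_add]; omega
    · rw [Nat.mul_add_mod]; exact Nat.mod_eq_of_lt hk

theorem Rf_flat_up {S : ℕ → ℕ} (hS : ∀ t, S (t+1) = S t + 1 ∨ S (t+1) + 1 = S t) {s t a n : ℕ} (hst : s ≤ t)
    (hf : ∀ i, a ≤ i → i ≤ a + n → π.w i = n) (h1 : S s ≤ a) (h2 : a + n ≤ S t) : Rf π S s t n := by
  intro k hk
  obtain ⟨e, he1, he2, he3⟩ := exists_mod a n k hk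
  obtain ⟨i, hi1, hi2, hi3, hi4⟩ := cross_up hS hst (e := e) (by omega) (by omega)
  refine ⟨i, hi1, hi2, ?_⟩
  rw [ed, hi3, hi4, show min e (e+1) = e by omega, cc, if_neg, hf e (by omega) (by omega), he3]
  rw [hf e (by omega) (by omega), hf (e+1) (by omega) (by omega)]; omega

theorem Rf_flat_dn {S : ℕ → ℕ} (hS : ∀ t, S (t+1) = S t + 1 ∨ S (t+1) + 1 = S t) {s t a n : ℕ} (hst : s ≤ t)
    (hf : ∀ i, a ≤ i → i ≤ a + n → π.w i = n) (h1 : a + n ≤ S s) (h2 : S t ≤ a) : Rf π S s t n := by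
  intro k hk
  obtain ⟨e, he1, he2, he3⟩ := exists_mod a n k hk
  obtain ⟨i, hi1, hi2, hi3, hi4⟩ := cross_dn hS hst (e := e) (by omega) (by omega)
  refine ⟨i, hi1, hi2, ?_⟩
  rw [ed, hi3, hi4, show min (e+1) e = e by omega, cc, if_neg, hf e (by omega) (by omega), he3]
  rw [hf e (by omega) (by omega), hf (e+1) (by omega) (by omega)]; omega

/-! ### rich visits -/

def Rich (α c β n : ℕ) : ℕ → Set (ℕ → ℕ)
  | 0 => Set.univ
  | m+1 => {ω | ∃ t, ω t = c ∧ (∃ t1 ≤ t, ω t1 = c + n) ∧ (∀ i ≤ t, α < ω i ∧ ω i < β) ∧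
      sh t ω ∈ Rich α c β n m}

theorem measurableSet_Rich (α c β n m : ℕ) : MeasurableSet (Rich α c β n m) := by
  induction m with
  | zero => exact MeasurableSet.univ
  | succ m ih =>
    have : Rich α c β n (m+1) = ⋃ t, ({ω | ω t = c ∧ (∃ t1 ≤ t, ω t1 = c + n) ∧
        (∀ i ≤ t, α < ω i ∧ ω i < β)} ∩ sh t ⁻¹' (Rich α c β n m)) := by
      ext ω; simp [Rich, and_assoc]
    rw [this]
    refine MeasurableSet.iUnion fun t => MeasurableSet.inter ?_ (measurable_sh t ih)
    measurability

theorem Rich_anti (α c β n m : ℕ) : Rich α c β n (m+1) ⊆ Rich α c β n m := by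
  induction m with
  | zero => exact Set.subset_univ _
  | succ m ih =>
    rintro ω ⟨t, h1, h2, h3, h4⟩
    exact ⟨t, h1, h2, h3, ih h4⟩

theorem Rich_anti' (α c β n : ℕ) {m m' : ℕ} (h : m ≤ m') : Rich α c β n m' ⊆ Rich α c β n m := by
  induction m', h using Nat.le_induction with
  | base => exact le_rfl
  | succ m' _ ih => exact (Rich_anti α c β n m').trans ih

theorem Rich_seq {S : ℕ → ℕ} (hS : ∀ t, S (t+1) = S t + 1 ∨ S (t+1) + 1 = S t) {α c β n : ℕ}
    (hc : α < c) (hc' : c < β) (hf : ∀ i, c ≤ i → i ≤ c + n → π.w i = n) (m : ℕ) :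
    ∀ s, S s = c → sh s S ∈ Rich α c β n m →
    ∃ r : ℕ → ℕ, r 0 = s ∧ (∀ i ≤ m, S (r i) = c) ∧ (∀ i < m, r i ≤ r (i+1)) ∧
      (∀ i < m, Rf π S (r i) (r (i+1)) n) ∧ (∀ i, s ≤ i → i ≤ r m → α < S i ∧ S i < β) := by
  induction m with
  | zero =>
    intro s hs _
    refine ⟨fun _ => s, rfl, fun _ _ => hs, by omega, by omega, fun i h1 h2 => ?_⟩
    have : i = s := le_antisymm h2 h1
    rw [this, hs]; exact ⟨hc, hc'⟩
  | succ m ih =>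
    rintro s hs ⟨t, h1, ⟨t1, h2, h3⟩, h4, h5⟩
    simp only [sh_apply] at h1 h3 h4
    have h5' : sh (s+t) S ∈ Rich α c β n m := by
      have : sh (s+t) S = sh t (sh s S) := by ext i; simp [add_assoc]
      rw [this]; exact h5
    obtain ⟨r, r0, r1, r2, r3, r4⟩ := ih (s+t) h1 h5'
    refine ⟨fun i => if i = 0 then s else r (i-1), by simp, ?_, ?_, ?_, ?_⟩
    · intro i hi
      by_cases h : i = 0
      · simp [h, hs]
      · simp only [h, if_false]; exact r1 _ (by omega)
    · intro i hi
      by_cases h : i = 0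
      · simp [h, r0]
      · simp only [h, if_false, Nat.add_eq_zero_iff, Nat.add_sub_cancel]
        have := r2 (i-1) (by omega)
        rw [show i - 1 + 1 = i by omega] at this
        simpa using this
    · intro i hi
      by_cases h : i = 0
      · subst h
        simp only [if_true]
        simp only [zero_add, one_ne_zero, if_false, Nat.sub_self, r0]
        exact (Rf_flat_up π hS (show s ≤ s + t1 by omega) hf hs.le h3.ge).mono π le_rfl (by omega) le_rfl
      · have := r3 (i-1) (by omega)
        rw [show i - 1 + 1 = i by omega] at this
        simpa [h] using this
    · intro i h6 h7
      simp only [Nat.add_eq_zero_iff, one_ne_zero, and_false, if_false, Nat.add_sub_cancel] at h7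
      by_cases h : i ≤ s + t
      · have := h4 (i - s) (by omega)
        rwa [show s + (i - s) = i by omega] at this
      · exact r4 i (by omega) h7

theorem Rich_step (hH : HH π 0 ≠ ⊤) {α c β n : ℕ} (hc : α < c) (hn : 0 < n) (hc' : c + n < β) :
    R π c {ω | ∃ t, ω t = c ∧ (∃ t1 ≤ t, ω t1 = c + n) ∧ (∀ i ≤ t, α < ω i ∧ ω i < β)}ᶜ ≤
      rr π c (c+n) / rr π α (c+n) + rr π c (c+n) / rr π c β := by
  have h1 := HB_dn_le π (show α < c + n by omega) c
  have h2 := HB_up_le π (show c < β by omega) (c+n)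
  have h3 := strong_first π c (c+n) (fun t ω => ω t = c+n) (HB β c) (fun t => by measurability)
    (fun t ω ω' hh h => by rw [← hh t le_rfl]; exact h) (fun t ω h => h) (measurableSet_HB _ _)
  refine le_trans (measure_mono_ae (t := HB α (c+n) ∪
    {ω | ∃ t, ω t = c+n ∧ (∀ s < t, ¬ ω s = c+n) ∧ sh t ω ∈ HB β c}) ?_)
    ((measure_union_le _ _).trans (add_le_add h1 (h3.le.trans ?_)))
  · filter_upwards [ae_NP π hH c] with ω hω hne
    obtain ⟨hω0, hω⟩ := hω
    obtain ⟨t1, -, e1, e2⟩ := first_after (hω.hits (s := 0) (y := c+n) (by rw [hω0]; omega))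
    by_cases ha : ∃ s < t1, ω s = α
    · obtain ⟨s, hs, hs'⟩ := ha
      exact Or.inl ⟨s, hs', fun r hr => e2 r (by omega) (by omega)⟩
    push Not at ha
    refine Or.inr ⟨t1, e1, fun s hs => e2 s (by omega) hs, ?_⟩
    obtain ⟨t2, f0, f1, f2⟩ := first_after (hω.hits (s := t1) (y := β) (by rw [e1]; omega))
    refine ⟨t2 - t1, by simp [show t1 + (t2 - t1) = t2 by omega, f1], ?_⟩
    intro s hs hsc
    simp only [sh_apply] at hsc
    obtain ⟨t3, g0, g1, g2⟩ := first_after (P := fun t => ω t = c) (s := t1) ⟨t1+s, by omega, hsc⟩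
    have g3 : t3 ≤ t1 + s := by
      by_contra h
      exact g2 (t1+s) (by omega) (by omega) hsc
    refine hne ⟨t3, g1, ⟨t1, g0, e1⟩, fun i hi => ?_⟩
    by_cases h : i < t1
    · constructor
      · by_contra h'
        obtain ⟨r, r1, r2, r3⟩ := ivt_dn hω.step (Nat.zero_le i) (y := α) (by omega) (by omega)
        exact ha r (by omega) r3
      · by_contra h'
        obtain ⟨r, r1, r2, r3⟩ := ivt_up hω.step (Nat.zero_le i) (y := c+n) (by omega) (by omega)
        exact e2 r (by omega) (by omega) r3
    · constructor
      · by_contra h'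
        obtain ⟨r, r1, r2, r3⟩ := ivt_dn hω.step (show t1 ≤ i by omega) (y := c) (by omega) (by omega)
        have : r ≠ i := by rintro rfl; omega
        exact g2 r (by omega) (by omega) r3
      · by_contra h'
        obtain ⟨r, r1, r2, r3⟩ := ivt_up hω.step (show t1 ≤ i by omega) (y := β) (by omega) (by omega)
        exact f2 r (by omega) (by omega) r3
  · exact (mul_le_mul' prob_le_one h2).trans (by rw [one_mul])

theorem Rich_bound (hH : HH π 0 ≠ ⊤) {α c β n : ℕ} (hc : α < c) (hn : 0 < n) (hc' : c + n < β) (m : ℕ) :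
    R π c (Rich α c β n m)ᶜ ≤ m * (rr π c (c+n) / rr π α (c+n) + rr π c (c+n) / rr π c β) := by
  induction m with
  | zero => simp [Rich]
  | succ m ih =>
    have h0 := Rich_step π hH hc hn hc'
    set P : ℕ → (ℕ → ℕ) → Prop := fun t ω => ω t = c ∧ (∃ t1 ≤ t, ω t1 = c + n) ∧
      (∀ i ≤ t, α < ω i ∧ ω i < β) with hP
    have h1 := strong_first π c c P (Rich α c β n m)ᶜ (fun t => by simp only [hP]; measurability)
      (fun t ω ω' hh h => by
        obtain ⟨h1, ⟨t1, h2, h3⟩, h4⟩ := h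
        refine ⟨by rw [← hh t le_rfl]; exact h1, ⟨t1, h2, by rw [← hh t1 h2]; exact h3⟩, fun i hi => ?_⟩
        rw [← hh i hi]; exact h4 i hi) (fun t ω h => h.1) (measurableSet_Rich _ _ _ _ _).compl
    have hsub : (Rich α c β n (m+1))ᶜ ⊆ {ω | ∃ t, P t ω}ᶜ ∪
        {ω | ∃ t, P t ω ∧ (∀ s < t, ¬ P s ω) ∧ sh t ω ∈ (Rich α c β n m)ᶜ} := by
      intro ω hω
      by_cases h : ∃ t, P t ω
      · right
        obtain ⟨t, -, h2, h3⟩ := first_after (P := fun t => P t ω) (s := 0) (by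
          obtain ⟨t, ht⟩ := h; exact ⟨t, by omega, ht⟩)
        refine ⟨t, h2, fun s hs => h3 s (by omega) hs, fun h4 => hω ⟨t, h2.1, h2.2.1, h2.2.2, h4⟩⟩
      · exact Or.inl h
    refine (measure_mono hsub).trans ((measure_union_le _ _).trans ?_)
    rw [h1]
    push_cast
    rw [add_mul, one_mul, add_comm]
    exact add_le_add ((mul_le_mul' prob_le_one ih).trans (by rw [one_mul])) h0

end CutWalk

namespace CutWalk
open scoped ENNReal

instance instMSFin : MeasurableSpace (Finset ℕ) := ⊤
instance instDMSFin : DiscreteMeasurableSpace (Finset ℕ) := ⟨fun _ => trivial⟩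

variable (π : Prof)

theorem measurable_bb (t k : ℕ) :
    Measurable fun p : (ℕ → ℕ) × (ℕ → Bool) => bb π p.1 p.2 t k := by
  induction t with
  | zero => exact measurable_const
  | succ t ih =>
    simp only [bb]
    refine Measurable.ite ?_ (by fun_prop) ih
    have : Measurable fun p : (ℕ → ℕ) × (ℕ → Bool) => cc π (ed p.1 t) := by
      refine (measurable_from_top (f := cc π)).comp ?_
      unfold ed; fun_prop
    exact this (measurableSet_singleton k)

theorem measurable_bt (t : ℕ) :
    Measurable fun p : (ℕ → ℕ) × (ℕ → Bool) => bt π p.1 p.2 t := by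
  refine measurable_to_countable' fun y => ?_
  have : (fun p : (ℕ → ℕ) × (ℕ → Bool) => bt π p.1 p.2 t) ⁻¹' {y} =
      ⋂ k, {p | (k < π.w (p.1 t) ∧ bb π p.1 p.2 t k = true) ↔ k ∈ y} := by
    ext p
    simp [bt, Finset.ext_iff]
  rw [this]
  refine MeasurableSet.iInter fun k => ?_
  have h1 : MeasurableSet {p : (ℕ → ℕ) × (ℕ → Bool) | k < π.w (p.1 t)} := by
    have : Measurable fun p : (ℕ → ℕ) × (ℕ → Bool) => π.w (p.1 t) :=
      (measurable_from_top (f := π.w)).comp (by fun_prop)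
    exact measurableSet_lt measurable_const this
  have h2 : MeasurableSet {p : (ℕ → ℕ) × (ℕ → Bool) | bb π p.1 p.2 t k = true} :=
    measurable_bb π t k (measurableSet_singleton true)
  by_cases hk : k ∈ y
  · simp only [hk, iff_true]; exact h1.inter h2
  · simp only [hk, iff_false]; exact (h1.inter h2).compl

theorem measurable_XX (t : ℕ) :
    Measurable fun p : (ℕ → ℕ) × (ℕ → Bool) => XX π p.1 p.2 t :=
  Measurable.prodMk (by fun_prop) (measurable_bt π t)

noncomputable def PP : Measure ((ℕ → ℕ) × (ℕ → Bool)) := (R π 0).prod Q2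

instance : IsProbabilityMeasure (PP π) := by unfold PP; infer_instance

theorem PP_fst_ae {p : (ℕ → ℕ) → Prop} (h : ∀ᵐ ω ∂(R π 0), p ω) : ∀ᵐ x ∂(PP π), p x.1 :=
  Measure.quasiMeasurePreserving_fst.ae h

theorem PP_fst (A : Set (ℕ → ℕ)) (hA : MeasurableSet A) : PP π {x | x.1 ∈ A} = R π 0 A := by
  have : {x : (ℕ → ℕ) × (ℕ → Bool) | x.1 ∈ A} = A ×ˢ Set.univ := by ext; simp
  rw [this, PP, Measure.prod_prod, measure_univ, mul_one]

/-- fibrewise bound -/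
theorem PP_le (E : Set ((ℕ → ℕ) × (ℕ → Bool))) (hE : MeasurableSet E) (A : Set (ℕ → ℕ)) (hA : MeasurableSet A)
    (η : ℝ≥0∞) (h : ∀ S, Q2 {B | (S, B) ∈ E} ≤ A.indicator (fun _ => η) S) : PP π E ≤ R π 0 A * η := by
  rw [PP, Measure.prod_apply hE]
  refine (lintegral_mono h).trans ?_
  rw [lintegral_indicator_const hA, mul_comm]

theorem PP_le_ae (E : Set ((ℕ → ℕ) × (ℕ → Bool))) (hE : MeasurableSet E) (A : Set (ℕ → ℕ)) (hA : MeasurableSet A)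
    (η : ℝ≥0∞) (h : ∀ᵐ S ∂(R π 0), Q2 {B | (S, B) ∈ E} ≤ A.indicator (fun _ => η) S) :
    PP π E ≤ R π 0 A * η := by
  rw [PP, Measure.prod_apply hE]
  refine (lintegral_mono_ae h).trans ?_
  rw [lintegral_indicator_const hA, mul_comm]

/-- starts of sojourns in a cell -/
def Start (α c β s : ℕ) : Set (ℕ → ℕ) :=
  {ω | ω s = c ∧ ∀ s' < s, ω s' = c → ∃ i, s' < i ∧ i < s ∧ (ω i = α ∨ ω i = β)}

theorem measurableSet_Start (α c β s : ℕ) : MeasurableSet (Start α c β s) := by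
  unfold Start; measurability

theorem pre_Start (α c β s : ℕ) : Pre s (fun ω => ω ∈ Start α c β s) := by
  refine pre_of_imp ?_
  rintro ω ω' hh ⟨h1, h2⟩
  refine ⟨by rw [← hh s le_rfl]; exact h1, fun s' hs' hc => ?_⟩
  obtain ⟨i, h3, h4, h5⟩ := h2 s' hs' (by rw [hh s' hs'.le]; exact hc)
  exact ⟨i, h3, h4, by rw [← hh i h4.le]; exact h5⟩

theorem Start_sum (hH : HH π 0 ≠ ⊤) {α c β : ℕ} (hc : α < c) (hc' : c < β) :
    (∑' s, R π 0 (Start α c β s)) * (rr π α c * rr π c β) ≤ rr π α β * HH π c := by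
  set P : ℕ → (ℕ → ℕ) → Prop := fun t ω => ω t = β ∧ ∀ s < t, ω s ≠ α with hP
  set E : Set (ℕ → ℕ) := {ω | ∃ t, P t ω ∧ (∀ s < t, ¬ P s ω) ∧ sh t ω ∈ NV c} with hE
  have hPm : ∀ t, MeasurableSet {ω | P t ω} := fun t => by simp only [hP]; measurability
  have hEm : MeasurableSet E := by
    have : E = ⋃ t, ({ω | P t ω} ∩ ⋂ s, ⋂ (_ : s < t), {ω | P s ω}ᶜ) ∩ sh t ⁻¹' (NV c) := by
      ext ω; simp [hE, and_assoc]
    rw [this]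
    exact MeasurableSet.iUnion fun t => ((hPm t).inter (MeasurableSet.iInter fun s =>
      MeasurableSet.iInter fun _ => (hPm s).compl)).inter (measurable_sh t (measurableSet_NV c))
  have h1 : R π c E = R π c (HB β α) * R π β (NV c) :=
    strong_first π c β P (NV c) hPm (fun t ω ω' hh h =>
      ⟨by rw [← hh t le_rfl]; exact h.1, fun s hs => by rw [← hh s hs.le]; exact h.2 s hs⟩)
      (fun t ω h => h.1) (measurableSet_NV c)
  have h2 := last_visit π 0 c (fun s => Start α c β s) E (measurableSet_Start α c β)
    (pre_Start α c β) (fun s ω h => h.1) hEm (by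
      rintro s t ω hst hs ht ⟨t1, ⟨e1, e2⟩, e3, e4⟩
      obtain ⟨i, h3, h4, h5⟩ := ht.2 s hst hs.1
      have h6 : s + t1 ≤ i := by
        by_contra hlt
        rcases h5 with h5 | h5
        · refine e2 (i - s) (by omega) ?_
          simp only [sh_apply]; rwa [show s + (i - s) = i by omega]
        · refine e3 (i - s) (by omega) ⟨?_, fun r hr => e2 r (by omega)⟩
          simp only [sh_apply]; rwa [show s + (i - s) = i by omega]
      refine e4 (t - s - t1) ?_
      simp only [sh_apply]
      rw [show s + (t1 + (t - s - t1)) = t by omega]; exact ht.1)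
  have h3 := HB_up_ge π hH (show α < β by omega) hc.le hc'.le
  have h4 := NV_ge π hH hc'.le
  calc (∑' s, R π 0 (Start α c β s)) * (rr π α c * rr π c β)
      ≤ (∑' s, R π 0 (Start α c β s)) * ((rr π α β * R π c (HB β α)) * (HH π c * R π β (NV c))) := by
        gcongr
    _ = ((∑' s, R π 0 (Start α c β s)) * R π c E) * (rr π α β * HH π c) := by rw [h1]; ring
    _ ≤ 1 * (rr π α β * HH π c) := by gcongr
    _ = _ := one_mul _

def LinkAt {V : Type*} (S : ℕ → ℕ) (z : ℕ → V) (α c β s : ℕ) : Prop :=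
  ∀ t0, S t0 = c → (∀ s' < t0, S s' ≠ c) → ∃ r r', t0 ≤ r ∧ s ≤ r' ∧ z r = z r' ∧
    (∀ i, t0 ≤ i → i ≤ r → α < S i ∧ S i < β) ∧ (∀ i, s ≤ i → i ≤ r' → α < S i ∧ S i < β)

theorem link_of_linkAt {V : Type*} {S : ℕ → ℕ} {z : ℕ → V} (hS : ∀ t, S (t+1) = S t + 1 ∨ S (t+1) + 1 = S t)
    {α c β : ℕ} (hc : α < c) (hc' : c < β) (h : ∀ s, S ∈ Start α c β s → LinkAt S z α c β s) :
    Link S z α c β := by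
  intro t0 t h0 h0' ht
  obtain ⟨s, -, ⟨h1, h2, h3⟩, h4⟩ := first_after (P := fun s => s ≤ t ∧ S s = c ∧
    ∀ i, s ≤ i → i ≤ t → α < S i ∧ S i < β) (s := 0) ⟨t, by omega, le_rfl, ht, fun i h1 h2 => by
      rw [le_antisymm h2 h1, ht]; exact ⟨hc, hc'⟩⟩
  have hst : S ∈ Start α c β s := by
    refine ⟨h2, fun s' hs' hsc => ?_⟩
    have h5 := h4 s' (by omega) hs'
    push Not at h5
    obtain ⟨i, h6, h7, h8⟩ := h5 (by omega) hsc
    have h9 : i < s := by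
      by_contra h'
      have := h3 i (by omega) h7
      exact absurd (h8 this.1) (by omega)
    by_cases h10 : α < S i
    · have := h8 h10
      obtain ⟨r, r1, r2, r3⟩ := ivt_up hS h6 (y := β) (by omega) this
      have : r ≠ s' := by rintro rfl; omega
      exact ⟨r, by omega, by omega, Or.inr r3⟩
    · obtain ⟨r, r1, r2, r3⟩ := ivt_dn hS h6 (y := α) (by omega) (by omega)
      have : r ≠ s' := by rintro rfl; omega
      exact ⟨r, by omega, by omega, Or.inl r3⟩
  obtain ⟨r, r', e1, e2, e3, e4, e5⟩ := h s hst t0 h0 h0'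
  exact ⟨s, r, r', e1, e2, h1, e3, e4, e5, h3⟩

theorem measurableSet_LinkAt (α c β s : ℕ) :
    MeasurableSet {p : (ℕ → ℕ) × (ℕ → Bool) | LinkAt p.1 (XX π p.1 p.2) α c β s} := by
  have hX : ∀ r r', MeasurableSet {p : (ℕ → ℕ) × (ℕ → Bool) | XX π p.1 p.2 r = XX π p.1 p.2 r'} :=
    fun r r' => measurableSet_eq_fun (measurable_XX π r) (measurable_XX π r')
  have hc : ∀ t r, MeasurableSet {p : (ℕ → ℕ) × (ℕ → Bool) | ∀ i, t ≤ i → i ≤ r → α < p.1 i ∧ p.1 i < β} := by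
    intro t r
    have : MeasurableSet {ω : ℕ → ℕ | ∀ i, t ≤ i → i ≤ r → α < ω i ∧ ω i < β} := by measurability
    exact measurable_fst this
  have hf : ∀ t0, MeasurableSet {p : (ℕ → ℕ) × (ℕ → Bool) | p.1 t0 = c ∧ (∀ s' < t0, p.1 s' ≠ c)} := by
    intro t0
    have : MeasurableSet {ω : ℕ → ℕ | ω t0 = c ∧ (∀ s' < t0, ω s' ≠ c)} := by measurability
    exact measurable_fst this
  have : {p : (ℕ → ℕ) × (ℕ → Bool) | LinkAt p.1 (XX π p.1 p.2) α c β s} =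
      ⋂ t0, ({p | p.1 t0 = c ∧ (∀ s' < t0, p.1 s' ≠ c)}ᶜ ∪ ⋃ r, ⋃ r', ({_p | t0 ≤ r ∧ s ≤ r'} ∩
        {p | XX π p.1 p.2 r = XX π p.1 p.2 r'} ∩ {p | ∀ i, t0 ≤ i → i ≤ r → α < p.1 i ∧ p.1 i < β} ∩
        {p | ∀ i, s ≤ i → i ≤ r' → α < p.1 i ∧ p.1 i < β})) := by
    ext p
    simp only [LinkAt, Set.mem_iInter, Set.mem_union, Set.mem_compl_iff, Set.mem_iUnion, Set.mem_inter_iff,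
      Set.mem_ofPred_eq]
    refine forall_congr' fun t0 => ?_
    constructor
    · intro h
      by_cases h1 : p.1 t0 = c ∧ (∀ s' < t0, p.1 s' ≠ c)
      · obtain ⟨r, r', e1, e2, e3, e4, e5⟩ := h h1.1 h1.2
        exact Or.inr ⟨r, r', ⟨⟨⟨e1, e2⟩, e3⟩, e4⟩, e5⟩
      · exact Or.inl h1
    · rintro (h | ⟨r, r', ⟨⟨⟨e1, e2⟩, e3⟩, e4⟩, e5⟩) h1 h2
      · exact absurd ⟨h1, h2⟩ h
      · exact ⟨r, r', e1, e2, e3, e4, e5⟩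
  rw [this]
  exact MeasurableSet.iInter fun t0 => (hf t0).compl.union (MeasurableSet.iUnion fun r =>
    MeasurableSet.iUnion fun r' => (((MeasurableSet.const _).inter (hX r r')).inter (hc _ _)).inter (hc _ _))

theorem linkAt_fail {S : ℕ → ℕ} (hS : ∀ t, S (t+1) = S t + 1 ∨ S (t+1) + 1 = S t)
    {α c β n : ℕ} (hc : α < c) (hn : 0 < n) (hc' : c + n < β)
    (hf : ∀ i, c ≤ i → i ≤ c + n → π.w i = n) (a b : ℕ) (ha : 0 < a) (hb : 0 < b) (haW : a ≤ 2 ^ n)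
    (hab : a ≤ b) (hrich : ∀ s, S ∈ Start α c β s → sh s S ∈ Rich α c β n b) (s : ℕ) (hs : S ∈ Start α c β s) :
    Q2 {B | ¬ LinkAt S (XX π S B) α c β s} ≤ (a:ℝ≥0∞) * a / 2 ^ n + 2 ^ n / ((a:ℝ≥0∞) * b) := by
  by_cases hex : ∃ t0, S t0 = c ∧ (∀ s' < t0, S s' ≠ c) ∧ t0 ≠ s
  · obtain ⟨t0, h0, h1, h2⟩ := hex
    have hst0 : S ∈ Start α c β t0 := ⟨h0, fun s' h3 h4 => absurd h4 (h1 s' h3)⟩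
    have h3 : t0 < s := by
      by_contra h
      exact h1 s (by omega) hs.1
    obtain ⟨i, i1, i2, i3⟩ := hs.2 t0 h3 h0
    obtain ⟨r, r0, r1, r2, r3, r4⟩ := Rich_seq π hS hc (by omega) hf a t0 h0
      (Rich_anti' α c β n hab (hrich t0 hst0))
    obtain ⟨r', r0', r1', r2', r3', r4'⟩ := Rich_seq π hS hc (by omega) hf b s hs.1 (hrich s hs)
    have h4 : r a ≤ r' 0 := by
      rw [r0']
      by_contra h
      have := r4 i (by omega) (by omega)
      omega
    have mono1 : ∀ (r : ℕ → ℕ) (a : ℕ), (∀ i < a, r i ≤ r (i+1)) → ∀ i ≤ a, r 0 ≤ r i ∧ r i ≤ r a := by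
      intro r a hr
      have : ∀ j ≤ a, ∀ i ≤ j, r i ≤ r j := by
        intro j
        induction j with
        | zero => intro _ i hi; rw [Nat.le_zero.1 hi]
        | succ j ih =>
          intro hj i hi
          rcases Nat.lt_or_ge j i with h | h
          · rw [show i = j+1 by omega]
          · exact (ih (by omega) i h).trans (hr j (by omega))
      exact fun i hi => ⟨this i hi 0 (by omega), this a le_rfl i hi⟩
    refine le_trans (measure_mono ?_) (no_match π S n r r' a b ha hb haW
      (fun i _ hi => by rw [r1 i hi]; exact hf c le_rfl (by omega)) r3 r2
      (fun i _ hi => by rw [r1' i hi]; exact hf c le_rfl (by omega)) r3' r2' h4)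
    intro B hB i k hi1 hi2 hk1 hk2 heq
    apply hB
    intro t hh0 hh1
    have : t = t0 := by
      rcases lt_trichotomy t t0 with h | h | h
      · exact absurd hh0 (h1 t h)
      · exact h
      · exact absurd h0 (hh1 t0 h)
    subst this
    have m1 := mono1 r a r2 i hi2
    have m2 := mono1 r' b r2' k hk2
    refine ⟨r i, r' k, by omega, by omega, ?_, fun j j1 j2 => r4 j j1 (by omega),
      fun j j1 j2 => r4' j j1 (by omega)⟩
    rw [XX, XX, r1 i hi2, r1' k hk2, heq]
  · push Not at hex
    have : {B | ¬ LinkAt S (XX π S B) α c β s} = ∅ := by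
      ext B
      simp only [Set.mem_ofPred_eq, Set.mem_empty_iff_false, iff_false, not_not]
      intro t0 h0 h1
      have := hex t0 h0 h1
      subst this
      refine ⟨t0, t0, le_rfl, le_rfl, rfl, fun i i1 i2 => ?_, fun i i1 i2 => ?_⟩ <;>
      · rw [le_antisymm i2 i1, h0]; omega
    rw [this]; simp

theorem cell_bound (hH : HH π 0 ≠ ⊤) {α c β n : ℕ} (hc : α < c) (hn : 0 < n) (hc' : c + n < β)
    (hf : ∀ i, c ≤ i → i ≤ c + n → π.w i = n) (a b : ℕ) (ha : 0 < a) (hb : 0 < b) (haW : a ≤ 2 ^ n)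
    (hab : a ≤ b) :
    PP π {p | ¬ Link p.1 (XX π p.1 p.2) α c β} * (rr π α c * rr π c β) ≤ rr π α β * HH π c *
     ((b * (rr π c (c+n) / rr π α (c+n) + rr π c (c+n) / rr π c β)) +
      ((a:ℝ≥0∞) * a / 2 ^ n + 2 ^ n / ((a:ℝ≥0∞) * b))) := by
  set η := (a:ℝ≥0∞) * a / 2 ^ n + 2 ^ n / ((a:ℝ≥0∞) * b) with hη
  set G : Set (ℕ → ℕ) := {ω | ∃ s, ω ∈ Start α c β s ∧ sh s ω ∈ (Rich α c β n b)ᶜ} with hG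
  have hGm : MeasurableSet G := by
    have : G = ⋃ s, (Start α c β s ∩ sh s ⁻¹' (Rich α c β n b)ᶜ) := by ext; simp [hG]
    rw [this]
    exact MeasurableSet.iUnion fun s => (measurableSet_Start _ _ _ s).inter
      (measurable_sh s (measurableSet_Rich _ _ _ _ _).compl)
  set E : ℕ → Set ((ℕ → ℕ) × (ℕ → Bool)) := fun s =>
    {p | p.1 ∈ Start α c β s} ∩ {p | p.1 ∈ Gᶜ} ∩ {p | LinkAt p.1 (XX π p.1 p.2) α c β s}ᶜ with hE
  have hEm : ∀ s, MeasurableSet (E s) := fun s =>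
    ((measurable_fst (measurableSet_Start _ _ _ s)).inter (measurable_fst hGm.compl)).inter
      (measurableSet_LinkAt π α c β s).compl
  have h1 : PP π {p | ¬ Link p.1 (XX π p.1 p.2) α c β} ≤ PP π ({p | p.1 ∈ G} ∪ ⋃ s, E s) := by
    refine measure_mono_ae ?_
    filter_upwards [PP_fst_ae π (ae_NP π hH 0)] with p hp hL
    by_cases hg : p.1 ∈ G
    · exact Or.inl hg
    · right
      have : ∃ s, p.1 ∈ Start α c β s ∧ ¬ LinkAt p.1 (XX π p.1 p.2) α c β s := by
        by_contra h
        push Not at h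
        exact hL (link_of_linkAt hp.2.step hc (by omega) h)
      obtain ⟨s, h2, h3⟩ := this
      rw [Set.mem_iUnion]
      exact ⟨s, ⟨h2, hg⟩, h3⟩
  have h2 : PP π {p | p.1 ∈ G} ≤ (∑' s, R π 0 (Start α c β s)) *
      (b * (rr π c (c+n) / rr π α (c+n) + rr π c (c+n) / rr π c β)) := by
    rw [PP_fst π G hGm]
    refine (union_markov π 0 c (fun s => Start α c β s) _ (measurableSet_Start α c β)
      (pre_Start α c β) (fun s ω h => h.1) (measurableSet_Rich _ _ _ _ _).compl).trans ?_
    gcongr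
    exact Rich_bound π hH hc hn hc' b
  have h3 : ∀ s, PP π (E s) ≤ R π 0 (Start α c β s) * η := by
    intro s
    refine PP_le_ae π _ (hEm s) _ (measurableSet_Start _ _ _ s) η ?_
    filter_upwards [ae_NP π hH 0] with S hS
    by_cases hs : S ∈ Start α c β s
    · rw [Set.indicator_of_mem hs]
      by_cases hg : S ∈ G
      · have : {B | (S, B) ∈ E s} = ∅ := by
          ext B
          simp only [hE, Set.mem_empty_iff_false, iff_false]
          rintro ⟨⟨-, h⟩, -⟩
          exact h hg
        rw [this]; simp
      · refine le_trans (measure_mono ?_) (linkAt_fail π hS.2.step hc hn hc' hf a b ha hb haW hab ?_ s hs)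
        · rintro B ⟨-, h⟩
          exact h
        · intro s hs
          by_contra h
          exact hg ⟨s, hs, h⟩
    · have : {B | (S, B) ∈ E s} = ∅ := by
        ext B
        simp only [hE, Set.mem_empty_iff_false, iff_false]
        rintro ⟨⟨h, -⟩, -⟩
        exact hs h
      rw [this]; simp
  have h4 : PP π {p | ¬ Link p.1 (XX π p.1 p.2) α c β} ≤ (∑' s, R π 0 (Start α c β s)) *
      ((b * (rr π c (c+n) / rr π α (c+n) + rr π c (c+n) / rr π c β)) + η) := by
    refine h1.trans ((measure_union_le _ _).trans ?_)
    rw [mul_add]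
    refine add_le_add h2 ((measure_iUnion_le _).trans ((ENNReal.tsum_le_tsum h3).trans ?_))
    rw [ENNReal.tsum_mul_right]
  calc _ ≤ ((∑' s, R π 0 (Start α c β s)) *
      ((b * (rr π c (c+n) / rr π α (c+n) + rr π c (c+n) / rr π c β)) + η)) * (rr π α c * rr π c β) := by
        gcongr
    _ = ((∑' s, R π 0 (Start α c β s)) * (rr π α c * rr π c β)) *
      ((b * (rr π c (c+n) / rr π α (c+n) + rr π c (c+n) / rr π c β)) + η) := by ring
    _ ≤ _ := by
      have := Start_sum π hH hc (show c < β by omega)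
      gcongr

end CutWalk

namespace CutWalk
open scoped ENNReal

variable (π : Prof)

theorem ed_congr {S S' : ℕ → ℕ} {t : ℕ} (h : ∀ i ≤ t + 1, S i = S' i) : ed S t = ed S' t := by
  rw [ed, ed, h t (by omega), h (t+1) le_rfl]

theorem bb_congr {S S' : ℕ → ℕ} (B : ℕ → Bool) {t : ℕ} (h : ∀ i ≤ t, S i = S' i) (k : ℕ) :
    bb π S B t k = bb π S' B t k := by
  induction t with
  | zero => rfl
  | succ t ih => simp only [bb, ed_congr h, ih (fun i hi => h i (by omega))]

theorem XX_congr {S S' : ℕ → ℕ} (B : ℕ → Bool) {t : ℕ} (h : ∀ i ≤ t, S i = S' i) :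
    XX π S B t = XX π S' B t := by
  simp only [XX, bt, bb_congr π B h, h t le_rfl]

/-- hit `q` before returning to `n` -/
def HR (n q : ℕ) : Set (ℕ → ℕ) := {ω | ∃ t, ω t = q ∧ ∀ s, 0 < s → s < t → ω s ≠ n}

theorem measurableSet_HR (n q : ℕ) : MeasurableSet (HR n q) := by unfold HR; measurability

theorem HR_ge (hH : HH π 0 ≠ ⊤) {n q : ℕ} (hnq : n < q) : aa π n ≤ 2 * rr π n q * R π n (HR n q) := by
  have h1 := HB_up_ge π hH hnq (show n ≤ n+1 by omega) (show n+1 ≤ q by omega)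
  rw [rr_succ π le_rfl, rr_self, zero_add] at h1
  have h2 : up π n * R π (n+1) (HB q n) ≤ R π n (HR n q) := by
    rw [meas_step π n _ (measurableSet_HR n q)]
    refine le_trans ?_ le_self_add
    gcongr
    rintro ω ⟨t, h3, h4⟩
    refine ⟨t+1, by simpa using h3, ?_⟩
    intro s hs hs'
    obtain ⟨m, rfl⟩ : ∃ m, s = m+1 := ⟨s-1, by omega⟩
    simpa using h4 m (by omega)
  have h3 : R π (n+1) (HB q n) ≤ 2 * R π n (HR n q) := by
    calc R π (n+1) (HB q n) = 2 * (2⁻¹ * R π (n+1) (HB q n)) := by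
          rw [← mul_assoc, ENNReal.mul_inv_cancel (by norm_num) (by norm_num), one_mul]
      _ ≤ 2 * (up π n * R π (n+1) (HB q n)) := by gcongr; exact up_ge π n
      _ ≤ _ := by gcongr
  calc aa π n ≤ rr π n q * R π (n+1) (HB q n) := h1
    _ ≤ rr π n q * (2 * R π n (HR n q)) := by gcongr
    _ = _ := by ring

/-- visit counting before a forbidden `q` -/
theorem visit_sum (hH : HH π 0 ≠ ⊤) (x : ℕ) {n q : ℕ} (hnq : n < q) (A : ℕ → Set (ℕ → ℕ))
    (hA : ∀ t, MeasurableSet (A t)) (hp : ∀ t, Pre t (fun ω => ω ∈ A t)) (hy : ∀ t, ∀ ω ∈ A t, ω t = n)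
    (hd : ∀ s t ω, s < t → ω ∈ A s → ω ∈ A t → ∀ i, s ≤ i → i ≤ t → ω i ≠ q) :
    (∑' t, R π x (A t)) * aa π n ≤ 2 * rr π n q := by
  have h1 := last_visit π x n A (HR n q) hA hp hy (measurableSet_HR n q) (by
    rintro s t ω hst hs ht ⟨r, h1, h2⟩
    have h3 : s + r ≤ t := by
      by_contra h
      refine h2 (t - s) (by omega) (by omega) ?_
      simp only [sh_apply]
      rw [show s + (t-s) = t by omega]; exact hy t ω ht
    exact hd s t ω hst hs ht (s+r) (by omega) h3 h1)
  calc (∑' t, R π x (A t)) * aa π n ≤ (∑' t, R π x (A t)) * (2 * rr π n q * R π n (HR n q)) := by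
        gcongr; exact HR_ge π hH hnq
    _ = ((∑' t, R π x (A t)) * R π n (HR n q)) * (2 * rr π n q) := by ring
    _ ≤ 1 * (2 * rr π n q) := by gcongr
    _ = _ := one_mul _

/-- `M` returns from `q` to `p` -/
def RetS (p q : ℕ) : ℕ → Set (ℕ → ℕ)
  | 0 => Set.univ
  | M+1 => {ω | ∃ r1 r2, r1 ≤ r2 ∧ ω r1 = q ∧ ω r2 = p ∧ sh r2 ω ∈ RetS p q M}

theorem sh_sh {α : Type*} (a b : ℕ) (ω : ℕ → α) : sh a (sh b ω) = sh (b+a) ω := by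
  ext i; simp [add_assoc]

theorem RetS_back {p q k : ℕ} {S : ℕ → ℕ} {s τ : ℕ} (h : sh s S ∈ RetS p q k) (hτ : τ ≤ s) :
    sh τ S ∈ RetS p q k := by
  cases k with
  | zero => trivial
  | succ k =>
    obtain ⟨r1, r2, h1, h2, h3, h4⟩ := h
    refine ⟨s - τ + r1, s - τ + r2, by omega, ?_, ?_, ?_⟩
    · simp only [sh_apply] at h2 ⊢; rwa [show τ + (s - τ + r1) = s + r1 by omega]
    · simp only [sh_apply] at h3 ⊢; rwa [show τ + (s - τ + r2) = s + r2 by omega]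
    · rw [sh_sh] at h4 ⊢; rwa [show τ + (s - τ + r2) = s + r2 by omega]

theorem RetS_fwd {p q k : ℕ} {S : ℕ → ℕ} {s τ : ℕ} (h : sh s S ∈ RetS p q k) (hτ : s ≤ τ)
    (hq : ∀ i, s ≤ i → i < τ → S i ≠ q) : sh τ S ∈ RetS p q k := by
  cases k with
  | zero => trivial
  | succ k =>
    obtain ⟨r1, r2, h1, h2, h3, h4⟩ := h
    have : τ ≤ s + r1 := by
      by_contra h
      exact hq (s+r1) (by omega) (by omega) h2
    refine ⟨s + r1 - τ, s + r2 - τ, by omega, ?_, ?_, ?_⟩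
    · simp only [sh_apply] at h2 ⊢; rwa [show τ + (s + r1 - τ) = s + r1 by omega]
    · simp only [sh_apply] at h3 ⊢; rwa [show τ + (s + r2 - τ) = s + r2 by omega]
    · rw [sh_sh] at h4 ⊢; rwa [show τ + (s + r2 - τ) = s + r2 by omega]

/-- one round: first `q`, then first `p`, then at `n` at time `u` before the next `q` -/
def Rl (n p q u : ℕ) : Set (ℕ → ℕ) :=
  {ω | ω u = n ∧ ∃ σ1 σ2, σ1 ≤ σ2 ∧ σ2 ≤ u ∧ (ω σ1 = q ∧ ∀ i < σ1, ω i ≠ q) ∧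
    (ω σ2 = p ∧ ∀ i, σ1 ≤ i → i < σ2 → ω i ≠ p) ∧ ∀ i, σ2 ≤ i → i ≤ u → ω i ≠ q}

theorem measurableSet_Rl (n p q u : ℕ) : MeasurableSet (Rl n p q u) := by unfold Rl; measurability

theorem pre_Rl (n p q u : ℕ) : Pre u (fun ω => ω ∈ Rl n p q u) := by
  refine pre_of_imp ?_
  rintro ω ω' hh ⟨h1, σ1, σ2, h2, h3, ⟨h4, h5⟩, ⟨h6, h7⟩, h8⟩
  refine ⟨by rw [← hh u le_rfl]; exact h1, σ1, σ2, h2, h3, ⟨?_, fun i hi => ?_⟩, ⟨?_, fun i hi hi' => ?_⟩,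
    fun i hi hi' => ?_⟩
  · rw [← hh σ1 (by omega)]; exact h4
  · rw [← hh i (by omega)]; exact h5 i hi
  · rw [← hh σ2 (by omega)]; exact h6
  · rw [← hh i (by omega)]; exact h7 i hi hi'
  · rw [← hh i (by omega)]; exact h8 i hi hi'

theorem Rl_sum (hH : HH π 0 ≠ ⊤) (x : ℕ) {n p q : ℕ} (hnq : n < q) :
    (∑' u, R π x (Rl n p q u)) * aa π n ≤ 2 * rr π n q := by
  refine visit_sum π hH x hnq _ (measurableSet_Rl n p q) (pre_Rl n p q) (fun u ω h => h.1) ?_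
  rintro s t ω hst ⟨-, σ1, σ2, h2, h3, ⟨h4, h5⟩, ⟨h6, h7⟩, h8⟩
    ⟨-, σ1', σ2', h2', h3', ⟨h4', h5'⟩, ⟨h6', h7'⟩, h8'⟩ i hi hi'
  have e1 : σ1 = σ1' := by
    rcases lt_trichotomy σ1 σ1' with h | h | h
    · exact absurd h4 (h5' σ1 h)
    · exact h
    · exact absurd h4' (h5 σ1' h)
  subst e1
  have e2 : σ2 = σ2' := by
    rcases lt_trichotomy σ2 σ2' with h | h | h
    · exact absurd h6 (h7' σ2 h2 h)
    · exact h
    · exact absurd h6' (h7 σ2' h2' h)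
  subst e2
  exact h8' i (by omega) hi'

/-- `CC m t`: `v = (n,y)` is visited at time `t` after `m` rounds, all visits to `v` -/
def CC (v : ℕ × Finset ℕ) (p q : ℕ) : ℕ → ℕ → Set ((ℕ → ℕ) × (ℕ → Bool))
  | 0, t => {x | XX π x.1 x.2 t = v ∧ ∀ i ≤ t, x.1 i ≠ q}
  | m+1, t => {x | XX π x.1 x.2 t = v ∧ ∃ s ≤ t, x ∈ CC v p q m s ∧ sh s x.1 ∈ Rl v.1 p q (t-s)}

theorem CC_X {v : ℕ × Finset ℕ} {p q m t : ℕ} {x : (ℕ → ℕ) × (ℕ → Bool)} (h : x ∈ CC π v p q m t) :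
    XX π x.1 x.2 t = v := by
  cases m with
  | zero => exact h.1
  | succ m => exact h.1

theorem measurableSet_CC (v : ℕ × Finset ℕ) (p q m : ℕ) : ∀ t, MeasurableSet (CC π v p q m t) := by
  have hX : ∀ t, MeasurableSet {x : (ℕ → ℕ) × (ℕ → Bool) | XX π x.1 x.2 t = v} := fun t =>
    measurable_XX π t (measurableSet_singleton v)
  induction m with
  | zero =>
    intro t
    have h2 : MeasurableSet {x : (ℕ → ℕ) × (ℕ → Bool) | ∀ i ≤ t, x.1 i ≠ q} := by
      have : MeasurableSet {ω : ℕ → ℕ | ∀ i ≤ t, ω i ≠ q} := by measurability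
      exact measurable_fst this
    exact (hX t).inter h2
  | succ m ih =>
    intro t
    have : CC π v p q (m+1) t = {x | XX π x.1 x.2 t = v} ∩ ⋃ s, ⋃ (_ : s ≤ t), (CC π v p q m s ∩
        {x | sh s x.1 ∈ Rl v.1 p q (t-s)}) := by
      ext x
      simp only [CC, Set.mem_inter_iff, Set.mem_iUnion, Set.mem_ofPred_eq, exists_prop]
    rw [this]
    exact (hX t).inter (MeasurableSet.iUnion fun s => MeasurableSet.iUnion fun _ => (ih s).inter
      (((measurable_sh s).comp measurable_fst) (measurableSet_Rl _ _ _ _)))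

theorem CC_preB (v : ℕ × Finset ℕ) (p q m : ℕ) (S : ℕ → ℕ) : ∀ t, PreB t {B | (S, B) ∈ CC π v p q m t} := by
  have hX : ∀ t (B B' : ℕ → Bool), (∀ i < t, B i = B' i) → XX π S B t = v → XX π S B' t = v := by
    intro t B B' hh h
    rw [XX, ← bt_pre π S B B' t hh]; exact h
  induction m with
  | zero =>
    rintro t B B' hh ⟨h1, h2⟩
    exact ⟨hX t B B' hh h1, h2⟩
  | succ m ih =>
    rintro t B B' hh ⟨h1, s, h2, h3, h4⟩
    exact ⟨hX t B B' hh h1, s, h2, ih s B B' (fun i hi => hh i (by omega)) h3, h4⟩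

theorem CC_pre (v : ℕ × Finset ℕ) (p q m : ℕ) (B : ℕ → Bool) : ∀ t (S S' : ℕ → ℕ), (∀ i ≤ t, S i = S' i) →
    (S, B) ∈ CC π v p q m t → (S', B) ∈ CC π v p q m t := by
  induction m with
  | zero =>
    rintro t S S' hh ⟨h1, h2⟩
    refine ⟨?_, fun i hi => ?_⟩
    · change XX π S' B t = v
      rw [← XX_congr π B hh]; exact h1
    · change S' i ≠ q
      rw [← hh i hi]; exact h2 i hi
  | succ m ih =>
    rintro t S S' hh ⟨h1, s, h2, h3, h4⟩
    refine ⟨?_, s, h2, ih s S S' (fun i hi => hh i (by omega)) h3, ?_⟩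
    · change XX π S' B t = v
      rw [← XX_congr π B hh]; exact h1
    · have := pre_Rl v.1 p q (t-s) (sh s S) (sh s S') (fun i hi => by
        simp only [sh_apply]; exact hh _ (by omega))
      exact this.mp h4

theorem PP_apply (E : Set ((ℕ → ℕ) × (ℕ → Bool))) (hE : MeasurableSet E) :
    PP π E = ∫⁻ S, Q2 {B | (S, B) ∈ E} ∂(R π 0) := by
  rw [PP, Measure.prod_apply hE]; rfl

theorem w_mono_step {a b : ℕ} (h : a ≤ b) : π.w a ≤ π.w b := by
  induction b, h using Nat.le_induction with
  | base => exact le_rfl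
  | succ b _ ih => rcases π.step b with h | h <;> omega

theorem growth_edge {n k : ℕ} (hk : k < π.w n) : ∃ e < n, cc π e = k := by
  induction n with
  | zero => rw [π.w0] at hk; omega
  | succ n ih =>
    by_cases h : k < π.w n
    · obtain ⟨e, h1, h2⟩ := ih h
      exact ⟨e, by omega, h2⟩
    · refine ⟨n, by omega, ?_⟩
      have := π.step n
      rw [cc, if_pos (by omega)]
      omega

theorem ed_of_up {S : ℕ → ℕ} {i e : ℕ} (h1 : S i = e) (h2 : S (i+1) = e+1) : ed S i = e := by
  rw [ed, h1, h2]; omega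
theorem ed_of_dn {S : ℕ → ℕ} {i e : ℕ} (h1 : S i = e+1) (h2 : S (i+1) = e) : ed S i = e := by
  rw [ed, h1, h2]; omega

theorem CC_zero_sum (hH : HH π 0 ≠ ⊤) {v : ℕ × Finset ℕ} {p q : ℕ} (hvq : v.1 < q) :
    ∑' t, PP π (CC π v p q 0 t) ≤ 2 * rr π v.1 q := by
  set A : ℕ → Set (ℕ → ℕ) := fun t => {ω | ω t = v.1 ∧ ∀ i ≤ t, ω i ≠ q} with hA
  have hAm : ∀ t, MeasurableSet (A t) := fun t => by simp only [hA]; measurability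
  have h1 : ∀ t, PP π (CC π v p q 0 t) ≤ R π 0 (A t) * aa π v.1 := by
    intro t
    refine PP_le_ae π _ (measurableSet_CC π v p q 0 t) _ (hAm t) _ ?_
    filter_upwards [ae_NP π hH 0] with S hS
    by_cases hs : S ∈ A t
    · rw [Set.indicator_of_mem hs]
      have hR : Rf π S 0 t (π.w (S t)) := by
        intro k hk
        rw [hs.1] at hk
        obtain ⟨e, he, hc⟩ := growth_edge π hk
        obtain ⟨i, i1, i2, i3, i4⟩ := cross_up hS.2.step (Nat.zero_le t) (e := e) (by rw [hS.1]; omega)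
          (by rw [hs.1]; exact he)
        exact ⟨i, i1, i2, by rw [ed_of_up i3 i4, hc]⟩
      have := bits_le π S hR (E := Set.univ) (fun B B' _ h => h) v.2
      rw [measure_univ, one_mul, hs.1] at this
      refine le_trans (measure_mono ?_) this
      rintro B ⟨h1, -⟩
      exact ⟨trivial, congrArg Prod.snd h1⟩
    · have : {B | (S, B) ∈ CC π v p q 0 t} = ∅ := by
        ext B
        simp only [Set.mem_empty_iff_false, iff_false]
        rintro ⟨h1, h2⟩
        exact hs ⟨congrArg Prod.fst h1, h2⟩
      rw [this]; simp
  refine (ENNReal.tsum_le_tsum h1).trans ?_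
  rw [ENNReal.tsum_mul_right]
  refine visit_sum π hH 0 hvq A hAm (fun t => pre_of_imp ?_) (fun t ω h => h.1) ?_
  · rintro ω ω' hh ⟨h1, h2⟩
    exact ⟨by rw [← hh t le_rfl]; exact h1, fun i hi => by rw [← hh i hi]; exact h2 i hi⟩
  · rintro s t ω hst hs ht i hi hi'
    exact ht.2 i hi'

theorem CC_succ_sum (hH : HH π 0 ≠ ⊤) {v : ℕ × Finset ℕ} {p q : ℕ} (hvq : v.1 < q)
    (hcov : ∀ k < π.w v.1, ∃ e, p ≤ e ∧ e < q ∧ cc π e = k) (m : ℕ) :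
    ∑' t, PP π (CC π v p q (m+1) t) ≤ (∑' t, PP π (CC π v p q m t)) * (2 * rr π v.1 q) := by
  set f : ℕ → (ℕ → ℕ) → ℝ≥0∞ := fun s S => Q2 {B | (S, B) ∈ CC π v p q m s} with hf
  have hfm : ∀ s, Measurable (f s) := fun s => measurable_measure_prodMk_left (measurableSet_CC π v p q m s)
  have hfp : ∀ s, Pre s (f s) := by
    intro s S S' hh
    simp only [hf]
    congr 1
    ext B
    exact ⟨CC_pre π v p q m B s S S' hh, CC_pre π v p q m B s S' S fun i hi => (hh i hi).symm⟩
  have hfy : ∀ s S, f s S ≠ 0 → S s = v.1 := by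
    intro s S h
    by_contra h1
    apply h
    have : {B | (S, B) ∈ CC π v p q m s} = ∅ := by
      ext B
      simp only [Set.mem_empty_iff_false, iff_false]
      intro h2
      exact h1 (congrArg Prod.fst (CC_X π h2))
    simp only [hf, this]; simp
  have key : ∀ t, PP π (CC π v p q (m+1) t) ≤ ∑' s, if s ≤ t then
      PP π (CC π v p q m s) * R π v.1 (Rl v.1 p q (t-s)) * aa π v.1 else 0 := by
    intro t
    have h1 : CC π v p q (m+1) t ⊆ ⋃ s, {x | s ≤ t ∧ XX π x.1 x.2 t = v ∧ x ∈ CC π v p q m s ∧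
        sh s x.1 ∈ Rl v.1 p q (t-s)} := by
      rintro x ⟨h1, s, h2, h3, h4⟩
      rw [Set.mem_iUnion]
      exact ⟨s, h2, h1, h3, h4⟩
    refine (measure_mono h1).trans ((measure_iUnion_le _).trans (ENNReal.tsum_le_tsum fun s => ?_))
    by_cases hst : s ≤ t
    · rw [if_pos hst]
      have hm : MeasurableSet {x | s ≤ t ∧ XX π x.1 x.2 t = v ∧ x ∈ CC π v p q m s ∧
        sh s x.1 ∈ Rl v.1 p q (t-s)} :=
        (MeasurableSet.const _).inter ((measurable_XX π t (measurableSet_singleton v)).inter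
          ((measurableSet_CC π v p q m s).inter
            (((measurable_sh s).comp measurable_fst) (measurableSet_Rl _ _ _ _))))
      rw [PP_apply π _ hm, PP_apply π _ (measurableSet_CC π v p q m s), ← markov_fun π s 0 v.1 (f s) (hfm s)
        (hfp s) (hfy s) _ (measurableSet_Rl _ _ _ _), ← lintegral_mul_const]
      · refine lintegral_mono_ae ?_
        filter_upwards [ae_NP π hH 0] with S hS
        by_cases hs : sh s S ∈ Rl v.1 p q (t-s)
        · rw [Set.indicator_of_mem hs]
          simp only [Pi.one_apply, mul_one]
          obtain ⟨g1, σ1, σ2, g2, g3, ⟨g4, g5⟩, ⟨g6, g7⟩, g8⟩ := id hs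
          simp only [sh_apply] at g1 g4 g6
          rw [show s + (t-s) = t by omega] at g1
          have hR : Rf π S s t (π.w (S t)) := by
            intro k hk
            rw [g1] at hk
            obtain ⟨e, he, he', hc⟩ := hcov k hk
            obtain ⟨i, i1, i2, i3, i4⟩ := cross_dn hS.2.step (show s + σ1 ≤ s + σ2 by omega) (e := e)
              (by omega) (by omega)
            exact ⟨i, by omega, by omega, by rw [ed_of_dn i3 i4, hc]⟩
          have := bits_le π S hR (CC_preB π v p q m S s) v.2
          rw [g1] at this
          refine le_trans (measure_mono ?_) this
          rintro B ⟨-, h2, h3, -⟩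
          exact ⟨h3, congrArg Prod.snd h2⟩
        · have : {B | s ≤ t ∧ XX π S B t = v ∧ (S, B) ∈ CC π v p q m s ∧
              sh s S ∈ Rl v.1 p q (t-s)} = ∅ := by
            ext B
            simp only [Set.mem_empty_iff_false, iff_false]
            rintro ⟨-, -, -, h⟩
            exact hs h
          refine le_trans (le_of_eq ?_) zero_le
          exact (congrArg Q2 this).trans measure_empty
      · exact (hfm s).mul ((measurable_one.indicator (measurableSet_Rl _ _ _ _)).comp (measurable_sh s))
    · rw [if_neg hst]
      have : {x : (ℕ → ℕ) × (ℕ → Bool) | s ≤ t ∧ XX π x.1 x.2 t = v ∧ x ∈ CC π v p q m s ∧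
        sh s x.1 ∈ Rl v.1 p q (t-s)} = ∅ := by
        ext x
        simp [hst]
      rw [this]; simp
  refine (ENNReal.tsum_le_tsum key).trans ?_
  rw [ENNReal.tsum_comm, ← ENNReal.tsum_mul_right]
  refine ENNReal.tsum_le_tsum fun s => ?_
  calc ∑' t, (if s ≤ t then PP π (CC π v p q m s) * R π v.1 (Rl v.1 p q (t-s)) * aa π v.1 else 0)
      = ∑' u, PP π (CC π v p q m s) * R π v.1 (Rl v.1 p q u) * aa π v.1 := by
        rw [← Summable.sum_add_tsum_nat_add' (k := s) ENNReal.summable, Finset.sum_eq_zero, zero_add]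
        · refine tsum_congr fun u => ?_
          rw [if_pos (by omega), Nat.add_sub_cancel]
        · intro i hi
          rw [if_neg (by have := Finset.mem_range.1 hi; omega)]
    _ = PP π (CC π v p q m s) * ((∑' u, R π v.1 (Rl v.1 p q u)) * aa π v.1) := by
        rw [ENNReal.tsum_mul_right, ENNReal.tsum_mul_left, mul_assoc]
    _ ≤ _ := by
        exact mul_le_mul' le_rfl (Rl_sum π hH v.1 hvq)

theorem CC_bound (hH : HH π 0 ≠ ⊤) {v : ℕ × Finset ℕ} {p q : ℕ} (hvq : v.1 < q)
    (hcov : ∀ k < π.w v.1, ∃ e, p ≤ e ∧ e < q ∧ cc π e = k) (m : ℕ) :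
    ∑' t, PP π (CC π v p q m t) ≤ (2 * rr π v.1 q) ^ (m+1) := by
  induction m with
  | zero => rw [zero_add, pow_one]; exact CC_zero_sum π hH hvq
  | succ m ih =>
    refine (CC_succ_sum π hH hvq hcov m).trans ?_
    rw [pow_succ _ (m+1)]
    gcongr

/-- every passage from `p` to `q` visits `v` -/
def Common {V : Type*} (S : ℕ → ℕ) (z : ℕ → V) (p q : ℕ) (v : V) : Prop :=
  ∀ s t, s ≤ t → S s = p → S t = q → ∃ i, s ≤ i ∧ i ≤ t ∧ z i = v

theorem CC_of_common {S : ℕ → ℕ} {B : ℕ → Bool} (hNP : NP S) (hS0 : S 0 = 0) {v : ℕ × Finset ℕ} {p q : ℕ}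
    (hpq : p < q) (hvq : v.1 < q) (hcom : Common S (XX π S B) p q v) (k : ℕ) :
    ∀ m, S ∈ RetS p q (m + k) → ∃ τ, (S, B) ∈ CC π v p q m τ ∧ sh τ S ∈ RetS p q k := by
  intro m
  induction m generalizing k with
  | zero =>
    intro hret
    rw [zero_add] at hret
    obtain ⟨σ3, -, h3, h4⟩ := first_after (hNP.hits (s := 0) (y := q) (by omega))
    obtain ⟨σ2, -, h2, h1⟩ := ivt_up hNP.step (Nat.zero_le σ3) (y := p) (by omega) (by omega)
    obtain ⟨τ, h5, h6, h7⟩ := hcom σ2 σ3 h2 h1 h3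
    have hlt : τ < σ3 := by
      rcases Nat.lt_or_ge τ σ3 with h | h
      · exact h
      · have : τ = σ3 := le_antisymm h6 h
        subst this
        have := congrArg Prod.fst h7
        simp only [XX] at this
        omega
    refine ⟨τ, ⟨h7, fun i hi => h4 i (by omega) (by omega)⟩, ?_⟩
    have h8 : sh 0 S ∈ RetS p q k := by
      have : sh 0 S = S := by ext i; simp
      rw [this]; exact hret
    exact RetS_fwd h8 (Nat.zero_le _) fun i _ hi => h4 i (by omega) (by omega)
  | succ m ih =>
    intro hret
    obtain ⟨s, g1, r1, r2, g2, g3, g4, g5⟩ := ih (k+1) (by rwa [show m + (k+1) = m+1+k by omega])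
    rw [sh_sh] at g5
    simp only [sh_apply] at g3 g4
    obtain ⟨σ1, a1, a2, a3⟩ := first_after (P := fun i => S i = q) (s := s) ⟨s+r1, by omega, g3⟩
    have a4 : σ1 ≤ s + r1 := by
      by_contra h
      exact a3 (s+r1) (by omega) (by omega) g3
    obtain ⟨σ2, b1, b2, b3⟩ := first_after (P := fun i => S i = p) (s := σ1) ⟨s+r2, by omega, g4⟩
    have b4 : σ2 ≤ s + r2 := by
      by_contra h
      exact b3 (s+r2) (by omega) (by omega) g4
    obtain ⟨σ3, h2, h3, h4⟩ := first_after (hNP.hits (s := σ2) (y := q) (by omega))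
    obtain ⟨τ, h5, h6, h7⟩ := hcom σ2 σ3 h2 b2 h3
    have hlv := congrArg Prod.fst h7
    simp only [XX] at hlv
    have hlt : τ < σ3 := by
      rcases Nat.lt_or_ge τ σ3 with h | h
      · exact h
      · have : τ = σ3 := le_antisymm h6 h
        subst this
        omega
    refine ⟨τ, ⟨h7, s, by omega, g1, ?_, σ1 - s, σ2 - s, by omega, by omega, ⟨?_, fun i hi => ?_⟩,
      ⟨?_, fun i hi hi' => ?_⟩, fun i hi hi' => ?_⟩, ?_⟩
    · simp only [sh_apply]; rw [show s + (τ - s) = τ by omega]; exact hlv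
    · simp only [sh_apply]; rw [show s + (σ1 - s) = σ1 by omega]; exact a2
    · exact a3 (s+i) (by omega) (by omega)
    · simp only [sh_apply]; rw [show s + (σ2 - s) = σ2 by omega]; exact b2
    · exact b3 (s+i) (by omega) (by omega)
    · exact h4 (s+i) (by omega) (by omega)
    · by_cases h : τ ≤ s + r2
      · exact RetS_back g5 h
      · exact RetS_fwd g5 (by omega) fun i hi hi' => h4 i (by omega) (by omega)

theorem common_bound (hH : HH π 0 ≠ ⊤) {v : ℕ × Finset ℕ} {p q : ℕ} (hpq : p < q) (hvq : v.1 < q)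
    (hcov : ∀ k < π.w v.1, ∃ e, p ≤ e ∧ e < q ∧ cc π e = k) (M : ℕ) :
    PP π {x | x.1 ∈ RetS p q M ∧ Common x.1 (XX π x.1 x.2) p q v} ≤ (2 * rr π v.1 q) ^ (M+1) := by
  refine le_trans ?_ (CC_bound π hH hvq hcov M)
  refine le_trans (measure_mono_ae ?_) (measure_iUnion_le _)
  filter_upwards [PP_fst_ae π (ae_NP π hH 0)] with x hx hx2
  obtain ⟨τ, h, -⟩ := CC_of_common π hx.2 hx.1 hpq hvq hx2.2 0 M hx2.1
  exact Set.mem_iUnion.2 ⟨τ, h⟩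

end CutWalk

namespace CutWalk
open scoped ENNReal

/-- first hit of `y`, then event -/
def FT (y : ℕ) (E : Set (ℕ → ℕ)) : Set (ℕ → ℕ) :=
  {ω | ∃ t, ω t = y ∧ (∀ s < t, ω s ≠ y) ∧ sh t ω ∈ E}

/-- first hit of `y`, before hitting `z`, then event -/
def FB (y z : ℕ) (E : Set (ℕ → ℕ)) : Set (ℕ → ℕ) :=
  {ω | ∃ t, ω t = y ∧ (∀ s < t, ω s ≠ z ∧ ω s ≠ y) ∧ sh t ω ∈ E}

theorem measurableSet_FT {y : ℕ} {E : Set (ℕ → ℕ)} (hE : MeasurableSet E) : MeasurableSet (FT y E) := by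
  have : FT y E = ⋃ t, ({ω | ω t = y ∧ ∀ s < t, ω s ≠ y} ∩ sh t ⁻¹' E) := by
    ext ω; simp [FT, and_assoc]
  rw [this]
  exact MeasurableSet.iUnion fun t => MeasurableSet.inter (by measurability) (measurable_sh t hE)

theorem measurableSet_FB {y z : ℕ} {E : Set (ℕ → ℕ)} (hE : MeasurableSet E) : MeasurableSet (FB y z E) := by
  have : FB y z E = ⋃ t, ({ω | ω t = y ∧ ∀ s < t, ω s ≠ z ∧ ω s ≠ y} ∩ sh t ⁻¹' E) := by
    ext ω; simp [FB, and_assoc]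
  rw [this]
  exact MeasurableSet.iUnion fun t => MeasurableSet.inter (by measurability) (measurable_sh t hE)

variable (π : Prof)

theorem R_FT (x y : ℕ) {E : Set (ℕ → ℕ)} (hE : MeasurableSet E) :
    R π x (FT y E) = R π x {ω | ∃ t, ω t = y} * R π y E := by
  exact strong_first π x y (fun t ω => ω t = y) E (fun t => by measurability)
    (fun t ω ω' h h1 => by rw [← h t le_rfl]; exact h1) (fun t ω h => h) hE

theorem R_FT_le (x y : ℕ) {E : Set (ℕ → ℕ)} (hE : MeasurableSet E) : R π x (FT y E) ≤ R π y E := by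
  rw [R_FT π x y hE]
  calc _ ≤ 1 * R π y E := mul_le_mul' prob_le_one le_rfl
    _ = _ := one_mul _

theorem R_FB (x y z : ℕ) {E : Set (ℕ → ℕ)} (hE : MeasurableSet E) :
    R π x (FB y z E) = R π x (HB y z) * R π y E := by
  rw [HB, ← strong_first π x y (fun t ω => ω t = y ∧ ∀ s < t, ω s ≠ z) E (fun t => by measurability)
    (fun t ω ω' h h1 => ⟨by rw [← h t le_rfl]; exact h1.1, fun s hs => by
      rw [← h s hs.le]; exact h1.2 s hs⟩) (fun t ω h => h.1) hE]
  congr 1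
  ext ω
  constructor
  · rintro ⟨t, h1, h2, h3⟩
    exact ⟨t, ⟨h1, fun s hs => (h2 s hs).1⟩, fun s hs h4 => (h2 s hs).2 h4.1, h3⟩
  · rintro ⟨t, ⟨h1, h2⟩, h3, h4⟩
    exact ⟨t, h1, fun s hs => ⟨h2 s hs, fun h5 => h3 s hs ⟨h5, fun s' hs' => h2 s' (by omega)⟩⟩, h4⟩

/-- failing to make `M` returns `q → p` before first hitting `r`, followed by event `E` -/
def Fb (p q r : ℕ) (E : Set (ℕ → ℕ)) : ℕ → Set (ℕ → ℕ)
  | 0 => ∅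
  | M+1 => FT q (FB r p E ∪ FB p r (Fb p q r E M))

theorem measurableSet_Fb {p q r : ℕ} {E : Set (ℕ → ℕ)} (hE : MeasurableSet E) (M : ℕ) :
    MeasurableSet (Fb p q r E M) := by
  induction M with
  | zero => exact MeasurableSet.empty
  | succ M ih => exact measurableSet_FT ((measurableSet_FB hE).union (measurableSet_FB ih))

theorem Fb_le {p q r : ℕ} (hpr : p < r) {E : Set (ℕ → ℕ)} (hE : MeasurableSet E) (M x : ℕ) :
    R π x (Fb p q r E M) ≤ M * (rr π p q / rr π p r) * R π r E := by
  induction M generalizing x with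
  | zero => simp [Fb]
  | succ M ih =>
    have hm := measurableSet_Fb (p := p) (q := q) (r := r) hE M
    refine (R_FT_le π x q ((measurableSet_FB hE).union (measurableSet_FB hm))).trans ?_
    refine (measure_union_le _ _).trans ?_
    rw [R_FB π _ _ _ hE, R_FB π _ _ _ hm]
    calc R π q (HB r p) * R π r E + R π q (HB p r) * R π p (Fb p q r E M)
        ≤ (rr π p q / rr π p r) * R π r E + 1 * (M * (rr π p q / rr π p r) * R π r E) :=
          add_le_add (mul_le_mul' (HB_up_le π hpr q) le_rfl) (mul_le_mul' prob_le_one (ih p))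
      _ = _ := by push_cast; ring

theorem mem_Fb {p q r : ℕ} (hpq : p < q) (hqr : q < r) {E : Set (ℕ → ℕ)} (M : ℕ) :
    ∀ ω : ℕ → ℕ, NP ω → ω 0 ≤ q → ω ∉ RetS p q M →
      (∀ t, ω t = r → (∀ s < t, ω s ≠ r) → sh t ω ∈ E) → ω ∈ Fb p q r E M := by
  induction M with
  | zero => intro ω _ _ h; exact absurd trivial h
  | succ M ih =>
    intro ω hN h0 hR hE
    obtain ⟨t1, -, h1, h2⟩ := first_after (hN.hits (s := 0) h0)
    refine ⟨t1, h1, fun s hs => h2 s (by omega) hs, ?_⟩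
    have hnr : ∀ s ≤ t1, ω s ≠ r := by
      intro s hs h
      obtain ⟨i, i1, i2, i3⟩ := ivt_up hN.step (Nat.zero_le s) h0 (by omega : q ≤ ω s)
      rcases Nat.lt_or_ge i t1 with hi | hi
      · exact h2 i (by omega) hi i3
      · have : s = t1 := by omega
        subst this; omega
    obtain ⟨t2, h3, h4, h5⟩ := first_after (hN.hits (s := t1) (y := r) (by omega))
    by_cases hp : ∃ i, t1 ≤ i ∧ i < t2 ∧ ω i = p
    · right
      obtain ⟨i, i1, i2, i3⟩ := hp
      obtain ⟨t3, g1, g2, g3⟩ := first_after (P := fun i => ω i = p) (s := t1) ⟨i, i1, i3⟩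
      have g4 : t3 ≤ i := by
        by_contra h; exact g3 i i1 (by omega) i3
      refine ⟨t3 - t1, ?_, fun s hs => ⟨?_, ?_⟩, ?_⟩
      · simp only [sh_apply]; rw [show t1 + (t3 - t1) = t3 by omega]; exact g2
      · exact h5 _ (by omega) (by omega)
      · exact g3 _ (by omega) (by omega)
      · rw [sh_sh, show t1 + (t3 - t1) = t3 by omega]
        apply ih _ (hN.sh t3)
        · simp only [sh_apply, add_zero]; omega
        · intro h
          exact hR ⟨t1, t3, g1, h1, g2, h⟩
        · intro t ht hs
          rw [sh_sh]
          apply hE _ ht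
          intro s hst hsr
          rcases Nat.lt_or_ge s t1 with h | h
          · exact hnr s h.le hsr
          · rcases Nat.lt_or_ge s t3 with h' | h'
            · exact h5 s h (by omega) hsr
            · exact hs (s - t3) (by omega) (by simp only [sh_apply]; rw [show t3 + (s-t3) = s by omega]; exact hsr)
    · left
      push Not at hp
      refine ⟨t2 - t1, ?_, fun s hs => ⟨?_, ?_⟩, ?_⟩
      · simp only [sh_apply]; rw [show t1 + (t2 - t1) = t2 by omega]; exact h4
      · exact hp _ (by omega) (by omega)
      · exact h5 _ (by omega) (by omega)
      · rw [sh_sh, show t1 + (t2 - t1) = t2 by omega]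
        apply hE _ h4
        intro s hs hsr
        rcases Nat.lt_or_ge s t1 with h | h
        · exact hnr s h.le hsr
        · exact h5 s h hs hsr

theorem ret_single (hH : HH π 0 ≠ ⊤) {p q r : ℕ} (hpq : p < q) (hqr : q < r) (M x : ℕ) (hx : x ≤ q) :
    R π x {ω | ω ∉ RetS p q M} ≤ M * (rr π p q / rr π p r) := by
  calc R π x {ω | ω ∉ RetS p q M} ≤ R π x (Fb p q r Set.univ M) := by
        refine measure_mono_ae ?_
        filter_upwards [ae_NP π hH x] with ω h1 h2
        exact mem_Fb hpq hqr M ω h1.2 (by omega) h2 fun _ _ _ => trivial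
    _ ≤ _ := Fb_le π (hpq.trans hqr) MeasurableSet.univ M x
    _ = _ := by simp

/-- after first hit of `r`, never hit `b` -/
def BB (b r : ℕ) : Set (ℕ → ℕ) := FT r (NV b)

theorem ret_double (hH : HH π 0 ≠ ⊤) {b p q r : ℕ} (hb : b ≤ p) (hpq : p < q) (hqr : q < r) (M x : ℕ)
    (hx : x ≤ q) :
    R π x {ω | ω ∉ RetS p q M ∧ ω ∉ BB b r} ≤ (M * (rr π p q / rr π p r)) ^ 2 := by
  have hm := measurableSet_Fb (p := p) (q := q) (r := r) MeasurableSet.univ M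
  calc R π x {ω | ω ∉ RetS p q M ∧ ω ∉ BB b r} ≤ R π x (Fb p q r (FT p (Fb p q r Set.univ M)) M) := by
        refine measure_mono_ae ?_
        filter_upwards [ae_NP π hH x] with ω h1 h2
        refine mem_Fb hpq hqr M ω h1.2 (by omega) h2.1 fun t ht hs => ?_
        have h3 : ∃ i, ω (t + i) = b := by
          by_contra h; push Not at h
          exact h2.2 ⟨t, ht, hs, h⟩
        obtain ⟨i, hi⟩ := h3
        obtain ⟨k, k1, k2, k3⟩ := ivt_dn h1.2.step (show t ≤ t + i by omega) (y := p) (by omega) (by omega)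
        obtain ⟨l, l1, l2, l3⟩ := first_after (P := fun i => ω i = p) (s := t) ⟨k, k1, k3⟩
        refine ⟨l - t, ?_, fun s hs => ?_, ?_⟩
        · simp only [sh_apply]; rw [show t + (l - t) = l by omega]; exact l2
        · exact l3 _ (by omega) (by omega)
        · rw [sh_sh, show t + (l - t) = l by omega]
          refine mem_Fb hpq hqr M _ (h1.2.sh l) (by simp only [sh_apply, add_zero]; omega) ?_ fun _ _ _ => trivial
          intro h
          apply h2.1
          have := RetS_back h (Nat.zero_le l)
          rwa [show sh 0 ω = ω by ext i; simp] at this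
    _ ≤ M * (rr π p q / rr π p r) * R π r (FT p (Fb p q r Set.univ M)) :=
        Fb_le π (hpq.trans hqr) (measurableSet_FT hm) M x
    _ ≤ M * (rr π p q / rr π p r) * (M * (rr π p q / rr π p r) * R π r Set.univ) :=
        mul_le_mul' le_rfl ((R_FT_le π _ _ hm).trans (Fb_le π (hpq.trans hqr) MeasurableSet.univ M p))
    _ = _ := by simp [sq]

theorem BB_le (hH : HH π 0 ≠ ⊤) {b r r' : ℕ} (hb : b < r) (hr : r ≤ r') (x : ℕ) :
    R π x (BB b r) ≤ rr π b r / rr π b r' := by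
  refine (R_FT_le π x r (measurableSet_NV b)).trans ?_
  refine le_trans (measure_mono_ae ?_) (HB_up_le π (show b < r' by omega) r)
  filter_upwards [ae_NP π hH r] with ω h1 h2
  obtain ⟨t, -, h3⟩ := h1.2.hits (s := 0) (y := r') (by omega)
  exact ⟨t, h3, fun s _ => h2 s⟩

end CutWalk

namespace CutWalk
open scoped ENNReal

theorem FT_shift {ω : ℕ → ℕ} {u y : ℕ} {E : Set (ℕ → ℕ)} (h : ∀ s < u, ω s ≠ y) :
    sh u ω ∈ FT y E ↔ ω ∈ FT y E := by
  constructor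
  · rintro ⟨t, h1, h2, h3⟩
    refine ⟨u + t, h1, fun s hs hy => ?_, by rwa [sh_sh] at h3⟩
    rcases Nat.lt_or_ge s u with g | g
    · exact h s g hy
    · exact h2 (s - u) (by omega) (by simp only [sh_apply]; rw [show u + (s-u) = s by omega]; exact hy)
  · rintro ⟨t, h1, h2, h3⟩
    have : u ≤ t := by
      by_contra g; exact h t (by omega) h1
    refine ⟨t - u, ?_, fun s hs => h2 _ (by omega), ?_⟩
    · simp only [sh_apply]; rw [show u + (t-u) = t by omega]; exact h1
    · rw [sh_sh, show u + (t-u) = t by omega]; exact h3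

theorem below_first {ω : ℕ → ℕ} (hN : NP ω) {u y : ℕ} (h0 : ω 0 ≤ y) (h : ∀ s < u, ω s ≠ y) :
    ∀ s < u, ω s < y := by
  intro s hs
  by_contra g
  obtain ⟨i, i1, i2, i3⟩ := ivt_up hN.step (Nat.zero_le s) h0 (by omega)
  exact h i (by omega) i3

variable (π : Prof)

/-- no later gap -/
def DT (b : ℕ → ℕ) (N k : ℕ) : Set (ℕ → ℕ) :=
  {ω | ∀ k', k < k' → k' < N → ω ∉ BB (b k') (b (k'+2))}

theorem measurableSet_DT (b : ℕ → ℕ) (N k : ℕ) : MeasurableSet (DT b N k) := by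
  have : DT b N k = ⋂ k', ⋂ (_ : k < k'), ⋂ (_ : k' < N), (BB (b k') (b (k'+2)))ᶜ := by
    ext ω; simp [DT]
  rw [this]
  exact MeasurableSet.iInter fun k' => MeasurableSet.iInter fun _ => MeasurableSet.iInter fun _ =>
    (measurableSet_FT (measurableSet_NV _)).compl

theorem log_step (hH : HH π 0 ≠ ⊤) {b : ℕ → ℕ} (hb : StrictMono b) {N i k : ℕ} (hik : i < k) :
    R π 0 (BB (b k) (b (k+2)) ∩ DT b N k) * R π (b (i+2)) (HB (b (k+2)) (b i)) ≤
      R π 0 (BB (b k) (b (k+2)) ∩ DT b N k ∩ BB (b i) (b (i+2))) := by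
  set E : Set (ℕ → ℕ) := NV (b k) ∩ DT b N k with hEdef
  have hE : MeasurableSet E := (measurableSet_NV _).inter (measurableSet_DT _ _ _)
  have hEb := measurableSet_FB (y := b (k+2)) (z := b i) hE
  have h1 : R π 0 (BB (b k) (b (k+2)) ∩ DT b N k) ≤ R π (b (k+2)) E := by
    refine le_trans (measure_mono_ae ?_) (R_FT_le π 0 (b (k+2)) hE)
    filter_upwards [ae_NP π hH 0] with ω hω h
    obtain ⟨⟨t, g1, g2, g3⟩, g4⟩ := h
    refine ⟨t, g1, g2, g3, fun k' h1 h2 h3 => g4 k' h1 h2 ?_⟩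
    refine (FT_shift fun s hs => ?_).1 h3
    have := below_first hω.2 (by omega) g2 s hs
    have := hb (show k+2 < k'+2 by omega)
    omega
  have h2 : R π 0 {ω | ∃ t, ω t = b (i+2)} = 1 := by
    rw [prob_compl_eq_zero_iff (by measurability) |>.symm]
    refine measure_mono_null (t := {ω | ¬ (ω 0 = 0 ∧ NP ω)}) ?_ (ae_NP π hH 0)
    intro ω hω h
    apply hω
    obtain ⟨t, -, ht⟩ := h.2.hits (s := 0) (y := b (i+2)) (by omega)
    exact ⟨t, ht⟩
  calc _ ≤ R π (b (k+2)) E * R π (b (i+2)) (HB (b (k+2)) (b i)) := mul_le_mul' h1 le_rfl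
    _ = R π 0 (FT (b (i+2)) (FB (b (k+2)) (b i) E)) := by
        rw [R_FT π _ _ hEb, R_FB π _ _ _ hE, h2, one_mul, mul_comm]
    _ ≤ _ := by
        refine measure_mono_ae ?_
        filter_upwards [ae_NP π hH 0] with ω hω h
        obtain ⟨t, g1, g2, s, g3, g4, g5⟩ := h
        rw [sh_sh] at g5
        simp only [sh_apply] at g3
        have hlt := hb (show i+2 < k+2 by omega)
        have hlt' := hb hik
        have hlt3 := hb (show k < k+2 by omega)
        have f1 : ∀ a < t + s, ω a ≠ b (k+2) := by
          intro a ha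
          rcases Nat.lt_or_ge a t with h | h
          · have := below_first hω.2 (by omega) g2 a h
            omega
          · have := (g4 (a - t) (by omega)).2
            simpa only [sh_apply, show t + (a - t) = a by omega] using this
        have f2 : ∀ a, ω (t + s + a) ≠ b k := g5.1
        refine ⟨⟨⟨t+s, g3, f1, g5.1⟩, fun k' h1 h2 h3 => ?_⟩, t, g1, g2, fun a => ?_⟩
        · refine g5.2 k' h1 h2 ((FT_shift fun a ha => ?_).2 h3)
          have := below_first hω.2 (by omega) f1 a ha
          have := hb (show k+2 < k'+2 by omega)
          omega
        · simp only [sh_apply]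
          rcases Nat.lt_or_ge a s with h | h
          · exact (g4 a h).1
          · intro h'
            obtain ⟨c, c1, c2, c3⟩ := ivt_dn hω.2.step (show t + s ≤ t + a by omega) (y := b k)
              (by omega) (by omega)
            apply f2 (c - (t+s))
            rw [show t + s + (c - (t+s)) = c by omega]; exact c3

theorem log_lemma (hH : HH π 0 ≠ ⊤) {b : ℕ → ℕ} (hb : StrictMono b) {N K0 : ℕ} {d : ℝ≥0∞}
    (hd0 : d ≠ 0) (hdt : d ≠ ⊤)
    (hrr : ∀ i k, i < k → k ≤ N + 1 → rr π (b i) (b k) = ((k - i : ℕ) : ℝ≥0∞) * d) :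
    R π 0 {ω | ∃ k, K0 ≤ k ∧ k < N ∧ ω ∈ BB (b k) (b (k+2))} *
      (∑ m ∈ Finset.range K0, (2 : ℝ≥0∞) / ((m + 3 : ℕ) : ℝ≥0∞)) ≤
        ∑ i ∈ Finset.range N, R π 0 (BB (b i) (b (i+2))) := by
  set D : ℕ → Set (ℕ → ℕ) := fun k => BB (b k) (b (k+2)) ∩ DT b N k with hD
  have hDm : ∀ k, MeasurableSet (D k) := fun k =>
    (measurableSet_FT (measurableSet_NV _)).inter (measurableSet_DT _ _ _)
  have hdisj : ∀ k k', k < k' → k' < N → Disjoint (D k) (D k') := by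
    intro k k' h h'
    rw [Set.disjoint_left]
    intro ω h1 h2
    exact h1.2 k' h h' h2.1
  have hPD : Set.PairwiseDisjoint (↑(Finset.Ico K0 N)) D := by
    intro k hk k' hk' hne
    simp only [Finset.coe_Ico, Set.mem_Ico] at hk hk'
    rcases lt_or_gt_of_ne hne with h | h
    · exact hdisj k k' h hk'.2
    · exact (hdisj k' k h hk.2).symm
  have h1 : R π 0 {ω | ∃ k, K0 ≤ k ∧ k < N ∧ ω ∈ BB (b k) (b (k+2))} ≤ ∑ k ∈ Finset.Ico K0 N, R π 0 (D k) := by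
    refine le_trans (measure_mono ?_) (measure_biUnion_finset_le _ _)
    rintro ω ⟨k, hk1, hk2, hk3⟩
    obtain ⟨r, r1, r2, r3, r4⟩ := last_before (P := fun k => ω ∈ BB (b k) (b (k+2)))
      (show k ≤ N - 1 by omega) hk3
    simp only [Set.mem_iUnion, Finset.mem_Ico, exists_prop]
    exact ⟨r, ⟨by omega, by omega⟩, r3, fun k' g1 g2 => r4 k' g1 (by omega)⟩
  have h2 : ∀ k ∈ Finset.Ico K0 N, R π 0 (D k) * (∑ m ∈ Finset.range K0, (2 : ℝ≥0∞) / ((m + 3 : ℕ) : ℝ≥0∞)) ≤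
      ∑ i ∈ Finset.range N, R π 0 (D k ∩ BB (b i) (b (i+2))) := by
    intro k hk
    rw [Finset.mem_Ico] at hk
    rw [Finset.mul_sum]
    calc ∑ m ∈ Finset.range K0, R π 0 (D k) * ((2 : ℝ≥0∞) / ((m + 3 : ℕ) : ℝ≥0∞))
        ≤ ∑ m ∈ Finset.range K0, R π 0 (D k ∩ BB (b (k-1-m)) (b (k-1-m+2))) := by
          refine Finset.sum_le_sum fun m hm => ?_
          rw [Finset.mem_range] at hm
          refine le_trans (mul_le_mul' le_rfl ?_) (log_step π hH hb (show k-1-m < k by omega))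
          have := HB_up_ge π hH (hb (show k-1-m < k+2 by omega)) (hb.monotone (show k-1-m ≤ k-1-m+2 by omega))
            (hb.monotone (show k-1-m+2 ≤ k + 2 by omega))
          rw [hrr _ _ (by omega) (by omega), hrr _ _ (by omega) (by omega)] at this
          rw [show k - 1 - m + 2 - (k-1-m) = 2 by omega, show k + 2 - (k-1-m) = m + 3 by omega,
            mul_right_comm] at this
          rw [ENNReal.mul_le_mul_iff_left hd0 hdt] at this
          refine ENNReal.div_le_of_le_mul' ?_
          simpa using this
      _ = ∑ i ∈ Finset.image (fun m => k-1-m) (Finset.range K0), R π 0 (D k ∩ BB (b i) (b (i+2))) := by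
          rw [Finset.sum_image]
          intro x hx y hy hxy
          simp only [Finset.coe_range, Set.mem_Iio] at hx hy hxy
          omega
      _ ≤ _ := by
          refine Finset.sum_le_sum_of_subset ?_
          intro i hi
          simp only [Finset.mem_image, Finset.mem_range] at hi ⊢
          obtain ⟨m, hm, rfl⟩ := hi
          omega
  calc _ ≤ (∑ k ∈ Finset.Ico K0 N, R π 0 (D k)) * (∑ m ∈ Finset.range K0, (2 : ℝ≥0∞) / ((m + 3 : ℕ) : ℝ≥0∞)) :=
        mul_le_mul' h1 le_rfl
    _ ≤ ∑ k ∈ Finset.Ico K0 N, ∑ i ∈ Finset.range N, R π 0 (D k ∩ BB (b i) (b (i+2))) := by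
        rw [Finset.sum_mul]; exact Finset.sum_le_sum h2
    _ = ∑ i ∈ Finset.range N, ∑ k ∈ Finset.Ico K0 N, R π 0 (D k ∩ BB (b i) (b (i+2))) := Finset.sum_comm
    _ ≤ _ := by
        refine Finset.sum_le_sum fun i _ => ?_
        rw [← measure_biUnion_finset (f := fun k => D k ∩ BB (b i) (b (i+2))) (fun k hk k' hk' hne =>
          (hPD hk hk' hne).mono Set.inter_subset_left Set.inter_subset_left)
          (fun k _ => (hDm k).inter (measurableSet_FT (measurableSet_NV _)))]
        exact measure_mono (Set.iUnion₂_subset fun k _ => Set.inter_subset_right)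

theorem harm_ge (v : ℕ) : (v : ℝ≥0∞) / 3 ≤ ∑ m ∈ Finset.range (2^v), (2 : ℝ≥0∞) / ((m + 3 : ℕ) : ℝ≥0∞) := by
  induction v with
  | zero => simp
  | succ v ih =>
    rw [pow_succ, mul_two, Finset.sum_range_add, Nat.cast_succ, ENNReal.add_div]
    refine add_le_add ih ?_
    calc (1:ℝ≥0∞)/3 ≤ ∑ m ∈ Finset.range (2^v), (2 : ℝ≥0∞) / ((2^v * 6 : ℕ) : ℝ≥0∞) := by
          rw [Finset.sum_const, Finset.card_range, nsmul_eq_mul]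
          have h0 : (((2:ℕ)^v : ℕ) : ℝ≥0∞) ≠ 0 := by
            rw [Nat.cast_ne_zero]; positivity
          rw [← mul_div_assoc, Nat.cast_mul, ENNReal.mul_div_mul_left _ _ h0 (by simp)]
          rw [ENNReal.div_le_iff (by norm_num) (by norm_num)]
          rw [← ENNReal.mul_div_right_comm]
          norm_num
          rw [ENNReal.div_self (by norm_num) (by norm_num)]
      _ ≤ _ := by
          refine Finset.sum_le_sum fun m hm => ?_
          rw [Finset.mem_range] at hm
          have : 0 < 2^v := by positivity
          refine ENNReal.div_le_div_left ?_ _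
          exact_mod_cast (by omega)

end CutWalk

namespace CutWalk
open scoped ENNReal

/-! ### powers of two -/
noncomputable def T (z : ℤ) : ℝ≥0∞ := (2:ℝ≥0∞) ^ z

theorem T_add (a b : ℤ) : T (a + b) = T a * T b := ENNReal.zpow_add (by norm_num) (by norm_num) _ _
theorem T_nat (n : ℕ) : T n = (2:ℝ≥0∞) ^ n := by simp [T]
theorem T_cast (n : ℕ) : ((2 ^ n : ℕ) : ℝ≥0∞) = T n := by rw [T_nat]; push_cast; rfl
theorem T_neg (z : ℤ) : T (-z) = (T z)⁻¹ := by simp [T, ENNReal.zpow_neg]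
theorem T_mono {a b : ℤ} (h : a ≤ b) : T a ≤ T b := ENNReal.zpow_le_of_le (by norm_num) h
theorem T_ne_zero (z : ℤ) : T z ≠ 0 := by
  have : T z * T (-z) = 1 := by rw [← T_add]; simp [T]
  intro h; simp [h] at this
theorem T_ne_top (z : ℤ) : T z ≠ ⊤ := by
  have : T z = (T (-z))⁻¹ := by rw [← T_neg]; simp
  rw [this]; exact ENNReal.inv_ne_top.2 (T_ne_zero _)
theorem T_div (a b : ℤ) : T a / T b = T (a - b) := by
  rw [div_eq_mul_inv, ← T_neg, ← T_add, sub_eq_add_neg]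
theorem T_double (a : ℤ) : T a + T a = T (a + 1) := by
  rw [T_add, show T 1 = 2 by simp [T], mul_two]
theorem T_pow (a : ℤ) (n : ℕ) : (T a) ^ n = T (a * n) := by
  induction n with
  | zero => simp [T]
  | succ n ih => rw [pow_succ, ih, ← T_add]; congr 1; push_cast; ring
theorem aa_T (π : Prof) (n : ℕ) : aa π n = T (-(π.w n : ℤ)) := by rw [T_neg, T_nat]; rfl

/-! ### parameters -/
def vv (j : ℕ) : ℕ := 2 ^ (j + 10)
def uu (j : ℕ) : ℕ := 2 * vv j + j
def ww (j : ℕ) : ℕ := 50 * uu j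
def LL (j : ℕ) : ℕ := 2 ^ (ww j - j)
def l1 (j : ℕ) : ℕ := 2 ^ (47 * uu j)
def l2 (j : ℕ) : ℕ := 2 ^ (49 * uu j)
def st : ℕ → ℕ
  | 0 => ww 0
  | j+1 => st j + LL j + (ww (j+1) - ww j)

theorem vv_ge (j : ℕ) : j + 10 < vv j := Nat.lt_two_pow_self
theorem vv_ge' (j : ℕ) : 1024 ≤ vv j := by
  unfold vv; exact le_trans (by norm_num) (Nat.pow_le_pow_right (by norm_num) (show 10 ≤ j + 10 by omega))
theorem vv_succ (j : ℕ) : vv (j+1) = 2 * vv j := by unfold vv; rw [show j+1+10 = (j+10)+1 by ring, pow_succ]; ring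
theorem uu_succ (j : ℕ) : uu (j+1) = 4 * vv j + j + 1 := by unfold uu; rw [vv_succ]; ring
theorem ww_lt (j : ℕ) : ww j < ww (j+1) := by
  have := uu_succ j; have := vv_ge j
  unfold ww; rw [uu_succ]; unfold uu; omega
theorem LL_pos (j : ℕ) : 0 < LL j := by unfold LL; positivity
theorem l1_pos (j : ℕ) : 0 < l1 j := by unfold l1; positivity
theorem st_lt (j : ℕ) : st j + LL j < st (j+1) := by
  have := ww_lt j; simp only [st]; omega
theorem st_mono {i j : ℕ} (h : i < j) : st i + LL i < st j := by
  induction j, h using Nat.le_induction with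
  | base => exact st_lt i
  | succ j _ ih => have := st_lt j; omega
theorem st_pos (j : ℕ) : 0 < st j := by
  have h0 : 0 < st 0 := by
    simp only [st, ww, uu]; have := vv_ge 0; omega
  rcases Nat.eq_zero_or_pos j with rfl | h
  · exact h0
  · have := st_mono h; omega

def Growth (e : ℕ) : Prop := ∀ j, ¬ (st j ≤ e ∧ e < st j + LL j)

noncomputable def prof : Prof where
  w n := Nat.count Growth n
  w0 := Nat.count_zero _
  w1 := by
    rw [Nat.count_succ, Nat.count_zero, if_pos]
    intro j hj; have := st_pos j; omega
  step n := by
    rw [Nat.count_succ]; split_ifs <;> simp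

theorem prof_succ_g {n : ℕ} (h : Growth n) : prof.w (n+1) = prof.w n + 1 := by
  change Nat.count Growth (n+1) = _
  rw [Nat.count_succ, if_pos h]; rfl
theorem prof_succ_f {n : ℕ} (h : ¬ Growth n) : prof.w (n+1) = prof.w n := by
  change Nat.count Growth (n+1) = _
  rw [Nat.count_succ, if_neg h]; rfl

theorem growth_init {e : ℕ} (h : e < st 0) : Growth e := by
  intro j hj
  rcases Nat.eq_zero_or_pos j with rfl | h'
  · omega
  · have := st_mono h'; omega

theorem growth_mid {e j : ℕ} (h1 : st j + LL j ≤ e) (h2 : e < st (j+1)) : Growth e := by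
  intro i hi
  rcases lt_trichotomy i j with h | h | h
  · have := st_mono h; omega
  · subst h; omega
  · rcases Nat.lt_or_ge (j+1) i with h' | h'
    · have := st_mono h'; omega
    · have : i = j+1 := by omega
      subst this; omega

theorem w_init {n : ℕ} (h : n ≤ st 0) : prof.w n = n := by
  induction n with
  | zero => exact prof.w0
  | succ n ih => rw [prof_succ_g (growth_init (by omega)), ih (by omega)]

theorem w_flat_of {j i : ℕ} (h0 : prof.w (st j) = ww j) (hi : i ≤ LL j) : prof.w (st j + i) = ww j := by
  induction i with
  | zero => exact h0
  | succ i ih =>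
    rw [← add_assoc, prof_succ_f, ih (by omega)]
    intro h; exact h j ⟨by omega, by omega⟩

theorem w_grow_of {j i : ℕ} (h0 : prof.w (st j) = ww j) (hi : i ≤ ww (j+1) - ww j) :
    prof.w (st j + LL j + i) = ww j + i := by
  induction i with
  | zero => exact w_flat_of h0 le_rfl
  | succ i ih =>
    rw [← add_assoc, prof_succ_g (growth_mid (j := j) (by omega) (by simp only [st]; omega)), ih (by omega), add_assoc]

theorem w_st (j : ℕ) : prof.w (st j) = ww j := by
  induction j with
  | zero => rw [w_init le_rfl]; rfl
  | succ j ih =>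
    have := w_grow_of ih le_rfl
    have h := ww_lt j
    rw [show st (j+1) = st j + LL j + (ww (j+1) - ww j) from rfl, this]; omega

theorem w_flat {j n : ℕ} (h1 : st j ≤ n) (h2 : n ≤ st j + LL j) : prof.w n = ww j := by
  have := w_flat_of (i := n - st j) (w_st j) (by omega)
  rwa [show st j + (n - st j) = n by omega] at this

theorem w_grow {j i : ℕ} (hi : i ≤ ww (j+1) - ww j) : prof.w (st j + LL j + i) = ww j + i :=
  w_grow_of (w_st j) hi

theorem rr_flat {j p q : ℕ} (h1 : st j ≤ p) (h2 : q ≤ st j + LL j) :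
    rr prof p q = ((q - p : ℕ) : ℝ≥0∞) * T (-(ww j : ℤ)) := by
  rw [rr, Finset.sum_congr rfl (g := fun _ => T (-(ww j : ℤ)))]
  · simp
  · intro e he
    rw [Finset.mem_Ico] at he
    rw [aa_T, w_flat (j := j) (by omega) (by omega)]

theorem rr_grow (j : ℕ) : rr prof (st j + LL j) (st (j+1)) ≤ T (1 - (ww j : ℤ)) := by
  have : ∀ i ≤ ww (j+1) - ww j, rr prof (st j + LL j) (st j + LL j + i) + T (1 - (ww j : ℤ) - i) ≤ T (1 - (ww j : ℤ)) := by
    intro i hi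
    induction i with
    | zero => simp [rr_self]
    | succ i ih =>
      refine le_trans (le_of_eq ?_) (ih (by omega))
      rw [← add_assoc (st j + LL j), rr_succ _ (by omega), aa_T, w_grow (by omega), add_assoc]
      congr 1
      rw [show (1 - (ww j : ℤ) - i) = (1 - (ww j : ℤ) - ((i+1 : ℕ) : ℤ)) + 1 by push_cast; ring, ← T_double]
      congr 2
      push_cast; ring
  exact le_trans le_self_add (this _ le_rfl)

theorem LL_T (j : ℕ) : ((LL j : ℕ) : ℝ≥0∞) = T ((ww j : ℤ) - j) := by
  unfold LL
  rw [T_cast]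
  congr 1
  have : j ≤ ww j := by unfold ww uu; omega
  omega

theorem rr_block (j : ℕ) : rr prof (st j) (st j + LL j) = T (-(j:ℤ)) := by
  rw [rr_flat le_rfl le_rfl, show st j + LL j - st j = LL j by omega, LL_T, ← T_add]
  congr 1; ring

theorem rr_init : rr prof 0 (st 0) ≤ 2 := by
  have : ∀ i ≤ st 0, rr prof 0 i + T (1 - i) ≤ T 1 := by
    intro i hi
    induction i with
    | zero => simp [rr_self]
    | succ i ih =>
      refine le_trans (le_of_eq ?_) (ih (by omega))
      rw [rr_succ _ (by omega), aa_T, w_init (by omega), add_assoc]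
      congr 1
      rw [show (1 - (i : ℤ)) = (1 - ((i+1 : ℕ) : ℤ)) + 1 by push_cast; ring, ← T_double]
      congr 2
      push_cast; ring
  refine le_trans le_self_add ((this _ le_rfl).trans ?_)
  simp [T]

theorem rr_stst (j : ℕ) : rr prof (st j) (st (j+1)) + T (2 - ((j+1:ℕ):ℤ)) ≤ T (2 - (j:ℤ)) := by
  have h := st_lt j
  rw [rr_add prof (show st j ≤ st j + LL j by omega) h.le, rr_block]
  have h1 : (rr prof (st j + LL j) (st (j+1))) ≤ T (-(j:ℤ)) := by
    refine (rr_grow j).trans (T_mono ?_)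
    have := vv_ge j
    unfold ww uu; push_cast; omega
  calc _ ≤ T (-(j:ℤ)) + T (-(j:ℤ)) + T (2 - ((j+1:ℕ):ℤ)) := by gcongr
    _ = _ := by
      rw [T_double, show (2 - ((j+1:ℕ):ℤ)) = -(j:ℤ)+1 by push_cast; ring, T_double]
      congr 1; ring

theorem HH_le : HH prof 0 ≤ 8 := by
  have h1 : ∀ j, rr prof 0 (st j) + T (2 - (j:ℤ)) ≤ 8 := by
    intro j
    induction j with
    | zero =>
      calc _ ≤ 2 + T (2 - ((0:ℕ):ℤ)) := by gcongr; exact rr_init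
        _ = 6 := by simp [T]; norm_num
        _ ≤ 8 := by norm_num
    | succ j ih =>
      have h := st_lt j
      rw [rr_add prof (Nat.zero_le (st j)) (by omega), add_assoc]
      exact le_trans (by gcongr; exact rr_stst j) ih
  refine ENNReal.tsum_le_of_sum_range_le fun n => ?_
  have h2 : n ≤ st n := by
    clear h1
    induction n with
    | zero => omega
    | succ n ih => have := st_lt n; have := LL_pos n; omega
  calc ∑ i ∈ Finset.range n, aa prof (0 + i) = rr prof 0 n := by
        rw [rr, Nat.Ico_zero_eq_range]
        exact Finset.sum_congr rfl fun i _ => by rw [zero_add]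
    _ ≤ rr prof 0 (st n) := by rw [rr_add prof (Nat.zero_le n) h2]; exact le_self_add
    _ ≤ _ := le_self_add.trans (h1 n)

theorem hHp : HH prof 0 ≠ ⊤ := by
  intro h
  have := HH_le
  rw [h] at this
  simp at this

end CutWalk

namespace CutWalk
open scoped ENNReal

def hl (j : ℕ) : ℕ := 2 ^ (47 * uu j - 1)
def CN (j : ℕ) : ℕ := 2 ^ (3 * uu j - j)
def cA (j i : ℕ) : ℕ := st j + i * l1 j
def cC (j i : ℕ) : ℕ := cA j i + hl j

theorem uu_ge (j : ℕ) : 2048 + j ≤ uu j := by have := vv_ge' j; unfold uu; omega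
theorem l1_hl (j : ℕ) : l1 j = 2 * hl j := by
  have := uu_ge j
  unfold l1 hl
  rw [← pow_succ']; congr 1; omega
theorem hl_pos (j : ℕ) : 0 < hl j := by unfold hl; positivity
theorem CN_l1 (j : ℕ) : CN j * l1 j = LL j := by
  have := uu_ge j
  unfold CN l1 LL ww
  rw [← pow_add]; congr 1; omega
theorem cA_le {j i : ℕ} (hi : i ≤ CN j) : cA j i ≤ st j + LL j := by
  unfold cA; rw [← CN_l1]; exact Nat.add_le_add_left (Nat.mul_le_mul_right _ hi) _
theorem cA_succ (j i : ℕ) : cA j (i+1) = cA j i + 2 * hl j := by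
  unfold cA; rw [l1_hl]; ring
theorem st_le_cA (j i : ℕ) : st j ≤ cA j i := Nat.le_add_right _ _
theorem ww_two (u : ℕ) (h : 9 ≤ u) : 50 * u ≤ 2 ^ u := by
  induction u, h using Nat.le_induction with
  | base => norm_num
  | succ u hu ih =>
    rw [pow_succ]
    have : 50 ≤ 2 ^ u := by
      calc 50 ≤ 2 ^ 9 := by norm_num
        _ ≤ 2 ^ u := Nat.pow_le_pow_right (by norm_num) hu
    omega
theorem ww_le_pow (j : ℕ) : ww j ≤ 2 ^ (uu j) := ww_two _ (by have := uu_ge j; omega)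
theorem ww_lt_hl (j : ℕ) : ww j < hl j := by
  have := uu_ge j
  refine (ww_le_pow j).trans_lt ?_
  unfold hl
  exact Nat.pow_lt_pow_right (by norm_num) (by omega)
theorem hl_T (j : ℕ) : ((hl j : ℕ) : ℝ≥0∞) = T (47 * (uu j : ℤ) - 1) := by
  have := uu_ge j
  unfold hl; rw [T_cast]; congr 1; omega

theorem cell_est (j i : ℕ) (hi : i < CN j) :
    PP prof {p | ¬ Link p.1 (XX prof p.1 p.2) (cA j i) (cC j i) (cA j (i+1))} ≤ T (9 - 4 * (uu j : ℤ)) := by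
  have hu := uu_ge j
  have h0 := hl_pos j
  have h1 := ww_lt_hl j
  have h2 := cA_succ j i
  have h3 := cA_le (j := j) (i := i+1) (by omega)
  have h4 := st_le_cA j i
  have h5 : cC j i = cA j i + hl j := rfl
  have hww : (ww j : ℤ) = 50 * uu j := by unfold ww; push_cast; ring
  have hb := cell_bound prof hHp (α := cA j i) (c := cC j i) (β := cA j (i+1)) (n := ww j) (by omega)
    (by unfold ww; omega) (by omega) (fun k k1 k2 => w_flat (by omega) (by omega)) (2 ^ (21 * uu j)) (2 ^ (39 * uu j))
    (by positivity) (by positivity) (Nat.pow_le_pow_right (by norm_num) (by unfold ww; omega))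
    (Nat.pow_le_pow_right (by norm_num) (by omega))
  set X := PP prof {p | ¬ Link p.1 (XX prof p.1 p.2) (cA j i) (cC j i) (cA j (i+1))} with hX
  have e1 : rr prof (cA j i) (cC j i) = T (-3 * (uu j : ℤ) - 1) := by
    rw [rr_flat (j := j) (by omega) (by omega), show cC j i - cA j i = hl j by omega, hl_T, ← T_add]
    congr 1; omega
  have e2 : rr prof (cC j i) (cA j (i+1)) = T (-3 * (uu j : ℤ) - 1) := by
    rw [rr_flat (j := j) (by omega) (by omega), show cA j (i+1) - cC j i = hl j by omega, hl_T, ← T_add]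
    congr 1; omega
  have e3 : rr prof (cA j i) (cA j (i+1)) = T (-3 * (uu j : ℤ)) := by
    rw [rr_add prof (show cA j i ≤ cC j i by omega) (by omega), e1, e2, T_double]; congr 1; ring
  have e4 : rr prof (cC j i) (cC j i + ww j) ≤ T (-49 * (uu j : ℤ)) := by
    rw [rr_flat (j := j) (by omega) (by omega), show cC j i + ww j - cC j i = ww j by omega]
    calc _ ≤ T (uu j) * T (-(ww j : ℤ)) := by
          refine mul_le_mul' ?_ le_rfl
          rw [← T_cast]; exact_mod_cast ww_le_pow j
      _ = _ := by rw [← T_add]; congr 1; omega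
  have e5 : T (-3 * (uu j : ℤ) - 1) ≤ rr prof (cA j i) (cC j i + ww j) := by
    rw [← e1, rr_add prof (show cA j i ≤ cC j i by omega) (show cC j i ≤ cC j i + ww j by omega)]
    exact le_self_add
  have e6 : HH prof (cC j i) ≤ T 3 := by
    refine (HH_anti prof (Nat.zero_le _)).trans (HH_le.trans ?_)
    simp [T]; norm_num
  rw [e2, e1, e3] at hb
  have hb2 : X * T (-6 * (uu j : ℤ) - 2) ≤ T (7 - 10 * (uu j : ℤ)) := by
    calc X * T (-6 * (uu j : ℤ) - 2) = X * (T (-3 * (uu j : ℤ) - 1) * T (-3 * (uu j : ℤ) - 1)) := by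
          rw [← T_add]; congr 2; ring
      _ ≤ _ := hb
      _ ≤ T (-3 * (uu j : ℤ)) * T 3 * (T (39 * (uu j : ℤ)) * (T (-49 * (uu j : ℤ)) / T (-3 * (uu j : ℤ) - 1) +
            T (-49 * (uu j : ℤ)) / T (-3 * (uu j : ℤ) - 1)) + (T (21 * (uu j : ℤ)) * T (21 * (uu j : ℤ)) / T (50 * (uu j : ℤ))
            + T (50 * (uu j : ℤ)) / (T (21 * (uu j : ℤ)) * T (39 * (uu j : ℤ))))) := by
          have c1 : (((2 ^ (39 * uu j) : ℕ)) : ℝ≥0∞) = T (39 * (uu j : ℤ)) := by rw [T_cast]; push_cast; rfl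
          have c2 : (((2 ^ (21 * uu j) : ℕ)) : ℝ≥0∞) = T (21 * (uu j : ℤ)) := by rw [T_cast]; push_cast; rfl
          have c3 : (2:ℝ≥0∞) ^ (ww j) = T (50 * (uu j : ℤ)) := by rw [← T_nat, hww]
          rw [c1, c2, c3]
          refine mul_le_mul' (mul_le_mul' le_rfl e6) (add_le_add (mul_le_mul' le_rfl (add_le_add ?_ ?_)) le_rfl)
          · exact ENNReal.div_le_div e4 e5
          · exact ENNReal.div_le_div e4 le_rfl
      _ ≤ T (3 - 3 * (uu j : ℤ)) * T (4 - 7 * (uu j : ℤ)) := by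
          refine mul_le_mul' (le_of_eq ?_) ?_
          · rw [← T_add]; congr 1; ring
          · simp only [T_div, ← T_add, T_double]
            calc _ ≤ T (2 - 7 * (uu j : ℤ)) + (T (2 - 7 * (uu j : ℤ)) + T (3 - 7 * (uu j : ℤ))) :=
                  add_le_add (T_mono (by omega)) (add_le_add (T_mono (by omega)) (T_mono (by omega)))
              _ = _ := by
                rw [← add_assoc, T_double, show 2 - 7 * (uu j : ℤ) + 1 = 3 - 7 * (uu j : ℤ) by ring, T_double]
                congr 1; ring
      _ = _ := by rw [← T_add]; congr 1; ring
  calc X = X * T (-6 * (uu j : ℤ) - 2) * T (6 * (uu j : ℤ) + 2) := by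
        rw [mul_assoc, ← T_add]
        have : T (-6 * (uu j : ℤ) - 2 + (6 * (uu j : ℤ) + 2)) = 1 := by
          rw [show -6 * (uu j : ℤ) - 2 + (6 * (uu j : ℤ) + 2) = 0 by ring]; simp [T]
        rw [this, mul_one]
    _ ≤ T (7 - 10 * (uu j : ℤ)) * T (6 * (uu j : ℤ) + 2) := mul_le_mul' hb2 le_rfl
    _ = _ := by rw [← T_add]; congr 1; ring

/-- union bound over a range -/
theorem union_range {Ω : Type*} [MeasurableSpace Ω] (μ : Measure Ω) (n : ℕ) (P : ℕ → Ω → Prop) (B : ℝ≥0∞)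
    (h : ∀ i < n, μ {x | P i x} ≤ B) : μ {x | ∃ i < n, P i x} ≤ n * B := by
  have : {x | ∃ i < n, P i x} = ⋃ i ∈ Finset.range n, {x | P i x} := by ext; simp
  rw [this]
  refine (measure_biUnion_finset_le _ _).trans ?_
  refine (Finset.sum_le_sum fun i hi => h i (Finset.mem_range.1 hi)).trans ?_
  simp

theorem CN_T (j : ℕ) : ((CN j : ℕ) : ℝ≥0∞) = T (3 * (uu j : ℤ) - j) := by
  have := uu_ge j
  unfold CN; rw [T_cast]; congr 1; omega

def E1 (j : ℕ) : Set ((ℕ → ℕ) × (ℕ → Bool)) :=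
  {p | ∃ i < CN j, ¬ Link p.1 (XX prof p.1 p.2) (cA j i) (cC j i) (cA j (i+1))}

theorem E1_le (j : ℕ) : PP prof (E1 j) ≤ T (-(j:ℤ)) := by
  have hu := uu_ge j
  refine (union_range _ _ _ _ fun i hi => cell_est j i hi).trans ?_
  rw [CN_T, ← T_add]
  exact T_mono (by omega)

end CutWalk

namespace CutWalk
open scoped ENNReal

theorem PP_fst_le (π : Prof) (A : Set (ℕ → ℕ)) : PP π {x | x.1 ∈ A} ≤ R π 0 A := by
  calc PP π {x | x.1 ∈ A} ≤ PP π {x | x.1 ∈ toMeasurable (R π 0) A} :=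
        measure_mono fun x hx => subset_toMeasurable _ _ hx
    _ = _ := by rw [PP_fst π _ (measurableSet_toMeasurable _ _), measure_toMeasurable]

/-- window end -/
def wq (j m : ℕ) : ℕ := if m + 2 < CN j then cC j (m+2) else cC (j+1) 1
/-- zone end -/
def zh (j m : ℕ) : ℕ := if m + 2 < CN j then cA j (m+2) else cA (j+1) 1
/-- far end -/
def fr (j : ℕ) : ℕ := st (j+1) + LL (j+1)

theorem CN_ge (j : ℕ) : 8 ≤ CN j := by
  have := uu_ge j
  unfold CN
  calc 8 = 2 ^ 3 := by norm_num
    _ ≤ _ := Nat.pow_le_pow_right (by norm_num) (by omega)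

theorem cC_lt {j i : ℕ} (h : i < CN j) : cC j i + hl j ≤ st j + LL j := by
  have h1 := cA_succ j i
  have h2 := cA_le (j := j) (i := i+1) h
  unfold cC; omega

theorem zone_facts (j m : ℕ) (hm : m + 1 < CN j) : cC j m < cA j (m+1) ∧ cA j (m+1) ≤ zh j m ∧
    zh j m < wq j m ∧ wq j m < fr j ∧ st j ≤ cC j m ∧ cC j m < st j + LL j := by
  have h0 := hl_pos j
  have h0' := hl_pos (j+1)
  have h1 := cA_succ j m
  have h2 := cA_succ j (m+1)
  have h3 := CN_ge (j+1)
  have h4 := cC_lt (j := j) (i := m) (by omega)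
  have h5 := cC_lt (j := j+1) (i := 1) (by omega)
  have h6 := st_lt j
  have h7 := st_le_cA j m
  have h8 := st_le_cA (j+1) 1
  have h9 := cA_le (j := j) (i := m+1) (by omega)
  have h10 := LL_pos (j+1)
  have h11 := hl_pos (j+1)
  unfold wq zh fr
  have d1 : cC j m = cA j m + hl j := rfl
  have d2 : cC (j+1) 1 = cA (j+1) 1 + hl (j+1) := rfl
  split_ifs with h
  · have h12 := cC_lt h
    have d3 : cC j (m+2) = cA j (m+2) + hl j := rfl
    have : m + 1 + 1 = m + 2 := rfl
    rw [this] at h2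
    omega
  · omega

theorem rr_mono {π : Prof} {p p' q q' : ℕ} (h : p ≤ p') (h' : q' ≤ q) : rr π p' q' ≤ rr π p q := by
  unfold rr
  exact Finset.sum_le_sum_of_subset (Finset.Ico_subset_Ico h h')

theorem hl3 (j : ℕ) : ((3 * hl j : ℕ) : ℝ≥0∞) * T (-(ww j : ℤ)) ≤ T (1 - 3 * (uu j : ℤ)) := by
  have hww : (ww j : ℤ) = 50 * uu j := by unfold ww; push_cast; ring
  calc _ ≤ (T 2 * T (47 * (uu j : ℤ) - 1)) * T (-(ww j : ℤ)) := by
        refine mul_le_mul' ?_ le_rfl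
        push_cast
        rw [hl_T]
        refine mul_le_mul' ?_ le_rfl
        simp [T]; norm_num
    _ = _ := by rw [← T_add, ← T_add]; congr 1; rw [hww]; ring

theorem uu_mono (j : ℕ) : uu j ≤ uu (j+1) ∧ uu (j+1) ≤ 2 * uu j + 1 := by
  have := vv_ge j
  rw [uu_succ]; unfold uu; omega

theorem rr_window (j m : ℕ) (hm : m + 1 < CN j) : rr prof (cC j m) (wq j m) ≤ T (3 - 3 * (uu j : ℤ)) := by
  have hu := uu_ge j
  have hu' := uu_mono j
  have hww : (ww j : ℤ) = 50 * uu j := by unfold ww; push_cast; ring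
  have h0 := hl_pos j
  have h1 := cA_succ j m
  have h2 : cA j (m+2) = cA j (m+1) + 2 * hl j := cA_succ j (m+1)
  have d1 : cC j m = cA j m + hl j := rfl
  have d2 : cC (j+1) 1 = cA (j+1) 1 + hl (j+1) := rfl
  have h7 := st_le_cA j m
  unfold wq
  split_ifs with h
  · have h12 := cC_lt h
    have d3 : cC j (m+2) = cA j (m+2) + hl j := rfl
    rw [rr_flat (j := j) (by omega) (by omega), show cC j (m+2) - cC j m = 2 * (2 * hl j) by omega]
    push_cast
    rw [hl_T, show (2:ℝ≥0∞) = T 1 by simp [T], ← T_add, ← T_add, ← T_add]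
    exact T_mono (by omega)
  · have h3 := CN_ge (j+1)
    have h4 := cC_lt (j := j) (i := m) (by omega)
    have h5 := cC_lt (j := j+1) (i := 1) (by omega)
    have h6 := st_lt j
    have h8 := st_le_cA (j+1) 1
    have h9 : cA j (m+2) = st j + LL j := by
      have : m + 2 = CN j := by omega
      rw [this, ← CN_l1]; rfl
    have h10 : cA (j+1) 1 = st (j+1) + 2 * hl (j+1) := by
      rw [cA_succ]; unfold cA; omega
    rw [rr_add prof (show cC j m ≤ st j + LL j by omega) (show _ ≤ cC (j+1) 1 by omega),
      rr_add prof (show st j + LL j ≤ st (j+1) by omega) (show _ ≤ cC (j+1) 1 by omega)]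
    have r1 : rr prof (cC j m) (st j + LL j) ≤ T (1 - 3 * (uu j : ℤ)) := by
      rw [rr_flat (j := j) (by omega) (by omega), show st j + LL j - cC j m = 3 * hl j by omega]
      exact hl3 j
    have r2 : rr prof (st (j+1)) (cC (j+1) 1) ≤ T (2 - 3 * (uu j : ℤ)) := by
      rw [rr_flat (j := j+1) (by omega) (by omega), show cC (j+1) 1 - st (j+1) = 3 * hl (j+1) by omega]
      exact (hl3 (j+1)).trans (T_mono (by omega))
    have r3 : rr prof (st j + LL j) (st (j+1)) ≤ T (1 - 3 * (uu j : ℤ)) :=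
      (rr_grow j).trans (T_mono (by omega))
    calc _ ≤ T (1 - 3 * (uu j : ℤ)) + (T (1 - 3 * (uu j : ℤ)) + T (2 - 3 * (uu j : ℤ))) :=
          add_le_add r1 (add_le_add r3 r2)
      _ = _ := by
          rw [← add_assoc, T_double, show (1 - 3 * (uu j : ℤ)) + 1 = 2 - 3 * (uu j : ℤ) by ring, T_double]
          exact congrArg T (by ring)

theorem cov (j m : ℕ) (hm : m + 1 < CN j) {n : ℕ} (h1 : cA j (m+1) ≤ n) (h2 : n ≤ zh j m) :
    prof.w n ≤ ww (j+1) ∧ ∀ k < prof.w n, ∃ e, cC j m ≤ e ∧ e < wq j m ∧ cc prof e = k := by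
  obtain ⟨z1, z2, z3, z4, z5, z6⟩ := zone_facts j m hm
  have hw := ww_lt_hl j
  have h0 := hl_pos j
  have hlt := ww_lt j
  have hst := st_lt j
  have c1 := cA_succ j m
  have d1 : cC j m = cA j m + hl j := rfl
  have c2 := cC_lt (j := j) (i := m) (by omega)
  have hflat : ∀ k < ww j, ∃ e, cC j m ≤ e ∧ e < wq j m ∧ cc prof e = k := by
    intro k hk
    obtain ⟨e, he1, he2, he3⟩ := exists_mod (cC j m) (ww j) k hk
    refine ⟨e, he1, by omega, ?_⟩
    have w1 : prof.w e = ww j := w_flat (by omega) (by omega)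
    have w2 : prof.w (e+1) = ww j := w_flat (by omega) (by omega)
    unfold cc
    rw [if_neg (by omega), w1, he3]
  rcases Nat.lt_or_ge (st j + LL j) n with hn | hn
  · have hz : ¬ (m + 2 < CN j) := by
      intro h
      unfold zh at h2
      rw [if_pos h] at h2
      have := cA_le (j := j) (i := m+2) h.le
      omega
    have hzq : st (j+1) ≤ wq j m := by
      unfold wq; rw [if_neg hz]; unfold cC cA; omega
    have h3 := CN_ge (j+1)
    have h5 := cC_lt (j := j+1) (i := 1) (by omega)
    have d2 : cC (j+1) 1 = cA (j+1) 1 + hl (j+1) := rfl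
    unfold zh at h2
    rw [if_neg hz] at h2
    have hgrow : ∀ k, ww j ≤ k → k < ww (j+1) → ∃ e, cC j m ≤ e ∧ e < wq j m ∧ cc prof e = k := by
      intro k k1 k2
      have hs : st (j+1) = st j + LL j + (ww (j+1) - ww j) := rfl
      refine ⟨st j + LL j + (k - ww j), by omega, by omega, ?_⟩
      have w1 : prof.w (st j + LL j + (k - ww j)) = k := by rw [w_grow (by omega)]; omega
      have w2 : prof.w (st j + LL j + (k - ww j) + 1) = k + 1 := by
        rw [add_assoc, w_grow (by omega)]; omega
      unfold cc
      rw [if_pos (by omega), w1]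
    have hwn : prof.w n ≤ ww (j+1) := by
      rcases Nat.lt_or_ge n (st (j+1)) with h | h
      · have hs : st (j+1) = st j + LL j + (ww (j+1) - ww j) := rfl
        have := w_grow (j := j) (i := n - (st j + LL j)) (by omega)
        rw [show st j + LL j + (n - (st j + LL j)) = n by omega] at this
        omega
      · rw [w_flat (j := j+1) h (by omega)]
    refine ⟨hwn, fun k hk => ?_⟩
    rcases Nat.lt_or_ge k (ww j) with h | h
    · exact hflat k h
    · exact hgrow k h (by omega)
  · have : prof.w n = ww j := w_flat (by omega) hn
    rw [this]
    exact ⟨hlt.le, hflat⟩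

/-- zone vertices -/
noncomputable def ZV (j m : ℕ) : Finset (ℕ × Finset ℕ) :=
  (Finset.Icc (cA j (m+1)) (zh j m)).biUnion fun n => (Finset.range (prof.w n)).powerset.image fun b => (n, b)

theorem mem_ZV {j m : ℕ} {v : ℕ × Finset ℕ} :
    v ∈ ZV j m ↔ cA j (m+1) ≤ v.1 ∧ v.1 ≤ zh j m ∧ v.2 ⊆ Finset.range (prof.w v.1) := by
  unfold ZV
  simp only [Finset.mem_biUnion, Finset.mem_Icc, Finset.mem_image, Finset.mem_powerset]
  constructor
  · rintro ⟨n, ⟨h1, h2⟩, b, h3, rfl⟩; exact ⟨h1, h2, h3⟩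
  · rintro ⟨h1, h2, h3⟩; exact ⟨v.1, ⟨h1, h2⟩, v.2, h3, rfl⟩

theorem zone_len (j m : ℕ) (hm : m + 1 < CN j) : zh j m + 1 - cA j (m+1) ≤ 2 ^ (47 * uu (j+1) + 2) := by
  have hu := uu_ge (j+1)
  have hu' := uu_mono j
  have h2 : cA j (m+2) = cA j (m+1) + 2 * hl j := cA_succ j (m+1)
  have e1 : hl j ≤ hl (j+1) := by
    unfold hl; exact Nat.pow_le_pow_right (by norm_num) (by omega)
  have e2 : 2 ^ (47 * uu (j+1) + 2) = 8 * hl (j+1) := by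
    have := l1_hl (j+1)
    unfold l1 at this
    rw [pow_add, this]; ring
  have e3 := ww_lt_hl (j+1)
  have e4 := hl_pos (j+1)
  rw [e2]
  unfold zh
  split_ifs with h
  · omega
  · have h9 : cA j (m+2) = st j + LL j := by
      have : m + 2 = CN j := by omega
      rw [this, ← CN_l1]; rfl
    have h10 : cA (j+1) 1 = st (j+1) + 2 * hl (j+1) := by
      rw [cA_succ]; unfold cA; omega
    have hs : st (j+1) = st j + LL j + (ww (j+1) - ww j) := rfl
    omega

theorem ZV_card (j m : ℕ) (hm : m + 1 < CN j) : (ZV j m).card ≤ 2 ^ (194 * uu j + 99) := by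
  have hu' := uu_mono j
  unfold ZV
  refine Finset.card_biUnion_le.trans ?_
  have : ∀ n ∈ Finset.Icc (cA j (m+1)) (zh j m),
      ((Finset.range (prof.w n)).powerset.image fun b => (n, b)).card ≤ 2 ^ (50 * uu (j+1)) := by
    intro n hn
    rw [Finset.mem_Icc] at hn
    refine Finset.card_image_le.trans ?_
    rw [Finset.card_powerset, Finset.card_range]
    exact Nat.pow_le_pow_right (by norm_num) (cov j m hm hn.1 hn.2).1
  refine (Finset.sum_le_sum this).trans ?_
  rw [Finset.sum_const, smul_eq_mul, Nat.card_Icc]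
  refine (Nat.mul_le_mul_right _ (zone_len j m hm)).trans ?_
  rw [← pow_add]
  exact Nat.pow_le_pow_right (by norm_num) (by omega)

def E4 (j : ℕ) : Set ((ℕ → ℕ) × (ℕ → Bool)) :=
  {x | ∃ m < CN j - 1, ∃ v ∈ ZV j m, x.1 ∈ RetS (cC j m) (wq j m) 199 ∧
    Common x.1 (XX prof x.1 x.2) (cC j m) (wq j m) v}

theorem E4_le (j : ℕ) : PP prof (E4 j) ≤ T (-(j:ℤ)) := by
  have hu := uu_ge j
  have key : ∀ m < CN j - 1, PP prof {x | ∃ v ∈ ZV j m, x.1 ∈ RetS (cC j m) (wq j m) 199 ∧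
    Common x.1 (XX prof x.1 x.2) (cC j m) (wq j m) v} ≤ T (899 - 406 * (uu j : ℤ)) := by
    intro m hm
    have hm' : m + 1 < CN j := by omega
    have e : {x : (ℕ → ℕ) × (ℕ → Bool) | ∃ v ∈ ZV j m, x.1 ∈ RetS (cC j m) (wq j m) 199 ∧
      Common x.1 (XX prof x.1 x.2) (cC j m) (wq j m) v} = ⋃ v ∈ ZV j m, {x | x.1 ∈ RetS (cC j m) (wq j m) 199 ∧
      Common x.1 (XX prof x.1 x.2) (cC j m) (wq j m) v} := by
      ext x; simp only [Set.mem_iUnion, exists_prop]; rfl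
    rw [e]
    refine (measure_biUnion_finset_le _ _).trans ?_
    have : ∀ v ∈ ZV j m, PP prof {x | x.1 ∈ RetS (cC j m) (wq j m) 199 ∧
      Common x.1 (XX prof x.1 x.2) (cC j m) (wq j m) v} ≤ T (800 - 600 * (uu j : ℤ)) := by
      intro v hv
      rw [mem_ZV] at hv
      obtain ⟨z1, z2, z3, z4, z5, z6⟩ := zone_facts j m hm'
      refine (common_bound prof hHp (by omega) (by omega) (cov j m hm' hv.1 hv.2.1).2 199).trans ?_
      calc (2 * rr prof v.1 (wq j m)) ^ (199+1) ≤ (T 1 * T (3 - 3 * (uu j : ℤ))) ^ (199+1) := by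
            refine pow_le_pow_left' (mul_le_mul' ?_ ?_) _
            · simp [T]
            · exact (rr_mono (by omega) le_rfl).trans (rr_window j m hm')
        _ = _ := by rw [← T_add, T_pow]; congr 1; push_cast; ring
    refine (Finset.sum_le_sum this).trans ?_
    rw [Finset.sum_const, nsmul_eq_mul]
    calc _ ≤ T ((194 * uu j + 99 : ℕ) : ℤ) * T (800 - 600 * (uu j : ℤ)) := by
          refine mul_le_mul' ?_ le_rfl
          rw [← T_cast]; exact_mod_cast ZV_card j m hm'
      _ = _ := by rw [← T_add]; congr 1; push_cast; ring
  refine (union_range _ _ _ _ key).trans ?_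
  calc _ ≤ ((CN j : ℕ) : ℝ≥0∞) * T (899 - 406 * (uu j : ℤ)) := by
        refine mul_le_mul' ?_ le_rfl
        exact_mod_cast Nat.sub_le _ _
    _ ≤ _ := by
      rw [CN_T, ← T_add]
      exact T_mono (by omega)

end CutWalk

namespace CutWalk
open scoped ENNReal

def bk (j k : ℕ) : ℕ := st j + k * l2 j
/-- ratio of the two cell sizes -/
def qq (j : ℕ) : ℕ := 2 ^ (2 * uu j)
def KN (j : ℕ) : ℕ := 2 ^ (2 * vv j)

theorem l2_eq (j : ℕ) : l2 j = qq j * l1 j := by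
  unfold l2 qq l1; rw [← pow_add]; congr 1; ring
theorem l2_pos (j : ℕ) : 0 < l2 j := by unfold l2; positivity
theorem qq_pos (j : ℕ) : 0 < qq j := by unfold qq; positivity
theorem qq_ge (j : ℕ) : 8 ≤ qq j := by
  have := uu_ge j
  unfold qq
  calc 8 = 2 ^ 3 := by norm_num
    _ ≤ _ := Nat.pow_le_pow_right (by norm_num) (by omega)
theorem KN_qq (j : ℕ) : KN j * qq j = CN j := by
  unfold KN qq CN; rw [← pow_add]; congr 1; unfold uu; omega
theorem KN_l2 (j : ℕ) : KN j * l2 j = LL j := by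
  rw [l2_eq, ← mul_assoc, KN_qq, CN_l1]
theorem bk_mono (j : ℕ) : StrictMono (bk j) := by
  intro a b h
  unfold bk
  have := Nat.mul_lt_mul_of_pos_right h (l2_pos j)
  omega
theorem bk_le {j k : ℕ} (h : k ≤ KN j) : bk j k ≤ st j + LL j := by
  rw [← KN_l2]; exact Nat.add_le_add_left (Nat.mul_le_mul_right _ h) _
theorem l2_T (j : ℕ) : ((l2 j : ℕ) : ℝ≥0∞) = T (49 * (uu j : ℤ)) := by
  unfold l2; rw [T_cast]; push_cast; rfl
theorem rr_bk {j i k : ℕ} (h : i < k) (hk : k ≤ KN j) :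
    rr prof (bk j i) (bk j k) = ((k - i : ℕ) : ℝ≥0∞) * T (-(uu j : ℤ)) := by
  have hww : (ww j : ℤ) = 50 * uu j := by unfold ww; push_cast; ring
  rw [rr_flat (j := j) (show st j ≤ bk j i from Nat.le_add_right _ _) (bk_le hk),
    show bk j k - bk j i = (k - i) * l2 j by unfold bk; rw [Nat.sub_mul]; omega]
  rw [Nat.cast_mul, mul_assoc, l2_T, ← T_add]
  congr 2
  rw [hww]; ring

theorem far_ge {j p : ℕ} (h : p ≤ st j + LL j) : T (-((j+1 : ℕ):ℤ)) ≤ rr prof p (fr j) := by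
  have := st_lt j
  rw [← rr_block]
  exact rr_mono (by omega) le_rfl

theorem T199 : ((199 : ℕ) : ℝ≥0∞) ≤ T 8 := by
  rw [show (8:ℤ) = ((8:ℕ):ℤ) by rfl, ← T_cast]
  exact_mod_cast (by norm_num)

theorem single_est (j m : ℕ) (hm : m + 1 < CN j) :
    R prof 0 {ω | ω ∉ RetS (cC j m) (wq j m) 199} ≤ T (12 + j - 3 * (uu j : ℤ)) := by
  obtain ⟨z1, z2, z3, z4, z5, z6⟩ := zone_facts j m hm
  refine (ret_single prof hHp (r := fr j) (by omega) z4 199 0 (by omega)).trans ?_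
  calc _ ≤ T 8 * (T (3 - 3 * (uu j : ℤ)) / T (-((j+1 : ℕ):ℤ))) :=
        mul_le_mul' T199 (ENNReal.div_le_div (rr_window j m hm) (far_ge z6.le))
    _ = _ := by rw [T_div, ← T_add]; exact congrArg T (by push_cast; ring)

theorem double_est (j m k : ℕ) (hk1 : k * qq j ≤ m) (hk2 : m < (k + 1) * qq j) (hk : k + 2 ≤ KN j) :
    R prof 0 {ω | ω ∉ RetS (cC j m) (wq j m) 199 ∧ ω ∉ BB (bk j k) (bk j (k+2))} ≤ T (22 - 4 * (uu j : ℤ)) := by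
  have hq := qq_ge j
  have hcn : m + 2 < CN j := by
    rw [← KN_qq]
    have := Nat.mul_le_mul_right (qq j) hk
    have e : (k + 2) * qq j = (k+1) * qq j + qq j := by ring
    omega
  have hm : m + 1 < CN j := by omega
  obtain ⟨z1, z2, z3, z4, z5, z6⟩ := zone_facts j m hm
  have h0 := hl_pos j
  have h1 := cA_succ j m
  have h2 : cA j (m+2) = cA j (m+1) + 2 * hl j := cA_succ j (m+1)
  have d3 : cC j (m+2) = cA j (m+2) + hl j := rfl
  have d1 : cC j m = cA j m + hl j := rfl
  have f1 : bk j k ≤ cA j m := by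
    unfold bk cA
    rw [l2_eq, ← mul_assoc]
    exact Nat.add_le_add_left (Nat.mul_le_mul_right _ hk1) _
  have f2 : cA j (m+1) ≤ bk j (k+1) := by
    unfold bk cA
    rw [l2_eq, ← mul_assoc]
    exact Nat.add_le_add_left (Nat.mul_le_mul_right _ hk2) _
  have f3 : bk j (k+2) = bk j (k+1) + l2 j := by unfold bk; ring
  have f4 : 8 * l1 j ≤ l2 j := by rw [l2_eq]; exact Nat.mul_le_mul_right _ hq
  rw [l1_hl] at f4
  have hwq : wq j m < bk j (k+2) := by
    unfold wq; rw [if_pos hcn]; omega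
  refine (ret_double prof hHp (b := bk j k) (r := bk j (k+2)) (by omega) (by omega) hwq 199 0 (by omega)).trans ?_
  have hr : T (-(uu j : ℤ)) ≤ rr prof (cC j m) (bk j (k+2)) := by
    refine le_trans ?_ (rr_mono (p' := bk j (k+1)) (by omega) le_rfl)
    rw [rr_bk (by omega) hk, show k + 2 - (k+1) = 1 by omega]; simp
  calc _ ≤ (T 8 * (T (3 - 3 * (uu j : ℤ)) / T (-(uu j : ℤ)))) ^ 2 :=
        pow_le_pow_left' (mul_le_mul' T199 (ENNReal.div_le_div (rr_window j m hm) hr)) 2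
    _ = _ := by rw [T_div, ← T_add, T_pow]; exact congrArg T (by push_cast; ring)

theorem log_est (j : ℕ) :
    R prof 0 {ω | ∃ k, 2 ^ vv j ≤ k ∧ k < KN j - 1 ∧ ω ∈ BB (bk j k) (bk j (k+2))} ≤ T (-(j:ℤ)) := by
  have hv := vv_ge j
  have hK : 2 ≤ KN j := by
    unfold KN
    calc 2 = 2 ^ 1 := by norm_num
      _ ≤ _ := Nat.pow_le_pow_right (by norm_num) (by omega)
  have h := log_lemma prof hHp (bk_mono j) (N := KN j - 1) (K0 := 2 ^ vv j) (T_ne_zero (-(uu j : ℤ))) (T_ne_top _)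
    (fun i k h1 h2 => rr_bk h1 (by omega))
  set X := R prof 0 {ω | ∃ k, 2 ^ vv j ≤ k ∧ k < KN j - 1 ∧ ω ∈ BB (bk j k) (bk j (k+2))} with hX
  have h2 : ∑ i ∈ Finset.range (KN j - 1), R prof 0 (BB (bk j i) (bk j (i+2))) ≤ T 2 := by
    have : ∀ i ∈ Finset.range (KN j - 1), R prof 0 (BB (bk j i) (bk j (i+2))) ≤ T (2 + j - uu j) := by
      intro i hi
      rw [Finset.mem_range] at hi
      have hb := bk_le (j := j) (k := i+2) (by omega)
      have hb' := bk_le (j := j) (k := i) (by omega)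
      have := st_lt j
      refine (BB_le prof hHp (r' := fr j) (bk_mono j (by omega)) (by unfold fr; omega) 0).trans ?_
      calc _ ≤ T (1 - uu j) / T (-((j+1 : ℕ):ℤ)) := by
            refine ENNReal.div_le_div (le_of_eq ?_) (far_ge hb')
            rw [rr_bk (by omega) (by omega), show i + 2 - i = 2 by omega, show (1 - (uu j:ℤ)) = -(uu j:ℤ) + 1 by ring,
              ← T_double]
            push_cast; ring
        _ = _ := by rw [T_div]; exact congrArg T (by push_cast; ring)
    refine (Finset.sum_le_sum this).trans ?_
    rw [Finset.sum_const, nsmul_eq_mul, Finset.card_range]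
    calc _ ≤ T ((2 * vv j : ℕ) : ℤ) * T (2 + j - uu j) := by
          refine mul_le_mul' ?_ le_rfl
          rw [← T_cast]; exact_mod_cast Nat.sub_le _ _
      _ = _ := by rw [← T_add]; exact congrArg T (by unfold uu; push_cast; ring)
  have h3 : T (j + 8) ≤ ∑ m ∈ Finset.range (2 ^ vv j), (2 : ℝ≥0∞) / ((m + 3 : ℕ) : ℝ≥0∞) := by
    refine le_trans ?_ (harm_ge (vv j))
    have : ((vv j : ℕ) : ℝ≥0∞) = T (j + 10) := by
      unfold vv; rw [T_cast]; exact congrArg T (by push_cast; ring)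
    rw [this, ENNReal.le_div_iff_mul_le (by simp) (by simp)]
    calc _ ≤ T (j + 8) * T 2 := by
          refine mul_le_mul' le_rfl ?_
          simp [T]; norm_num
      _ = _ := by rw [← T_add]; exact congrArg T (by ring)
  have h4 : X * T (j + 8) ≤ T 2 := (mul_le_mul' le_rfl h3).trans (h.trans h2)
  calc X = X * T (j + 8) * T (-(j+8)) := by
        rw [mul_assoc, ← T_add]
        have : T (j + 8 + -(j + 8)) = 1 := by
          rw [show (j:ℤ) + 8 + -(j + 8) = 0 by ring]; simp [T]
        rw [this, mul_one]
    _ ≤ T 2 * T (-(j+8)) := mul_le_mul' h4 le_rfl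
    _ ≤ _ := by rw [← T_add]; exact T_mono (by omega)

def E3 (j : ℕ) : Set ((ℕ → ℕ) × (ℕ → Bool)) :=
  {x | ∃ m < CN j - 1, x.1 ∉ RetS (cC j m) (wq j m) 199}

theorem E3_le (j : ℕ) : PP prof (E3 j) ≤ 4 * T (1 - (j:ℤ)) := by
  have hv := vv_ge j
  have hu := uu_ge j
  have huv : (uu j : ℤ) = 2 * vv j + j := by unfold uu; push_cast; ring
  set A1 : Set (ℕ → ℕ) := {ω | ∃ k, 2 ^ vv j ≤ k ∧ k < KN j - 1 ∧ ω ∈ BB (bk j k) (bk j (k+2))}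
  set A2 : Set (ℕ → ℕ) := {ω | ∃ m < CN j, (2 ^ vv j ≤ m / qq j ∧ m / qq j < KN j - 1) ∧
    (ω ∉ RetS (cC j m) (wq j m) 199 ∧ ω ∉ BB (bk j (m / qq j)) (bk j (m / qq j + 2)))}
  set A3 : Set (ℕ → ℕ) := {ω | ∃ m < 2 ^ vv j * qq j, m + 1 < CN j ∧ ω ∉ RetS (cC j m) (wq j m) 199}
  set A4 : Set (ℕ → ℕ) := {ω | ∃ m < qq j, (KN j - 1) * qq j + m + 1 < CN j ∧
    ω ∉ RetS (cC j ((KN j - 1) * qq j + m)) (wq j ((KN j - 1) * qq j + m)) 199}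
  have hsub : E3 j ⊆ {x | x.1 ∈ A1 ∪ (A2 ∪ (A3 ∪ A4))} := by
    rintro x ⟨m, hm, hx⟩
    have hqp := qq_pos j
    rcases Nat.lt_or_ge (m / qq j) (2 ^ vv j) with h | h
    · right; right; left
      exact ⟨m, (Nat.div_lt_iff_lt_mul hqp).1 h, by omega, hx⟩
    · rcases Nat.lt_or_ge (m / qq j) (KN j - 1) with h' | h'
      · by_cases hb : x.1 ∈ BB (bk j (m / qq j)) (bk j (m / qq j + 2))
        · left; exact ⟨m / qq j, h, h', hb⟩
        · right; left; exact ⟨m, by omega, ⟨h, h'⟩, hx, hb⟩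
      · right; right; right
        have g1 := (Nat.le_div_iff_mul_le hqp).1 h'
        have g2 : CN j = (KN j - 1) * qq j + qq j := by
          rw [← KN_qq]
          have : 0 < KN j := by unfold KN; positivity
          obtain ⟨a, ha⟩ : ∃ a, KN j = a + 1 := ⟨KN j - 1, by omega⟩
          rw [ha]; simp only [Nat.add_sub_cancel]; ring
        refine ⟨m - (KN j - 1) * qq j, by omega, by omega, ?_⟩
        rw [show (KN j - 1) * qq j + (m - (KN j - 1) * qq j) = m by omega]; exact hx
  have hq : ((qq j : ℕ) : ℝ≥0∞) = T (2 * (uu j : ℤ)) := by unfold qq; rw [T_cast]; push_cast; rfl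
  have b1 : R prof 0 A1 ≤ T (1 - (j:ℤ)) := (log_est j).trans (T_mono (by omega))
  have b2 : R prof 0 A2 ≤ T (1 - (j:ℤ)) := by
    refine (union_range _ _ _ (T (22 - 4 * (uu j : ℤ))) fun m hm => ?_).trans ?_
    · by_cases h : 2 ^ vv j ≤ m / qq j ∧ m / qq j < KN j - 1
      · refine le_trans (measure_mono ?_) (double_est j m (m / qq j) (Nat.div_mul_le_self _ _) ?_
          (by have h2 := h.2; revert h2; generalize m / qq j = k; generalize KN j = K; omega))
        · rintro ω ⟨-, h⟩; exact h
        · rw [mul_comm]; exact Nat.lt_mul_div_succ m (qq_pos j)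
      · refine le_trans (le_of_eq ?_) zero_le
        convert measure_empty (μ := R prof 0)
        ext ω
        constructor
        · rintro ⟨h', -⟩; exact h h'
        · intro h; exact h.elim
    · rw [CN_T, ← T_add]; exact T_mono (by omega)
  have b3 : R prof 0 A3 ≤ T (1 - (j:ℤ)) := by
    refine (union_range _ _ _ (T (12 + j - 3 * (uu j : ℤ))) fun m hm => ?_).trans ?_
    · by_cases h : m + 1 < CN j
      · refine le_trans (measure_mono ?_) (single_est j m h)
        rintro ω ⟨-, h⟩; exact h
      · refine le_trans (le_of_eq ?_) zero_le
        convert measure_empty (μ := R prof 0)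
        ext ω
        constructor
        · rintro ⟨h', -⟩; exact h h'
        · intro h; exact h.elim
    · rw [Nat.cast_mul, T_cast, hq, ← T_add, ← T_add]; exact T_mono (by omega)
  have b4 : R prof 0 A4 ≤ T (1 - (j:ℤ)) := by
    refine (union_range _ _ _ (T (12 + j - 3 * (uu j : ℤ))) fun m hm => ?_).trans ?_
    · by_cases h : (KN j - 1) * qq j + m + 1 < CN j
      · refine le_trans (measure_mono ?_) (single_est j _ h)
        rintro ω ⟨-, h⟩; exact h
      · refine le_trans (le_of_eq ?_) zero_le
        convert measure_empty (μ := R prof 0)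
        ext ω
        constructor
        · rintro ⟨h', -⟩; exact h h'
        · intro h; exact h.elim
    · rw [hq, ← T_add]; exact T_mono (by omega)
  calc PP prof (E3 j) ≤ R prof 0 (A1 ∪ (A2 ∪ (A3 ∪ A4))) := (measure_mono hsub).trans (PP_fst_le _ _)
    _ ≤ R prof 0 A1 + (R prof 0 A2 + (R prof 0 A3 + R prof 0 A4)) :=
        (measure_union_le _ _).trans (add_le_add le_rfl ((measure_union_le _ _).trans
          (add_le_add le_rfl (measure_union_le _ _))))
    _ ≤ T (1 - (j:ℤ)) + (T (1 - (j:ℤ)) + (T (1 - (j:ℤ)) + T (1 - (j:ℤ)))) :=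
        add_le_add b1 (add_le_add b2 (add_le_add b3 b4))
    _ = _ := by ring

end CutWalk

namespace CutWalk
open scoped ENNReal

/-- good trajectories -/
def Good (z : ℕ → ℕ × Finset ℕ) : Prop :=
  (z 0).1 = 0 ∧ (∀ t, (z (t+1)).1 = (z t).1 + 1 ∨ (z (t+1)).1 + 1 = (z t).1) ∧
  (∀ p, ∃ N, ∀ t, N ≤ t → (z t).1 ≠ p) ∧
  ∃ J, ∀ j, J ≤ j → (∀ i, i < CN j → Link (fun t => (z t).1) z (cA j i) (cC j i) (cA j (i+1))) ∧
    (∀ m, m < CN j - 1 → ∀ v, v ∈ ZV j m → ¬ Common (fun t => (z t).1) z (cC j m) (wq j m) v)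

theorem T_sum : ∑' j : ℕ, T (-(j:ℤ)) ≠ ⊤ := by
  have : ∀ j : ℕ, T (-(j:ℤ)) = (2:ℝ≥0∞)⁻¹ ^ j := by
    intro j; rw [T_neg, T_nat, ENNReal.inv_pow]
  simp_rw [this]
  rw [ENNReal.tsum_geometric]
  simp

theorem bc {E : ℕ → Set ((ℕ → ℕ) × (ℕ → Bool))} {c : ℝ≥0∞} (hc : c ≠ ⊤)
    (h : ∀ j : ℕ, PP prof (E j) ≤ c * T (-(j:ℤ))) : ∀ᵐ x ∂(PP prof), ∀ᶠ j in Filter.atTop, x ∉ E j := by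
  refine ae_eventually_notMem (ne_top_of_le_ne_top ?_ (ENNReal.tsum_le_tsum h))
  rw [ENNReal.tsum_mul_left]
  exact ENNReal.mul_ne_top hc T_sum

theorem ae_Good : ∀ᵐ x ∂(PP prof), Good (XX prof x.1 x.2) := by
  have h1 := bc (E := E1) (c := 1) (by simp) (fun j => by rw [one_mul]; exact E1_le j)
  have h4 := bc (E := E4) (c := 1) (by simp) (fun j => by rw [one_mul]; exact E4_le j)
  have h3 := bc (E := E3) (c := 4 * T 1) (ENNReal.mul_ne_top (by simp) (T_ne_top _))
    (fun j => by rw [mul_assoc, ← T_add]; exact E3_le j)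
  have h0 := PP_fst_ae prof (ae_NP prof hHp 0)
  filter_upwards [h0, h1, h3, h4] with x g0 g1 g3 g4
  obtain ⟨J, hJ⟩ := Filter.eventually_atTop.1 (g1.and (g3.and g4))
  refine ⟨g0.1, g0.2.step, fun p => ?_, J, fun j hj => ⟨fun i hi => ?_, fun m hm v hv hcom => ?_⟩⟩
  · obtain ⟨N, hN⟩ := (g0.2.fin p).bddAbove
    exact ⟨N+1, fun t ht h => by have := hN h; omega⟩
  · by_contra h
    exact (hJ j hj).1 ⟨i, hi, h⟩
  · refine (hJ j hj).2.2 ⟨m, hm, v, hv, ?_, hcom⟩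
    by_contra h
    exact (hJ j hj).2.1 ⟨m, hm, h⟩

theorem measurableSet_Good (ψ : ℕ → ℕ × Finset ℕ) : MeasurableSet {ω : ℕ → ℕ | Good fun t => ψ (ω t)} := by
  have hz : ∀ (p : (ℕ × Finset ℕ) → Prop) (i : ℕ), MeasurableSet {ω : ℕ → ℕ | p (ψ (ω i))} := fun p i =>
    (measurable_pi_apply i : Measurable fun ω : ℕ → ℕ => ω i) (MeasurableSet.of_discrete (s := {n : ℕ | p (ψ n)}))
  have hz2 : ∀ (p : (ℕ × Finset ℕ) → (ℕ × Finset ℕ) → Prop) (i j : ℕ),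
      MeasurableSet {ω : ℕ → ℕ | p (ψ (ω i)) (ψ (ω j))} := fun p i j =>
    ((measurable_pi_apply i).prodMk (measurable_pi_apply j) : Measurable fun ω : ℕ → ℕ => (ω i, ω j))
      (MeasurableSet.of_discrete (s := {n : ℕ × ℕ | p (ψ n.1) (ψ n.2)}))
  have hall : ∀ {ι : Type} [Countable ι] {p : ι → (ℕ → ℕ) → Prop}, (∀ i, MeasurableSet {ω | p i ω}) →
      MeasurableSet {ω | ∀ i, p i ω} := fun h => by
    simp only [Set.ofPred_forall]; exact MeasurableSet.iInter h
  have hex : ∀ {ι : Type} [Countable ι] {p : ι → (ℕ → ℕ) → Prop}, (∀ i, MeasurableSet {ω | p i ω}) →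
      MeasurableSet {ω | ∃ i, p i ω} := fun h => by
    simp only [Set.ofPred_exists]; exact MeasurableSet.iUnion h
  have himp : ∀ {q : Prop} {p : (ℕ → ℕ) → Prop}, (MeasurableSet {ω | p ω}) →
      MeasurableSet {ω | q → p ω} := fun {q p} h => by
    by_cases hq : q
    · simpa [hq] using h
    · simp [hq]
  have himp2 : ∀ {q p : (ℕ → ℕ) → Prop}, (MeasurableSet {ω | q ω}) → (MeasurableSet {ω | p ω}) →
      MeasurableSet {ω | q ω → p ω} := fun {q p} hq h => by
    have : {ω | q ω → p ω} = {ω | q ω}ᶜ ∪ {ω | p ω} := by ext ω; simp [imp_iff_not_or]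
    rw [this]; exact hq.compl.union h
  have hc : ∀ q : Prop, MeasurableSet {ω : ℕ → ℕ | q} := fun q => MeasurableSet.const q
  have hand : ∀ {q p : (ℕ → ℕ) → Prop}, (MeasurableSet {ω | q ω}) → (MeasurableSet {ω | p ω}) →
      MeasurableSet {ω | q ω ∧ p ω} := fun h h' => h.inter h'
  have hcell : ∀ (a b : ℕ) s t, MeasurableSet {ω : ℕ → ℕ | ∀ i, s ≤ i → i ≤ t → a < (ψ (ω i)).1 ∧ (ψ (ω i)).1 < b} :=
    fun a b s t => hall fun i => himp (himp (hz (fun v => a < v.1 ∧ v.1 < b) i))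
  have hLink : ∀ α c β : ℕ, MeasurableSet {ω : ℕ → ℕ | Link (fun t => (ψ (ω t)).1) (fun t => ψ (ω t)) α c β} := by
    intro α c β
    unfold Link
    exact hall fun t0 => hall fun t => himp2 (hz (fun v => v.1 = c) t0) (himp2 (hall fun s => himp
      (hz (fun v => v.1 ≠ c) s)) (himp2 (hz (fun v => v.1 = c) t) (hex fun s => hex fun r => hex fun r' =>
        hand (hc (t0 ≤ r)) (hand (hc (s ≤ r')) (hand (hc (s ≤ t)) (hand (hz2 (fun a b => a = b) r r') (hand (hcell α β _ _)
        (hand (hcell α β _ _) (hcell α β _ _)))))))))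
  have hCom : ∀ (p q : ℕ) (v : ℕ × Finset ℕ), MeasurableSet {ω : ℕ → ℕ | ¬ Common (fun t => (ψ (ω t)).1) (fun t => ψ (ω t)) p q v} := by
    intro p q v
    refine MeasurableSet.compl (s := {ω : ℕ → ℕ | Common (fun t => (ψ (ω t)).1) (fun t => ψ (ω t)) p q v}) ?_
    unfold Common
    exact hall fun s => hall fun t => himp (himp2 (hz (fun v => v.1 = p) s) (himp2 (hz (fun v => v.1 = q) t)
      (hex fun i => hand (hc (s ≤ i)) (hand (hc (i ≤ t)) (hz (fun a => a = v) i)))))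
  unfold Good
  exact hand (hz (fun v => v.1 = 0) 0) (hand (hall fun t => hz2 (fun v v' => v.1 = v'.1 + 1 ∨ v.1 + 1 = v'.1) (t+1) t)
    (hand (hall fun p => hex fun N => hall fun t => himp (hz (fun v => v.1 ≠ p) t)) (hex fun J => hall fun j => himp
      (hand (hall fun i => himp (hLink _ _ _)) (hall fun m => himp (hall fun v => himp (hCom _ _ _)))))))

theorem zone_cover {J n : ℕ} (hn : cA J 1 ≤ n) : ∃ j m, J ≤ j ∧ m < CN j - 1 ∧ cA j (m+1) ≤ n ∧ n ≤ zh j m := by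
  obtain ⟨j, hj1, hj2, hj3⟩ : ∃ j, J ≤ j ∧ cA j 1 ≤ n ∧ n < cA (j+1) 1 := by
    have hex : ∃ j, n < cA j 1 := by
      have : ∀ j, j ≤ st j := by
        intro j
        induction j with
        | zero => omega
        | succ j ih => have := st_lt j; omega
      exact ⟨n+1, by have := this (n+1); have := st_le_cA (n+1) 1; omega⟩
    have hs := Nat.find_spec hex
    have hmin := fun m => Nat.find_min (m := m) hex
    have hJ : J < Nat.find hex := by
      by_contra h
      have h2 : cA (Nat.find hex) 1 ≤ cA J 1 := by
        rcases Nat.lt_or_ge (Nat.find hex) J with h' | h'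
        · have h3 := st_mono h'
          have h4 := st_le_cA J 1
          have h5 := cA_le (j := Nat.find hex) (i := 1) (by have := CN_ge (Nat.find hex); omega)
          omega
        · rw [show Nat.find hex = J by omega]
      omega
    refine ⟨Nat.find hex - 1, by omega, ?_, ?_⟩
    · have := hmin (Nat.find hex - 1) (by omega); omega
    · rw [show Nat.find hex - 1 + 1 = Nat.find hex by omega]; exact hs
  have hC := CN_ge j
  by_cases h : cA j (CN j - 1) ≤ n
  · refine ⟨j, CN j - 2, hj1, by omega, ?_, ?_⟩
    · rw [show CN j - 2 + 1 = CN j - 1 by omega]; exact h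
    · unfold zh; rw [if_neg (by omega)]; omega
  · push Not at h
    obtain ⟨k, hk1, hk2, hk3⟩ : ∃ k, k + 2 ≤ CN j - 1 ∧ cA j (k+1) ≤ n ∧ n < cA j (k+2) := by
      have hex : ∃ k, n < cA j (k+2) := ⟨CN j - 3, by rw [show CN j - 3 + 2 = CN j - 1 by omega]; exact h⟩
      have hs := Nat.find_spec hex
      have hmin := fun m => Nat.find_min (m := m) hex
      refine ⟨Nat.find hex, ?_, ?_, hs⟩
      · have := Nat.find_min' hex (show n < cA j (CN j - 3 + 2) by rw [show CN j - 3 + 2 = CN j - 1 by omega]; exact h)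
        omega
      · rcases Nat.eq_zero_or_pos (Nat.find hex) with h0 | h0
        · rw [h0]; exact hj2
        · have := hmin (Nat.find hex - 1) (by omega)
          rw [show Nat.find hex - 1 + 2 = Nat.find hex + 1 by omega] at this
          omega
    exact ⟨j, k, hj1, by omega, hk2, by unfold zh; rw [if_pos (by omega)]; omega⟩

theorem Link.of_inj {V W : Type*} {S : ℕ → ℕ} {z : ℕ → V} {ψ : V → W} (hψ : Function.Injective ψ) {α c β : ℕ}
    (h : Link S (fun t => ψ (z t)) α c β) : Link S z α c β := by
  intro t0 t h0 h1 h2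
  obtain ⟨s, r, r', a1, a2, a3, a4, a5⟩ := h t0 t h0 h1 h2
  exact ⟨s, r, r', a1, a2, a3, hψ a4, a5⟩

theorem good_finite {ψ : ℕ → ℕ × Finset ℕ} (hψ : Function.Injective ψ)
    (hV : ∀ v, (ψ v).2 ⊆ Finset.range (prof.w (ψ v).1)) {ω : ℕ → ℕ} (h : Good fun t => ψ (ω t)) :
    (∀ s, {n | ω n = s}.Finite) ∧ {v : ℕ | (∃ n : ℕ, ω n = v) ∧
            IsCutpoint (SimpleGraph.fromEdgeSet {e : Sym2 ℕ | ∃ n : ℕ, e = s(ω n, ω (n + 1))})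
              (ω 0) v}.Finite := by
  obtain ⟨h0, h1, h2, J, hJ⟩ := h
  have hNP : NP (fun t => (ψ (ω t)).1) := by
    refine ⟨h1, fun p => ?_⟩
    obtain ⟨N, hN⟩ := h2 p
    refine (Set.finite_lt_nat N).subset fun t ht => ?_
    by_contra hc
    exact hN t (by simpa using hc) ht
  refine ⟨fun s => (hNP.fin (ψ s).1).subset fun n hn => ?_, ?_⟩
  · have : ω n = s := hn
    show (ψ (ω n)).1 = (ψ s).1
    rw [this]
  · obtain ⟨N, hN⟩ := hNP.large (cA J 1)
    refine ((Set.finite_lt_nat N).image ω).subset ?_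
    rintro v ⟨⟨n, rfl⟩, hcut⟩
    by_contra hc
    have hn : N ≤ n := by
      by_contra hn
      exact hc ⟨n, by simpa using hn, rfl⟩
    have hlev : cA J 1 ≤ (ψ (ω n)).1 := (hN n hn).le
    obtain ⟨j, m, hj, hm, z1, z2⟩ := zone_cover hlev
    obtain ⟨f1, f2, f3, f4, f5, f6⟩ := zone_facts j m (by omega)
    have hcom := (hJ j hj).2 m hm (ψ (ω n)) (mem_ZV.2 ⟨z1, z2, hV _⟩)
    unfold Common at hcom
    push Not at hcom
    obtain ⟨s, t, hst, hs, ht, hav⟩ := hcom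
    have hL := ((hJ j hj).1 m (by omega)).of_inj hψ
    have hL' : ∃ β', Link (fun t => (ψ (ω t)).1) ω (zh j m) (wq j m) β' := by
      unfold zh wq
      split_ifs with hh
      · exact ⟨_, ((hJ j hj).1 (m+2) hh).of_inj hψ⟩
      · exact ⟨_, ((hJ (j+1) (by omega)).1 1 (by have := CN_ge (j+1); omega)).of_inj hψ⟩
    obtain ⟨β', hL'⟩ := hL'
    exact not_cut (z := ω) (lv := fun v => (ψ v).1) (fun t => rfl) hNP h0 f1 f3 z1 z2 hL hL' hst hs ht
      (fun i a b he => hav i a b (by rw [he])) hcut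

end CutWalk

namespace CutWalk
open scoped ENNReal

variable (π : Prof)

/-- agreement off `c` -/
def Ag (c : ℕ) (x y : Finset ℕ) : Prop := ∀ k, k ≠ c → (k ∈ x ↔ k ∈ y)

theorem Ag.symm {c : ℕ} {x y : Finset ℕ} (h : Ag c x y) : Ag c y x := fun k hk => (h k hk).symm

theorem w_pos {n : ℕ} (h : 0 < n) : 0 < π.w n := by
  have := w_mono_step π (show 1 ≤ n from h)
  have := π.w1
  omega

theorem cc_grow {n : ℕ} (h : π.w (n+1) = π.w n + 1) : cc π n = π.w n := by simp [cc, h]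

theorem cc_flat {n : ℕ} (h : ¬ π.w (n+1) = π.w n + 1) : cc π n < π.w n := by
  simp only [cc, h, if_false]
  refine Nat.mod_lt _ (w_pos π ?_)
  rcases Nat.eq_zero_or_pos n with rfl | h'
  · exfalso; apply h; simp [π.w0, π.w1]
  · exact h'

theorem cc_lt_succ (n : ℕ) : cc π n < π.w (n+1) := by
  by_cases h : π.w (n+1) = π.w n + 1
  · rw [cc_grow π h]; omega
  · have := cc_flat π h; have := w_mono_step π (show n ≤ n+1 by omega); omega

theorem bt_succ_mem {l : ℕ → ℕ} (B : ℕ → Bool) {n : ℕ} (h : l (n+1) = l n + 1 ∨ l (n+1) + 1 = l n) (k : ℕ) :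
    k ∈ bt π l B (n+1) ↔ k < π.w (l (n+1)) ∧ if cc π (ed l n) = k then B n = true else k ∈ bt π l B n := by
  have hm : ∀ t, k ∈ bt π l B t ↔ k < π.w (l t) ∧ bb π l B t k = true := fun t => by
    simp only [bt, Finset.mem_filter, Finset.mem_range]
  rw [hm, hm]
  simp only [bb]
  refine and_congr_right fun hk => ?_
  by_cases hc : cc π (ed l n) = k
  · simp [hc]
  · simp only [hc, if_false]
    rw [iff_and_self]
    intro _
    rcases h with h | h
    · rw [h] at hk
      have he : ed l n = l n := by unfold ed; omega
      rw [he] at hc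
      by_cases hg : π.w (l n + 1) = π.w (l n) + 1
      · rw [cc_grow π hg] at hc; omega
      · rcases π.step (l n) with h' | h'
        · omega
        · exact absurd h' hg
    · have := w_mono_step π (show l (n+1) ≤ l n by omega)
      omega

theorem bit_half {l : ℕ → ℕ} {n : ℕ} (h : l (n+1) = l n + 1 ∨ l (n+1) + 1 = l n) {E : Set (ℕ → Bool)}
    (hE : PreB n E) {x y : Finset ℕ} (hx : ∀ B ∈ E, bt π l B n = x)
    (hy : y ⊆ Finset.range (π.w (l (n+1)))) (hxr : ∀ k ∈ x, k < π.w (l (n+1)))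
    (hc : cc π (ed l n) < π.w (l (n+1))) :
    Q2 (E ∩ {B | bt π l B (n+1) = y}) = if Ag (cc π (ed l n)) x y then Q2 E * 2⁻¹ else 0 := by
  set c := cc π (ed l n) with hcd
  split_ifs with hA
  · have : E ∩ {B | bt π l B (n+1) = y} = E ∩ {B | ∀ i ∈ ({n} : Finset ℕ), B i = decide (c ∈ y)} := by
      ext B
      refine and_congr_right fun hB => ?_
      simp only [Finset.mem_singleton, forall_eq]
      constructor
      · intro (hb : bt π l B (n+1) = y)
        have := bt_succ_mem π B h c
        rw [hb, ← hcd] at this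
        simp only [if_true, hc, true_and] at this
        show B n = decide (c ∈ y)
        rw [Bool.eq_iff_iff, decide_eq_true_iff]; exact this.symm
      · intro (hb : B n = decide (c ∈ y))
        show bt π l B (n+1) = y
        ext k
        rw [bt_succ_mem π B h k, ← hcd, hx B hB]
        by_cases hk : c = k
        · subst hk; simp [hb, hc]
        · simp only [hk, if_false]
          rw [← hA k (Ne.symm hk)]
          exact ⟨fun h => h.2, fun h => ⟨hxr k h, h⟩⟩
    rw [this, Q2_indep hE {n} (by simp)]
    simp
  · convert measure_empty (μ := Q2)
    ext B
    constructor
    · rintro ⟨hB, hb : bt π l B (n+1) = y⟩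
      refine hA fun k hk => ?_
      rw [← hb, bt_succ_mem π B h k, ← hcd, hx B hB]
      simp only [Ne.symm hk, if_false]
      exact ⟨fun h => ⟨hxr k h, h⟩, fun h => h.2⟩
    · intro h; exact h.elim

theorem bit_one {l : ℕ → ℕ} {n : ℕ} (h : l (n+1) = l n + 1 ∨ l (n+1) + 1 = l n) {E : Set (ℕ → Bool)}
    {x y : Finset ℕ} (hx : ∀ B ∈ E, bt π l B n = x)
    (hy : y ⊆ Finset.range (π.w (l (n+1)))) (hxr : ∀ k ∈ x, k < π.w (l (n+1)) + 1)
    (hc : cc π (ed l n) = π.w (l (n+1))) :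
    Q2 (E ∩ {B | bt π l B (n+1) = y}) = if Ag (cc π (ed l n)) x y then Q2 E else 0 := by
  set c := cc π (ed l n) with hcd
  have hk1 : ∀ B ∈ E, ∀ k, k ∈ bt π l B (n+1) ↔ k ≠ c ∧ k ∈ x := by
    intro B hB k
    rw [bt_succ_mem π B h k, ← hcd, hx B hB]
    by_cases hk : c = k
    · subst hk; simp [hc]
    · simp only [hk, if_false]
      constructor
      · intro h; exact ⟨Ne.symm hk, h.2⟩
      · intro h; exact ⟨by have := hxr k h.2; omega, h.2⟩
  have hcy : c ∉ y := fun hh => by have := hy hh; simp at this; omega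
  split_ifs with hA
  · congr 1
    ext B
    refine ⟨fun h => h.1, fun hB => ⟨hB, ?_⟩⟩
    show bt π l B (n+1) = y
    ext k
    rw [hk1 B hB]
    constructor
    · rintro ⟨a, b⟩; exact (hA k a).1 b
    · intro hk
      have : k ≠ c := fun h => hcy (h ▸ hk)
      exact ⟨this, (hA k this).2 hk⟩
  · convert measure_empty (μ := Q2)
    ext B
    constructor
    · rintro ⟨hB, hb : bt π l B (n+1) = y⟩
      refine hA fun k hk => ?_
      rw [← hb, hk1 B hB]
      exact ⟨fun h => ⟨hk, h⟩, fun h => h.2⟩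
    · intro h; exact h.elim

/-- radial transition probability -/
noncomputable def sp (x y : ℕ) : ℝ≥0∞ := if y = x + 1 then up π x else if y + 1 = x then dn π x else 0

theorem R_one (x y : ℕ) : R π x {ω | ω 1 = y} = sp π x y := by
  have hR : ∀ a : ℕ, R π a ((fun ω => consN x ω) ⁻¹' {ω : ℕ → ℕ | ω 1 = y}) = if a = y then 1 else 0 := by
    intro a
    have : ((fun ω => consN x ω) ⁻¹' {ω : ℕ → ℕ | ω 1 = y}) = {ω | ω 0 = y} := by
      ext ω; rfl
    rw [this]
    split_ifs with h
    · subst h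
      have := R_zero π a
      rw [← prob_compl_eq_zero_iff (by measurability)]
      exact this
    · have := R_zero π a
      refine measure_mono_null ?_ this
      intro ω (hω : ω 0 = y) (hc : ω 0 = a)
      omega
  rw [meas_step π x _ (by measurability), hR, hR]
  unfold sp
  by_cases h1 : y = x + 1
  · have : ¬ (x - 1 = y) := by omega
    simp [h1]
  · rw [if_neg (Ne.symm h1), if_neg h1]
    by_cases h2 : y + 1 = x
    · have : x - 1 = y := by omega
      simp [h2, this]
    · rw [if_neg h2]
      by_cases h3 : x = 0
      · subst h3; simp [dn]
      · rw [if_neg (by omega)]; simp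

theorem R_cyl (l : ℕ → ℕ) (n : ℕ) : R π 0 {S | ∀ i ≤ n + 1, S i = l i} =
    R π 0 {S | ∀ i ≤ n, S i = l i} * sp π (l n) (l (n+1)) := by
  have := markov_set π n 0 (l n) {S | ∀ i ≤ n, S i = l i} {ω | ω 1 = l (n+1)} (by measurability)
    (by
      intro ω ω' h
      apply propext
      exact forall_congr' fun i => forall_congr' fun hi => by rw [h i hi])
    (fun ω h => h n le_rfl) (by measurability)
  rw [R_one] at this
  rw [← this]
  congr 1
  ext S
  constructor
  · intro h; exact ⟨fun i hi => h i (by omega), h (n+1) le_rfl⟩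
  · rintro ⟨h1, h2⟩ i hi
    rcases Nat.lt_or_ge n i with h | h
    · rw [show i = n + 1 by omega]; exact h2
    · exact h1 i h

theorem PP_cyl (v : ℕ → ℕ × Finset ℕ) (n : ℕ) : PP π {p | ∀ i ≤ n, XX π p.1 p.2 i = v i} =
    R π 0 {S | ∀ i ≤ n, S i = (v i).1} * Q2 {B | ∀ i ≤ n, bt π (fun i => (v i).1) B i = (v i).2} := by
  rw [← Measure.prod_prod, PP]
  congr 1
  ext ⟨S, B⟩
  simp only [Set.mem_prod]
  constructor
  · intro h
    have h1 : ∀ i ≤ n, S i = (v i).1 := fun i hi => by rw [← h i hi]; rfl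
    refine ⟨h1, fun i hi => ?_⟩
    have := XX_congr π B (t := i) (S := S) (S' := fun i => (v i).1) (fun k hk => h1 k (by omega))
    rw [← h i hi, this]; rfl
  · rintro ⟨h1, h2⟩ i hi
    have := XX_congr π B (t := i) (S := S) (S' := fun i => (v i).1) (fun k hk => h1 k (by omega))
    show XX π S B i = v i
    rw [this]
    exact Prod.ext rfl (h2 i hi)

/-- one-step transition weights -/
noncomputable def tp (x y : ℕ × Finset ℕ) : ℝ≥0∞ :=
  if y.1 = x.1 + 1 then (if Ag (cc π x.1) x.2 y.2 then up π x.1 * 2⁻¹ else 0)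
  else if y.1 + 1 = x.1 then
    (if Ag (cc π y.1) x.2 y.2 then (if π.w x.1 = π.w y.1 + 1 then dn π x.1 else dn π x.1 * 2⁻¹) else 0)
  else 0

theorem PP_step (v : ℕ → ℕ × Finset ℕ) (hv : ∀ i, (v i).2 ⊆ Finset.range (π.w (v i).1)) (n : ℕ) :
    PP π {p | ∀ i ≤ n+1, XX π p.1 p.2 i = v i} = PP π {p | ∀ i ≤ n, XX π p.1 p.2 i = v i} * tp π (v n) (v (n+1)) := by
  rw [PP_cyl, PP_cyl, R_cyl]
  set l : ℕ → ℕ := fun i => (v i).1 with hl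
  set E : Set (ℕ → Bool) := {B | ∀ i ≤ n, bt π l B i = (v i).2} with hEd
  have hE : PreB n E := by
    intro B B' h hB i hi
    rw [← bt_pre π l B B' i (fun k hk => h k (by omega))]
    exact hB i hi
  have hsplit : {B : ℕ → Bool | ∀ i ≤ n+1, bt π l B i = (v i).2} = E ∩ {B | bt π l B (n+1) = (v (n+1)).2} := by
    ext B
    constructor
    · intro h; exact ⟨fun i hi => h i (by omega), h (n+1) le_rfl⟩
    · rintro ⟨h1, h2⟩ i hi
      rcases Nat.lt_or_ge n i with h | h
      · rw [show i = n + 1 by omega]; exact h2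
      · exact h1 i h
  have hx : ∀ B ∈ E, bt π l B n = (v n).2 := fun B hB => hB n le_rfl
  rw [hsplit]
  have hxr : ∀ k ∈ (v n).2, k < π.w (l n) := fun k hk => by simpa using hv n hk
  unfold sp tp
  by_cases h1 : l (n+1) = l n + 1
  · have h1' : (v (n+1)).1 = (v n).1 + 1 := h1
    have he : ed l n = l n := by unfold ed; omega
    have := w_mono_step π (show l n ≤ l n + 1 by omega)
    rw [if_pos h1, if_pos h1', bit_half π (Or.inl h1) hE hx (hv (n+1)) (fun k hk => by
      have := hxr k hk; rw [h1]; omega) (by rw [he, h1]; exact cc_lt_succ π _), he]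
    split_ifs with hA
    · ring
    · simp
  · have h1' : ¬ (v (n+1)).1 = (v n).1 + 1 := h1
    rw [if_neg h1, if_neg h1']
    by_cases h2 : l (n+1) + 1 = l n
    · have h2' : (v (n+1)).1 + 1 = (v n).1 := h2
      have he : ed l n = l (n+1) := by unfold ed; omega
      rw [if_pos h2, if_pos h2']
      by_cases hg : π.w (l n) = π.w (l (n+1)) + 1
      · rw [bit_one π (Or.inr h2) hx (hv (n+1)) (fun k hk => by
          have := hxr k hk; omega) (by rw [he]; exact cc_grow π (by rw [h2]; exact hg)), he]
        have hg' : π.w (v n).1 = π.w (v (n+1)).1 + 1 := hg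
        rw [if_pos hg']
        split_ifs with hA
        · ring
        · simp
      · have hw : π.w (l n) = π.w (l (n+1)) := by
          have := π.step (l (n+1)); rw [h2] at this; omega
        rw [bit_half π (Or.inr h2) hE hx (hv (n+1)) (fun k hk => by
          have := hxr k hk; omega) (by rw [he]; exact cc_flat π (by rw [h2]; exact hg)), he]
        have hg' : ¬ π.w (v n).1 = π.w (v (n+1)).1 + 1 := hg
        rw [if_neg hg']
        split_ifs with hA
        · ring
        · simp
    · have h2' : ¬ (v (n+1)).1 + 1 = (v n).1 := h2
      rw [if_neg h2, if_neg h2']; simp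

end CutWalk

namespace CutWalk
open scoped ENNReal

section graph
variable (π : Prof)

theorem Ag_iff {c : ℕ} {x y : Finset ℕ} : Ag c x y ↔ y = insert c x ∨ y = x.erase c := by
  constructor
  · intro h
    by_cases hc : c ∈ y
    · left; ext k
      by_cases hk : k = c
      · subst hk; simp [hc]
      · simp [hk, h k hk]
    · right; ext k
      by_cases hk : k = c
      · subst hk; simp [hc]
      · simp [hk, h k hk]
  · rintro (rfl | rfl) k hk <;> simp [hk]

def OKV (x : ℕ × Finset ℕ) : Prop := x.2 ⊆ Finset.range (π.w x.1)

def AdjP (x y : ℕ × Finset ℕ) : Prop :=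
  (y.1 = x.1 + 1 ∧ Ag (cc π x.1) x.2 y.2) ∨ (x.1 = y.1 + 1 ∧ Ag (cc π y.1) y.2 x.2)

theorem AdjP.symm {x y : ℕ × Finset ℕ} (h : AdjP π x y) : AdjP π y x := Or.symm h

noncomputable def NU (x : ℕ × Finset ℕ) : Finset (ℕ × Finset ℕ) :=
  {(x.1 + 1, insert (cc π x.1) x.2), (x.1 + 1, x.2.erase (cc π x.1))}

noncomputable def ND (x : ℕ × Finset ℕ) : Finset (ℕ × Finset ℕ) :=
  if x.1 = 0 then ∅ else if π.w x.1 = π.w (x.1 - 1) + 1 then {(x.1 - 1, x.2.erase (cc π (x.1 - 1)))}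
  else {(x.1 - 1, insert (cc π (x.1 - 1)) x.2), (x.1 - 1, x.2.erase (cc π (x.1 - 1)))}

noncomputable def NF (x : ℕ × Finset ℕ) : Finset (ℕ × Finset ℕ) := NU π x ∪ ND π x

theorem pair_ne (n c : ℕ) (s : Finset ℕ) : (n, insert c s) ≠ (n, s.erase c) := by
  intro h
  have h1 := congrArg Prod.snd h
  have h2 : c ∈ s.erase c := by
    rw [← show insert c s = s.erase c from h1]; exact Finset.mem_insert_self _ _
  simp at h2

theorem mem_ND_fst {x y : ℕ × Finset ℕ} (h : y ∈ ND π x) : y.1 + 1 = x.1 := by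
  unfold ND at h
  split_ifs at h with h1 h2
  · simp at h
  · rw [Finset.mem_singleton] at h; rw [h]; simp only; omega
  · simp only [Finset.mem_insert, Finset.mem_singleton] at h
    rcases h with h | h <;> (rw [h]; simp only; omega)

theorem mem_NU_fst {x y : ℕ × Finset ℕ} (h : y ∈ NU π x) : y.1 = x.1 + 1 := by
  simp only [NU, Finset.mem_insert, Finset.mem_singleton] at h
  rcases h with h | h <;> rw [h]

theorem card_NF (x : ℕ × Finset ℕ) : (NF π x).card =
    if x.1 = 0 then 2 else if π.w x.1 = π.w (x.1 - 1) + 1 then 3 else 4 := by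
  unfold NF
  rw [Finset.card_union_of_disjoint]
  · have h1 : (NU π x).card = 2 := Finset.card_pair (pair_ne _ _ _)
    rw [h1]
    unfold ND
    split_ifs with h1 h2
    · simp
    · simp
    · rw [Finset.card_pair (pair_ne _ _ _)]
  · rw [Finset.disjoint_left]
    intro y h h'
    have := mem_ND_fst π h'
    have := mem_NU_fst π h
    omega

theorem NU_ok {x y : ℕ × Finset ℕ} (hx : OKV π x) (h : y ∈ NU π x) : OKV π y := by
  have hc := cc_lt_succ π x.1
  have hw := w_mono_step π (show x.1 ≤ x.1 + 1 by omega)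
  simp only [NU, Finset.mem_insert, Finset.mem_singleton] at h
  rcases h with rfl | rfl <;> intro k hk
  · simp only [Finset.mem_insert] at hk
    rcases hk with rfl | hk
    · simpa using hc
    · have := hx hk; simp at this ⊢; omega
  · have := hx (Finset.mem_of_mem_erase hk); simp at this ⊢; omega

theorem erase_ok {n : ℕ} {s : Finset ℕ} (hx : OKV π (n+1, s)) : OKV π (n, s.erase (cc π n)) := by
  intro k hk
  rw [Finset.mem_erase] at hk
  have h2 := hx hk.2
  simp only [Finset.mem_range] at h2 ⊢
  by_cases h : π.w (n+1) = π.w n + 1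
  · have := cc_grow π h; omega
  · have := π.step n; omega

theorem ND_ok {x y : ℕ × Finset ℕ} (hx : OKV π x) (h : y ∈ ND π x) : OKV π y := by
  obtain ⟨n, s⟩ := x
  unfold ND at h
  split_ifs at h with h1 h2
  · simp at h
  · rw [Finset.mem_singleton] at h; rw [h]
    obtain ⟨m, rfl⟩ : ∃ m, n = m + 1 := ⟨n - 1, by simp only at h1; omega⟩
    exact erase_ok π hx
  · simp only at h1 h2
    obtain ⟨m, rfl⟩ : ∃ m, n = m + 1 := ⟨n - 1, by omega⟩
    simp only [Finset.mem_insert, Finset.mem_singleton] at h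
    rcases h with h | h
    · rw [h]
      simp only [Nat.add_sub_cancel] at h2 ⊢
      have := cc_flat π h2
      intro k hk
      simp only [Finset.mem_insert] at hk
      rcases hk with rfl | hk
      · simpa using this
      · have h2 := hx hk
        have := π.step m
        simp at h2 ⊢; omega
    · rw [h]; exact erase_ok π hx

theorem mem_NF {x y : ℕ × Finset ℕ} (hy : OKV π y) : y ∈ NF π x ↔ AdjP π x y := by
  obtain ⟨n, s⟩ := x
  obtain ⟨m, r⟩ := y
  unfold NF AdjP
  rw [Finset.mem_union]
  refine or_congr ?_ ?_
  · simp only [NU, Finset.mem_insert, Finset.mem_singleton, Prod.mk.injEq, Ag_iff]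
    tauto
  · unfold ND
    simp only
    by_cases h0 : n = 0
    · simp [h0]
    obtain ⟨a, rfl⟩ : ∃ a, n = a + 1 := ⟨n - 1, by omega⟩
    simp only [Nat.add_sub_cancel, h0, if_false]
    by_cases hg : π.w (a+1) = π.w a + 1
    · rw [if_pos hg]
      simp only [Finset.mem_singleton, Prod.mk.injEq]
      constructor
      · rintro ⟨rfl, rfl⟩
        exact ⟨rfl, (Ag_iff.2 (Or.inr rfl)).symm⟩
      · rintro ⟨h1, h2⟩
        obtain rfl : m = a := by omega
        refine ⟨rfl, ?_⟩
        rcases Ag_iff.1 h2.symm with h | h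
        · exfalso
          have : cc π m ∈ r := by rw [h]; exact Finset.mem_insert_self _ _
          have h3 := hy this
          rw [cc_grow π hg] at h3
          simp at h3
        · exact h
    · rw [if_neg hg]
      simp only [Finset.mem_insert, Finset.mem_singleton, Prod.mk.injEq]
      constructor
      · rintro (⟨rfl, h⟩ | ⟨rfl, h⟩)
        · exact ⟨rfl, (Ag_iff.2 (Or.inl h)).symm⟩
        · exact ⟨rfl, (Ag_iff.2 (Or.inr h)).symm⟩
      · rintro ⟨h1, h2⟩
        obtain rfl : m = a := by omega
        rcases Ag_iff.1 h2.symm with h | h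
        · exact Or.inl ⟨rfl, h⟩
        · exact Or.inr ⟨rfl, h⟩

theorem NF_ok {x y : ℕ × Finset ℕ} (hx : OKV π x) (h : y ∈ NF π x) : OKV π y := by
  rcases Finset.mem_union.1 h with h | h
  · exact NU_ok π hx h
  · exact ND_ok π hx h

theorem e13 : (2/3 : ℝ≥0∞) * 2⁻¹ = 3⁻¹ := by
  rw [div_eq_mul_inv, mul_right_comm, ENNReal.mul_inv_cancel (by norm_num) (by norm_num), one_mul]
theorem e14 : (1/2 : ℝ≥0∞) * 2⁻¹ = 4⁻¹ := by
  rw [one_div, ← ENNReal.mul_inv (by norm_num) (by norm_num)]; norm_num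

theorem tp_eq (x y : ℕ × Finset ℕ) : tp π x y = if AdjP π x y then (((NF π x).card : ℕ) : ℝ≥0∞)⁻¹ else 0 := by
  obtain ⟨n, s⟩ := x
  obtain ⟨m, r⟩ := y
  rw [card_NF]
  unfold tp AdjP
  simp only
  by_cases h1 : m = n + 1
  · subst h1
    have h2 : ¬ (n = n + 1 + 1) := by omega
    simp only [if_true, true_and, h2, false_and, or_false]
    split_ifs with hA h0 hg
    · simp [up, h0]
    · simp only [up, h0, hg, if_false, if_true, e13]; norm_num
    · simp only [up, h0, hg, if_false, e14]; norm_num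
    · rfl
  · simp only [h1, if_false, false_and, false_or]
    by_cases h2 : m + 1 = n
    · subst h2
      simp only [if_true, true_and, Nat.add_sub_cancel]
      have : Ag (cc π m) s r ↔ Ag (cc π m) r s := ⟨Ag.symm, Ag.symm⟩
      rw [this]
      have h0 : ¬ (m + 1 = 0) := by omega
      simp only [h0, if_false]
      split_ifs with hA hg
      · simp only [dn, h0, Nat.add_sub_cancel, hg, if_false, if_true]; norm_num
      · simp only [dn, h0, Nat.add_sub_cancel, hg, if_false, e14]; norm_num
      · rfl
    · have h3 : ¬ (n = m + 1) := fun h => h2 h.symm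
      simp [h2, h3]

theorem exists_psi : ∃ ψ : ℕ → ℕ × Finset ℕ, Function.Injective ψ ∧ Set.range ψ = {x | OKV π x} := by
  have : Infinite {x // OKV π x} :=
    Infinite.of_injective (fun n : ℕ => (⟨(n, ∅), by intro k hk; simp at hk⟩ : {x // OKV π x}))
      (fun a b h => congrArg (fun z : {x // OKV π x} => z.1.1) h)
  obtain ⟨e⟩ := nonempty_equiv_of_countable (α := ℕ) (β := {x // OKV π x})
  refine ⟨fun n => (e n).1, fun a b h => e.injective (Subtype.ext h), ?_⟩
  ext x
  constructor
  · rintro ⟨n, rfl⟩; exact (e n).2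
  · intro h; exact ⟨e.symm ⟨x, h⟩, by simp⟩

end graph

section final
variable {π : Prof} {ψ : ℕ → ℕ × Finset ℕ}

/-- the graph, transported to `ℕ` -/
def GG (π : Prof) (ψ : ℕ → ℕ × Finset ℕ) : SimpleGraph ℕ where
  Adj u v := AdjP π (ψ u) (ψ v)
  symm := ⟨fun _ _ h => AdjP.symm π h⟩
  loopless := ⟨fun u h => by rcases h with h | h <;> omega⟩

theorem GG_nbr (hψ : Function.Injective ψ) (hr : Set.range ψ = {x | OKV π x}) (u : ℕ) :
    ((GG π ψ).neighborSet u).Finite ∧ ((GG π ψ).neighborSet u).ncard = (NF π (ψ u)).card := by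
  have hok : ∀ u, OKV π (ψ u) := fun u => by
    have : ψ u ∈ Set.range ψ := ⟨u, rfl⟩
    rw [hr] at this; exact this
  have h1 : (GG π ψ).neighborSet u = ψ ⁻¹' (NF π (ψ u) : Set (ℕ × Finset ℕ)) := by
    ext v
    show AdjP π (ψ u) (ψ v) ↔ ψ v ∈ NF π (ψ u)
    rw [mem_NF π (hok v)]
  rw [h1]
  refine ⟨(Finset.finite_toSet _).preimage hψ.injOn, ?_⟩
  rw [Set.ncard_preimage_of_injective_subset_range hψ, Set.ncard_coe_finset]
  intro y hy
  rw [hr]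
  exact NF_ok π (hok u) hy

theorem GG_conn (hr : Set.range ψ = {x | OKV π x}) (hψ : Function.Injective ψ) : (GG π ψ).Connected := by
  have hok : ∀ u, OKV π (ψ u) := fun u => by
    have : ψ u ∈ Set.range ψ := ⟨u, rfl⟩
    rw [hr] at this; exact this
  obtain ⟨g0, hg0⟩ : (0, ∅) ∈ Set.range ψ := by rw [hr]; intro k hk; simp at hk
  have key : ∀ n u, (ψ u).1 = n → (GG π ψ).Reachable u g0 := by
    intro n
    induction n with
    | zero =>
      intro u hu
      have : u = g0 := by
        apply hψ
        rw [hg0]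
        have h := hok u
        unfold OKV at h
        rw [hu, π.w0] at h
        exact Prod.ext hu (by simpa using h)
      rw [this]
    | succ n ih =>
      intro u hu
      have h := erase_ok π (n := n) (s := (ψ u).2) (by rw [← hu]; exact hok u)
      obtain ⟨v, hv⟩ : (n, (ψ u).2.erase (cc π n)) ∈ Set.range ψ := by rw [hr]; exact h
      have hadj : (GG π ψ).Adj u v := by
        show AdjP π (ψ u) (ψ v)
        rw [hv]
        exact Or.inr ⟨hu, (Ag_iff.2 (Or.inr rfl)).symm⟩
      exact hadj.reachable.trans (ih v (by rw [hv]))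
  refine (SimpleGraph.connected_iff _).2 ⟨fun u v => (key _ u rfl).trans (key _ v rfl).symm, ⟨0⟩⟩

theorem chain_unique {p : ℕ → ℕ → ENNReal} {x : ℕ} {μ ν : Measure (ℕ → ℕ)} (hμ : IsMarkovChain p x μ)
    (hν : IsMarkovChain p x ν) : μ = ν := by
  obtain ⟨i1, a1, a2⟩ := hμ
  obtain ⟨i2, b1, b2⟩ := hν
  have hzero : ∀ (ρ : Measure (ℕ → ℕ)) [IsProbabilityMeasure ρ], ρ {ω | ω 0 = x} = 1 → ∀ y,
      ρ {ω | ω 0 = y} = if y = x then 1 else 0 := by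
    intro ρ _ h y
    split_ifs with hy
    · rw [hy]; exact h
    · rw [← prob_compl_eq_zero_iff (by measurability)] at h
      refine measure_mono_null ?_ h
      intro ω (hω : ω 0 = y) (hc : ω 0 = x)
      omega
  have hcyl : ∀ n (v : ℕ → ℕ), μ {ω | ∀ i ≤ n, ω i = v i} = ν {ω | ∀ i ≤ n, ω i = v i} := by
    intro n v
    induction n with
    | zero =>
      simp only [Nat.le_zero, forall_eq]
      rw [hzero μ a1, hzero ν b1]
    | succ n ih => rw [a2, b2, ih]
  refine ext_of_generate_finite (insert ∅ {E : Set (ℕ → ℕ) | ∃ (n : ℕ) (v : ℕ → ℕ), E = {ω : ℕ → ℕ | ∀ i ≤ n, ω i = v i}}) ?_ ?_ ?_ ?_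
  · refine le_antisymm ?_ (MeasurableSpace.generateFrom_le ?_)
    · refine iSup_le fun i => ?_
      rw [← measurable_iff_comap_le]
      refine @measurable_to_countable' ℕ (ℕ → ℕ) _ _ (MeasurableSpace.generateFrom _) _ fun k => ?_
      have : (fun ω : ℕ → ℕ => ω i) ⁻¹' {k} = ⋃ v : {v : Fin (i+1) → ℕ // v (Fin.last i) = k},
          {ω : ℕ → ℕ | ∀ j ≤ i, ω j = if h : j < i + 1 then v.1 ⟨j, h⟩ else 0} := by
        ext ω
        simp only [Set.mem_preimage, Set.mem_singleton_iff, Set.mem_iUnion]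
        constructor
        · intro h
          refine ⟨⟨fun j => ω j, h⟩, fun j hj => ?_⟩
          rw [dif_pos (by omega)]
        · rintro ⟨v, hv⟩
          have := hv i le_rfl
          rw [dif_pos (by omega)] at this
          rw [this]; exact v.2
      rw [this]
      exact MeasurableSet.iUnion fun v => MeasurableSpace.measurableSet_generateFrom
        (Or.inr ⟨i, _, rfl⟩)
    · rintro E (rfl | ⟨n, v, rfl⟩)
      · exact MeasurableSet.empty
      · measurability
  · rintro E (rfl | ⟨n, v, rfl⟩) F (rfl | ⟨m, u, rfl⟩) hne
    · simp at hne
    · simp at hne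
    · simp at hne
    · right
      obtain ⟨ω, h1, h2⟩ := hne
      refine ⟨max n m, ω, ?_⟩
      ext η
      constructor
      · rintro ⟨k1, k2⟩ i hi
        rcases le_max_iff.1 hi with h | h
        · rw [k1 i h, h1 i h]
        · rw [k2 i h, h2 i h]
      · intro h
        exact ⟨fun i hi => by rw [h i (le_max_of_le_left hi), h1 i hi],
          fun i hi => by rw [h i (le_max_of_le_right hi), h2 i hi]⟩
  · rintro E (rfl | ⟨n, v, rfl⟩)
    · simp
    · exact hcyl n v
  · simp

theorem exists_chain (hψ : Function.Injective ψ) (hr : Set.range ψ = {x | OKV π x}) {g0 : ℕ} (hg0 : ψ g0 = (0, ∅)) :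
    ∃ F : (ℕ × Finset ℕ) → ℕ, (∀ x, OKV π x → ψ (F x) = x) ∧
      IsMarkovChain (fun u u' => if (GG π ψ).Adj u u' then (((GG π ψ).neighborSet u).ncard : ENNReal)⁻¹ else 0) g0
      ((PP π).map fun p t => F (XX π p.1 p.2 t)) := by
  have hok : ∀ u, OKV π (ψ u) := fun u => by
    have : ψ u ∈ Set.range ψ := ⟨u, rfl⟩
    rw [hr] at this; exact this
  have hF : ∀ x, OKV π x → ψ (Function.invFun ψ x) = x := fun x hx => by
    apply Function.invFun_eq
    have : x ∈ Set.range ψ := by rw [hr]; exact hx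
    exact this
  have hX : ∀ S B t, OKV π (XX π S B t) := fun S B t => bt_subset π S B t
  have hm : Measurable fun (p : (ℕ → ℕ) × (ℕ → Bool)) (t : ℕ) => Function.invFun ψ (XX π p.1 p.2 t) :=
    measurable_pi_lambda _ fun t => (measurable_of_countable (Function.invFun ψ)).comp (measurable_XX π t)
  have hiff : ∀ S B t u, Function.invFun ψ (XX π S B t) = u ↔ XX π S B t = ψ u := fun S B t u => by
    constructor
    · rintro rfl; rw [hF _ (hX _ _ _)]
    · intro h; rw [h, Function.leftInverse_invFun hψ u]
  refine ⟨Function.invFun ψ, hF, Measure.isProbabilityMeasure_map hm.aemeasurable, ?_, ?_⟩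
  · rw [Measure.map_apply hm (by measurability), ← prob_compl_eq_zero_iff (hm (by measurability))]
    have := PP_fst_ae π (R_zero π 0)
    refine measure_mono_null ?_ this
    intro p hp (h0 : p.1 0 = 0)
    apply hp
    show Function.invFun ψ (XX π p.1 p.2 0) = g0
    rw [hiff, hg0]
    refine Prod.ext h0 ?_
    show bt π p.1 p.2 0 = ∅
    simp [bt, bb]
  · intro n v
    rw [Measure.map_apply hm (by measurability), Measure.map_apply hm (by measurability)]
    have e : ∀ k, (fun (p : (ℕ → ℕ) × (ℕ → Bool)) (t : ℕ) => Function.invFun ψ (XX π p.1 p.2 t)) ⁻¹'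
        {ω | ∀ i ≤ k, ω i = v i} = {p | ∀ i ≤ k, XX π p.1 p.2 i = ψ (v i)} := by
      intro k
      ext p
      exact forall_congr' fun i => forall_congr' fun _ => hiff _ _ _ _
    rw [e, e, PP_step π (fun i => ψ (v i)) (fun i => hok _), tp_eq, ← (GG_nbr hψ hr _).2]
    rfl

end final
end CutWalk

/-- There exists a connected, bounded-degree graph on the countably
infinite vertex set `ℕ`, with a root `g₀`, such that the simple random walk started at
`g₀` (the Markov chain whose transition kernel at `u` is uniform on the neighbors of `u`)
is transient — almost surely every vertex is visited only finitely often — and yet,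
almost surely, the path of the walk (the subgraph formed by all traversed edges) has
only finitely many cutpoints. -/
theorem exists_graph_with_finitely_many_path_cutpoints :
    ∃ (G : SimpleGraph ℕ) (g₀ : ℕ) (D : ℕ),
      G.Connected ∧
      (∀ v : ℕ, (G.neighborSet v).Finite ∧ (G.neighborSet v).ncard ≤ D) ∧
      (∃ μ : Measure (ℕ → ℕ),
        IsMarkovChain
          (fun u u' => if G.Adj u u' then ((G.neighborSet u).ncard : ENNReal)⁻¹ else 0) g₀ μ) ∧
      ∀ μ : Measure (ℕ → ℕ),
        IsMarkovChain
          (fun u u' => if G.Adj u u' then ((G.neighborSet u).ncard : ENNReal)⁻¹ else 0) g₀ μ →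
        (∀ s : ℕ, ∀ᵐ ω ∂μ, {n : ℕ | ω n = s}.Finite) ∧
        (∀ᵐ ω ∂μ, {v : ℕ | (∃ n : ℕ, ω n = v) ∧
            IsCutpoint (SimpleGraph.fromEdgeSet {e : Sym2 ℕ | ∃ n : ℕ, e = s(ω n, ω (n + 1))})
              g₀ v}.Finite) := by
  open CutWalk in
  obtain ⟨ψ, hψ, hr⟩ := exists_psi prof
  obtain ⟨g0, hg0⟩ : (0, ∅) ∈ Set.range ψ := by rw [hr]; intro k hk; simp at hk
  obtain ⟨F, hF, hch⟩ := exists_chain hψ hr hg0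
  have hok : ∀ u, OKV prof (ψ u) := fun u => by
    have : ψ u ∈ Set.range ψ := ⟨u, rfl⟩
    rw [hr] at this; exact this
  refine ⟨GG prof ψ, g0, 4, GG_conn hr hψ, fun v => ⟨(GG_nbr hψ hr v).1, ?_⟩, ⟨_, hch⟩, fun μ hμ => ?_⟩
  · rw [(GG_nbr hψ hr v).2, card_NF]; split_ifs <;> omega
  · have hgood : ∀ᵐ ω ∂μ, Good fun t => ψ (ω t) := by
      rw [chain_unique hμ hch]
      have hm : Measurable fun (p : (ℕ → ℕ) × (ℕ → Bool)) (t : ℕ) => F (XX prof p.1 p.2 t) :=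
        measurable_pi_lambda _ fun t => (measurable_of_countable F).comp (measurable_XX prof t)
      rw [ae_map_iff hm.aemeasurable (measurableSet_Good ψ)]
      filter_upwards [ae_Good] with p hp
      have : (fun t => ψ (F (XX prof p.1 p.2 t))) = XX prof p.1 p.2 := by
        funext t
        exact hF _ (bt_subset prof p.1 p.2 t)
      rw [this]; exact hp
    have h0 : ∀ᵐ ω ∂μ, ω 0 = g0 := by
      have := hμ.1
      have h := hμ.2.1
      rw [← prob_compl_eq_zero_iff (by measurability)] at h
      exact h
    refine ⟨fun s => ?_, ?_⟩
    · filter_upwards [hgood] with ω h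
      exact (good_finite hψ hok h).1 s
    · filter_upwards [hgood, h0] with ω h h'
      have := (good_finite hψ hok h).2
      rw [h'] at this
      exact this
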